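/- Suppose m,n → ∞ with m/n → μ ∈ (0,∞), P^{(n)} → P weakly, and P^{(n)}_{rs} → P_{rs} ∈ (0,∞) for (r,s) = (1,0), (2,1). Then Kendall's rank correlation of the model bidegree distribution converges: ρ_Ken(f_{2,n}) → ρ_Ken(\bar f_2). -/

import Mathlib

open MeasureTheory ProbabilityTheory Filter
open scoped ENNReal Topology Classical

noncomputable section

/-- The binomial probability mass function `Bin(x,y)(s)`. -/
def binP (x : ℕ) (y : ℝ) (s : ℕ) : ℝ := (x.choose s : ℝ) * y ^ s * (1 - y) ^ (x - s)

/-- Convolution of (mass) functions on `ℕ`. -/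
def conv (f g : ℕ → ℝ) (s : ℕ) : ℝ := ∑ i ∈ Finset.range (s + 1), f i * g (s - i)

/-- Iterated convolution power: `convPow f j` is the `j`-fold convolution of `f`. -/
def convPow (f : ℕ → ℝ) : ℕ → ℕ → ℝ
  | 0 => fun s => if s = 0 then 1 else 0
  | j + 1 => conv f (convPow f j)

/-- The compound Poisson probability mass function `CPoi(lam, f)`, i.e. the law of
`H_1 + ⋯ + H_Λ` where `Λ ~ Poi(lam)` and the `H_k` are i.i.d. with mass function `f`,
independent of `Λ`. -/
def cpoi (lam : ℝ) (f : ℕ → ℝ) (s : ℕ) : ℝ :=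
  ∑' j : ℕ, Real.exp (-lam) * lam ^ j / (j.factorial : ℝ) * convPow f j s

/-- Convolution of (mass) functions on `ℕ × ℕ`. -/
def conv2 (F G : ℕ → ℕ → ℝ) (s t : ℕ) : ℝ :=
  ∑ i ∈ Finset.range (s + 1), ∑ j ∈ Finset.range (t + 1), F i j * G (s - i) (t - j)

/-- Point mass at `(1,1)`, as a mass function on `ℕ × ℕ`. -/
def delta11 (s t : ℕ) : ℝ := if s = 1 ∧ t = 1 then 1 else 0

/-- The cross moment `Q_{rs} = E[(X)_r Y^s]` of a layer type distribution `Q`,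
where `(x)_r` is the falling factorial. -/
def mom (Q : Measure (ℕ × ℝ)) (r s : ℕ) : ℝ :=
  ∫ p, (p.1.descFactorial r : ℝ) * p.2 ^ s ∂Q

/-- The increment distribution `g(s) = ∫ Bin(x-1,y)(s) x P(dx,dy) / P₁₀`. -/
def gInc (P : Measure (ℕ × ℝ)) (s : ℕ) : ℝ :=
  (∫ p, (p.1 : ℝ) * binP (p.1 - 1) p.2 s ∂P) / mom P 1 0

/-- The limiting degree distribution `\bar f_1 = CPoi(μ P₁₀, g)`. -/
def barf1 (mu : ℝ) (P : Measure (ℕ × ℝ)) (s : ℕ) : ℝ :=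
  cpoi (mu * mom P 1 0) (gInc P) s

/-- The distribution `f₂'` of `(D₁', D₂')`:
`f₂'(s,t) = ∫ Bin(x-2,y)(s) Bin(x-2,y)(t) (x)₂ y P(dx,dy) / P₂₁`. -/
def f2p (P : Measure (ℕ × ℝ)) (s t : ℕ) : ℝ :=
  (∫ p, (p.1.descFactorial 2 : ℝ) * p.2 * binP (p.1 - 2) p.2 s * binP (p.1 - 2) p.2 t ∂P) /
    mom P 2 1

/-- The limiting bidegree distribution `\bar f₂ = δ₍₁,₁₎ ∗ (\bar f₁ ⊗ \bar f₁) ∗ f₂'`. -/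
def barf2 (mu : ℝ) (P : Measure (ℕ × ℝ)) : ℕ → ℕ → ℝ :=
  conv2 (conv2 delta11 fun s t => barf1 mu P s * barf1 mu P t) (f2p P)

instance (n : ℕ) : MeasurableSpace (Finset (Fin n)) := ⊤

/-- Bernoulli distribution on `Bool` with success probability `y` (truncated into `[0,1]`). -/
def bern (y : ℝ) : Measure Bool :=
  (PMF.bernoulli (min (Real.toNNReal y) 1) (min_le_right _ _)).toMeasure

instance (y : ℝ) : IsProbabilityMeasure (bern y) :=
  PMF.toMeasure.isProbabilityMeasure _

/-- The distribution of the indicator of one potential edge `e` of a layer with node set `V`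
and strength `y`: Bernoulli(`y`) if `e` is a non-loop pair inside `V`, and surely absent
otherwise. -/
def edgeFactor (n : ℕ) (V : Finset (Fin n)) (y : ℝ) (e : Sym2 (Fin n)) : Measure Bool :=
  if ¬ e.IsDiag ∧ ∀ v ∈ e, v ∈ V then bern y else Measure.dirac false

instance (n : ℕ) (V : Finset (Fin n)) (y : ℝ) (e : Sym2 (Fin n)) :
    IsProbabilityMeasure (edgeFactor n V y e) := by
  unfold edgeFactor; split <;> infer_instance

/-- Conditionally on the node set `V` and strength `y`, each non-loop pair of nodes of `V`
is linked independently with probability `y`. -/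
def edgeMeasure (n : ℕ) (V : Finset (Fin n)) (y : ℝ) : Measure (Sym2 (Fin n) → Bool) :=
  Measure.pi fun e => edgeFactor n V y e

/-- Uniformly random subset of the `n` nodes of size `x`. -/
def vertexMeasure (n x : ℕ) : Measure (Finset (Fin n)) :=
  if h : (Finset.powersetCard x (Finset.univ : Finset (Fin n))).Nonempty then
    (PMF.uniformOfFinset _ h).toMeasure
  else Measure.dirac ∅

/-- A sampled layer: its type `(x,y)`, its node set, and its edge indicators. -/
abbrev Layer (n : ℕ) := (ℕ × ℝ) × Finset (Fin n) × (Sym2 (Fin n) → Bool)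

/-- The distribution of a single layer with type distribution `Q`: the type `(x,y)` is
sampled from `Q`; conditionally on it, the node set is a uniformly random subset of size
`x` of the `n` nodes, and each pair of nodes of the node set is linked independently with
probability `y`. -/
def layerMeasure (n : ℕ) (Q : Measure (ℕ × ℝ)) : Measure (Layer n) :=
  Q.bind fun xy =>
    (vertexMeasure n xy.1).bind fun V =>
      (edgeMeasure n V xy.2).map fun f => (xy, V, f)

instance (n x : ℕ) : IsProbabilityMeasure (vertexMeasure n x) := by
  unfold vertexMeasure; split <;> infer_instance

instance (n : ℕ) (V : Finset (Fin n)) (y : ℝ) : IsProbabilityMeasure (edgeMeasure n V y) := by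
  unfold edgeMeasure; infer_instance

theorem measure_bind_univ_le {α β : Type*} [MeasurableSpace α] [MeasurableSpace β]
    (Q : Measure α) [IsProbabilityMeasure Q] {f : α → Measure β}
    (hf : ∀ a, f a Set.univ ≤ 1) : Q.bind f Set.univ ≤ 1 := by
  rw [Measure.bind, Measure.join_apply MeasurableSet.univ]
  by_cases hmeas : AEMeasurable f Q
  · rw [lintegral_map' (Measure.measurable_coe MeasurableSet.univ).aemeasurable hmeas]
    calc ∫⁻ a, f a Set.univ ∂Q ≤ ∫⁻ _, 1 ∂Q := lintegral_mono hf
      _ = 1 := by simp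
  · rw [Measure.map_of_not_aemeasurable hmeas]; simp

instance (n : ℕ) (Q : Measure (ℕ × ℝ)) [IsProbabilityMeasure Q] :
    IsFiniteMeasure (layerMeasure n Q) := by
  refine ⟨lt_of_le_of_lt ?_ ENNReal.one_lt_top⟩
  refine measure_bind_univ_le Q fun xy => ?_
  refine measure_bind_univ_le _ fun V => ?_
  have hg : Measurable fun f : Sym2 (Fin n) → Bool => ((xy, V, f) : Layer n) :=
    measurable_const.prodMk (measurable_const.prodMk measurable_id)
  rw [Measure.map_apply hg MeasurableSet.univ]
  simp

/-- The Bernoulli random graph superposition model `G_n` with `n` nodes and `m` mutually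
independent layers, each with type distribution `Q`. -/
def modelMeasure (n m : ℕ) (Q : Measure (ℕ × ℝ)) [IsProbabilityMeasure Q] :
    Measure (Fin m → Layer n) :=
  Measure.pi fun _ => layerMeasure n Q

/-- The edge set `E(G_{n,k})` of one layer. -/
def layerEdges {n : ℕ} (L : Layer n) : Finset (Sym2 (Fin n)) :=
  Finset.univ.filter fun e => L.2.2 e = true ∧ ¬ e.IsDiag ∧ ∀ v ∈ e, v ∈ L.2.1

/-- The edge set `E(G_n) = ⋃ₖ E(G_{n,k})` of the superposition graph. -/
def graphEdges {n m : ℕ} (ω : Fin m → Layer n) : Finset (Sym2 (Fin n)) :=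
  Finset.univ.biUnion fun k => layerEdges (ω k)

/-- The degree `deg_{G_n}(i)` of the node with label `i` (labels start from `0`). -/
def deg {n m : ℕ} (ω : Fin m → Layer n) (i : ℕ) : ℕ :=
  ((graphEdges ω).filter fun e => ∃ v : Fin n, v ∈ e ∧ (v : ℕ) = i).card

/-- The event that the first two nodes (labels `0` and `1`) are adjacent in `G_n`. -/
def adjEvent (n m : ℕ) : Set (Fin m → Layer n) :=
  {ω | ∃ e ∈ graphEdges ω, (∃ v : Fin n, v ∈ e ∧ (v : ℕ) = 0) ∧ ∃ v : Fin n, v ∈ e ∧ (v : ℕ) = 1}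

/-- The model bidegree distribution
`f_{2,n}(s,t) = P(deg(1) = s, deg(2) = t ∣ {1,2} ∈ E(G_n))`. -/
def bidegree (n m : ℕ) (Q : Measure (ℕ × ℝ)) [IsProbabilityMeasure Q] (s t : ℕ) : ℝ :=
  ((modelMeasure n m Q)[|adjEvent n m] {ω | deg ω 0 = s ∧ deg ω 1 = t}).toReal

/-- Expectation of `φ(U⁽¹⁾,U⁽²⁾)` where `(U⁽¹⁾,U⁽²⁾)` has mass function `F` on `ℕ²`. -/
def pmean (F : ℕ → ℕ → ℝ) (φ : ℕ → ℕ → ℝ) : ℝ :=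
  ∑' u : ℕ × ℕ, φ u.1 u.2 * F u.1 u.2

/-- Expectation of `φ(U, Z)` where `U = (U⁽¹⁾,U⁽²⁾)` and `Z = (Z⁽¹⁾,Z⁽²⁾)` are independent,
both with mass function `F` on `ℕ²`. -/
def pmean2 (F : ℕ → ℕ → ℝ) (φ : ℕ × ℕ → ℕ × ℕ → ℝ) : ℝ :=
  ∑' u : ℕ × ℕ, ∑' z : ℕ × ℕ, φ u z * F u.1 u.2 * F z.1 z.2

/-- Kendall's rank correlation coefficient
`ρ_Ken(F) = Cor(sgn(U⁽¹⁾-Z⁽¹⁾), sgn(U⁽²⁾-Z⁽²⁾))` of a mass function `F` on `ℕ²`,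
where `(U⁽¹⁾,U⁽²⁾)` and `(Z⁽¹⁾,Z⁽²⁾)` are independent and `F`-distributed. -/
def kendall (F : ℕ → ℕ → ℝ) : ℝ :=
  (pmean2 F (fun u z => Real.sign ((u.1 : ℝ) - z.1) * Real.sign ((u.2 : ℝ) - z.2)) -
      pmean2 F (fun u z => Real.sign ((u.1 : ℝ) - z.1)) *
        pmean2 F (fun u z => Real.sign ((u.2 : ℝ) - z.2))) /
    (Real.sqrt (pmean2 F (fun u z => Real.sign ((u.1 : ℝ) - z.1) ^ 2) -
        pmean2 F (fun u z => Real.sign ((u.1 : ℝ) - z.1)) ^ 2) *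
      Real.sqrt (pmean2 F (fun u z => Real.sign ((u.2 : ℝ) - z.2) ^ 2) -
        pmean2 F (fun u z => Real.sign ((u.2 : ℝ) - z.2)) ^ 2))

/-- The mid-rank function `r_i(x) = (F(-∞,x) + F(-∞,x])/2` of a marginal mass function. -/
def midRank (f : ℕ → ℝ) (x : ℕ) : ℝ :=
  ((∑' u : ℕ, if u < x then f u else 0) + ∑' u : ℕ, if u ≤ x then f u else 0) / 2

/-- Spearman's rank correlation coefficient (mid-rank convention)
`ρ_Spe(F) = Cor(r₁(U⁽¹⁾), r₂(U⁽²⁾))` of a mass function `F` on `ℕ²`,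
where `(U⁽¹⁾,U⁽²⁾)` is `F`-distributed and `r_i` is the mid-rank of the `i`-th marginal. -/
def spearman (F : ℕ → ℕ → ℝ) : ℝ :=
  (pmean F (fun s t => midRank (fun u => ∑' v : ℕ, F u v) s *
        midRank (fun v => ∑' u : ℕ, F u v) t) -
      pmean F (fun s _ => midRank (fun u => ∑' v : ℕ, F u v) s) *
        pmean F (fun _ t => midRank (fun v => ∑' u : ℕ, F u v) t)) /
    (Real.sqrt (pmean F (fun s _ => midRank (fun u => ∑' v : ℕ, F u v) s ^ 2) -
        pmean F (fun s _ => midRank (fun u => ∑' v : ℕ, F u v) s) ^ 2) *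
      Real.sqrt (pmean F (fun _ t => midRank (fun v => ∑' u : ℕ, F u v) t ^ 2) -
        pmean F (fun _ t => midRank (fun v => ∑' u : ℕ, F u v) t) ^ 2))

/-- Scheffé's lemma for mass functions: pointwise convergence of probability mass functions to a
probability mass function implies convergence of expectations of bounded functions. -/
theorem tendsto_tsum_mul_of_tendsto_pmf {ι : Type*} {F : ℕ → ι → ℝ} {G : ι → ℝ}
    (hF0 : ∀ᶠ n in atTop, ∀ i, 0 ≤ F n i) (hF : ∀ᶠ n in atTop, HasSum (F n) 1)
    (hG0 : ∀ i, 0 ≤ G i) (hG : HasSum G 1)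
    (hlim : ∀ i, Tendsto (fun n => F n i) atTop (𝓝 (G i)))
    {φ : ι → ℝ} {C : ℝ} (hφ : ∀ i, |φ i| ≤ C) :
    Tendsto (fun n => ∑' i, φ i * F n i) atTop (𝓝 (∑' i, φ i * G i)) := by
  have hpos : Tendsto (fun n => ∑' i, max (G i - F n i) 0) atTop (𝓝 0) := by
    have := tendsto_tsum_of_dominated_convergence (𝓕 := atTop) (g := fun _ : ι => (0 : ℝ))
      (f := fun n i => max (G i - F n i) 0) (bound := G) hG.summable ?_ ?_
    · simpa using this
    · intro i
      have h : Tendsto (fun n => max (G i - F n i) 0) atTop (𝓝 (max (G i - G i) 0)) :=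
        ((tendsto_const_nhds.sub (hlim i)).max tendsto_const_nhds)
      simpa using h
    · filter_upwards [hF0] with n hn i
      rw [Real.norm_of_nonneg (le_max_right _ _)]
      exact max_le (by linarith [hn i]) (hG0 i)
  have hC : 0 ≤ C ∨ IsEmpty ι := by
    rcases isEmpty_or_nonempty ι with h | ⟨⟨i⟩⟩
    · exact Or.inr h
    · exact Or.inl ((abs_nonneg _).trans (hφ i))
  rcases hC with hC | hE
  swap
  · simp
  have hL1 : Tendsto (fun n => C * (2 * ∑' i, max (G i - F n i) 0)) atTop (𝓝 0) := by
    simpa using (hpos.const_mul 2).const_mul C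
  rw [tendsto_iff_dist_tendsto_zero]
  refine squeeze_zero' (Eventually.of_forall fun _ => dist_nonneg) ?_ hL1
  filter_upwards [hF0, hF] with n hn0 hn
  have hφF : Summable fun i => φ i * F n i := by
    refine Summable.of_norm_bounded (hn.summable.mul_left C) fun i => ?_
    rw [norm_mul, Real.norm_of_nonneg (hn0 i)]
    exact mul_le_mul_of_nonneg_right (hφ i) (hn0 i)
  have hφG : Summable fun i => φ i * G i := by
    refine Summable.of_norm_bounded (hG.summable.mul_left C) fun i => ?_
    rw [norm_mul, Real.norm_of_nonneg (hG0 i)]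
    exact mul_le_mul_of_nonneg_right (hφ i) (hG0 i)
  have hmax : Summable fun i => max (G i - F n i) 0 := by
    refine Summable.of_nonneg_of_le (fun i => le_max_right _ _) (fun i => ?_) hG.summable
    exact max_le (by linarith [hn0 i]) (hG0 i)
  have habs : HasSum (fun i => |F n i - G i|) (2 * ∑' i, max (G i - F n i) 0) := by
    have h := (hn.sub hG).add (hmax.hasSum.mul_left 2)
    simp only [sub_self, zero_add] at h
    refine h.congr_fun fun i => ?_
    rcases le_total (F n i) (G i) with h1 | h1
    · rw [max_eq_left (by linarith), abs_of_nonpos (by linarith)]; ring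
    · rw [max_eq_right (by linarith), abs_of_nonneg (by linarith)]; ring
  rw [Real.dist_eq, ← hφF.tsum_sub hφG, ← habs.tsum_eq, ← tsum_mul_left]
  have hbd : ∀ i, |φ i * F n i - φ i * G i| ≤ C * |F n i - G i| := fun i => by
    rw [← mul_sub, abs_mul]
    exact mul_le_mul_of_nonneg_right (hφ i) (abs_nonneg _)
  have hs : Summable fun i => C * |F n i - G i| := habs.summable.mul_left C
  refine (Real.norm_eq_abs _ ▸ tsum_of_norm_bounded hs.hasSum hbd)

/-- Fourier inversion for absolutely summable double series on the torus. -/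
theorem coeff_eq_integral_torus {H : ℕ × ℕ → ℝ} (hH : Summable fun u => |H u|) (s t : ℕ) :
    (H (s, t) : ℂ) = ∫ p : UnitAddCircle × UnitAddCircle,
      (∑' u : ℕ × ℕ, (H u : ℂ) * (fourier 1 p.1) ^ u.1 * (fourier 1 p.2) ^ u.2) *
        (fourier (-(s : ℤ)) p.1 * fourier (-(t : ℤ)) p.2) := by
  have hpow : ∀ (k : ℕ) (x : UnitAddCircle), (fourier 1 x : ℂ) ^ k = fourier (k : ℤ) x := by
    intro k x
    induction k with
    | zero => simp
    | succ k ih => rw [pow_succ, ih, Nat.cast_succ, fourier_add]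
  have h_int : ∀ k : ℤ, ∫ x : UnitAddCircle, (fourier k x : ℂ) = if k = 0 then 1 else 0 := by
    intro k
    have h := fourierCoeff_fourier (T := 1) k
    have h1 : (∫ x : UnitAddCircle, (fourier k x : ℂ)) =
        fourierCoeff (fourier k : UnitAddCircle → ℂ) 0 := by
      simp [fourierCoeff, AddCircle.volume_eq_smul_haarAddCircle]
    rw [h1, h]
    by_cases hk : k = 0 <;> simp [hk, eq_comm]
  have hterm : ∀ u : ℕ × ℕ, ∀ p : UnitAddCircle × UnitAddCircle,
      (H u : ℂ) * (fourier 1 p.1) ^ u.1 * (fourier 1 p.2) ^ u.2 *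
        (fourier (-(s : ℤ)) p.1 * fourier (-(t : ℤ)) p.2) =
      (H u : ℂ) * (fourier ((u.1 : ℤ) - s) p.1 * fourier ((u.2 : ℤ) - t) p.2) := by
    intro u p
    rw [hpow, hpow, sub_eq_add_neg, sub_eq_add_neg, fourier_add, fourier_add]
    ring
  simp_rw [← tsum_mul_right, hterm]
  have hcont : ∀ u : ℕ × ℕ, Continuous fun p : UnitAddCircle × UnitAddCircle =>
      (H u : ℂ) * (fourier ((u.1 : ℤ) - s) p.1 * fourier ((u.2 : ℤ) - t) p.2) := by
    intro u; fun_prop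
  have hnorm : ∀ (u : ℕ × ℕ) (p : UnitAddCircle × UnitAddCircle),
      ‖(H u : ℂ) * (fourier ((u.1 : ℤ) - s) p.1 * fourier ((u.2 : ℤ) - t) p.2)‖ = |H u| := by
    intro u p
    rw [norm_mul, norm_mul, fourier_apply, fourier_apply, Circle.norm_coe, Circle.norm_coe]
    simp
  have hI := hasSum_integral_of_summable_integral_norm
    (μ := (volume : Measure (UnitAddCircle × UnitAddCircle)))
    (F := fun (u : ℕ × ℕ) (p : UnitAddCircle × UnitAddCircle) =>
      (H u : ℂ) * (fourier ((u.1 : ℤ) - s) p.1 * fourier ((u.2 : ℤ) - t) p.2))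
    (fun u => by
      refine Integrable.of_bound (hcont u).aestronglyMeasurable |H u| ?_
      exact Eventually.of_forall fun p => (hnorm u p).le)
    (by simpa only [hnorm, integral_const, smul_eq_mul] using hH.mul_left _)
  rw [← hI.tsum_eq]
  have hval : ∀ u : ℕ × ℕ, ∫ p : UnitAddCircle × UnitAddCircle,
      (H u : ℂ) * (fourier ((u.1 : ℤ) - s) p.1 * fourier ((u.2 : ℤ) - t) p.2) =
      if u = (s, t) then (H u : ℂ) else 0 := by
    intro u
    rw [integral_const_mul, Measure.volume_eq_prod,
      integral_prod_mul (fun x : UnitAddCircle => (fourier ((u.1 : ℤ) - s) x : ℂ))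
        (fun x : UnitAddCircle => (fourier ((u.2 : ℤ) - t) x : ℂ)), h_int, h_int]
    by_cases h1 : u.1 = s <;> by_cases h2 : u.2 = t <;>
      simp [h1, h2, Prod.ext_iff, sub_eq_zero]
  simp_rw [hval]
  rw [tsum_ite_eq]

/-- Continuity theorem: pointwise convergence of generating functions of mass functions on the
torus implies pointwise convergence of the mass functions. -/
theorem tendsto_pmf_of_tendsto_pgf {F : ℕ → ℕ × ℕ → ℝ} {G : ℕ × ℕ → ℝ}
    (hF0 : ∀ᶠ n in atTop, ∀ i, 0 ≤ F n i) (hF : ∀ᶠ n in atTop, HasSum (F n) 1)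
    (hG0 : ∀ i, 0 ≤ G i) (hG : HasSum G 1)
    (hlim : ∀ z w : ℂ, ‖z‖ = 1 → ‖w‖ = 1 →
      Tendsto (fun n => ∑' u : ℕ × ℕ, (F n u : ℂ) * z ^ u.1 * w ^ u.2) atTop
        (𝓝 (∑' u : ℕ × ℕ, (G u : ℂ) * z ^ u.1 * w ^ u.2))) (u : ℕ × ℕ) :
    Tendsto (fun n => F n u) atTop (𝓝 (G u)) := by
  obtain ⟨s, t⟩ := u
  suffices h : Tendsto (fun n => ((F n (s, t) : ℝ) : ℂ)) atTop (𝓝 ((G (s, t) : ℝ) : ℂ)) by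
    exact (Complex.continuous_re.tendsto _).comp h
  have habs : ∀ {H : ℕ × ℕ → ℝ}, (∀ i, 0 ≤ H i) → HasSum H 1 → HasSum (fun u => |H u|) 1 := by
    intro H h0 h1
    simpa only [abs_of_nonneg (h0 _)] using h1
  have hz : ∀ x : UnitAddCircle, ‖(fourier 1 x : ℂ)‖ = 1 := fun x => by
    rw [fourier_apply, Circle.norm_coe]
  have hnorm : ∀ {H : ℕ × ℕ → ℝ} (p : UnitAddCircle × UnitAddCircle) (u : ℕ × ℕ),
      ‖(H u : ℂ) * (fourier 1 p.1) ^ u.1 * (fourier 1 p.2) ^ u.2‖ = |H u| := by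
    intro H p u
    rw [norm_mul, norm_mul, norm_pow, norm_pow, hz, hz]; simp
  have key : Tendsto (fun n => ∫ p : UnitAddCircle × UnitAddCircle,
      (∑' u : ℕ × ℕ, (F n u : ℂ) * (fourier 1 p.1) ^ u.1 * (fourier 1 p.2) ^ u.2) *
        (fourier (-(s : ℤ)) p.1 * fourier (-(t : ℤ)) p.2)) atTop
      (𝓝 (∫ p : UnitAddCircle × UnitAddCircle,
      (∑' u : ℕ × ℕ, (G u : ℂ) * (fourier 1 p.1) ^ u.1 * (fourier 1 p.2) ^ u.2) *
        (fourier (-(s : ℤ)) p.1 * fourier (-(t : ℤ)) p.2))) := by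
    refine tendsto_integral_filter_of_dominated_convergence (fun _ => 1) ?_ ?_ ?_ ?_
    · filter_upwards [hF0, hF] with n h0 h1
      refine Continuous.aestronglyMeasurable (Continuous.mul ?_ (by fun_prop))
      refine continuous_tsum (u := fun u => |F n u|) (fun u => by fun_prop)
        (habs h0 h1).summable fun u p => (hnorm p u).le
    · filter_upwards [hF0, hF] with n h0 h1
      refine Eventually.of_forall fun p => ?_
      rw [norm_mul]
      have h2 : ‖(fourier (-(s : ℤ)) p.1 * fourier (-(t : ℤ)) p.2 : ℂ)‖ = 1 := by
        rw [norm_mul, fourier_apply, fourier_apply, Circle.norm_coe, Circle.norm_coe, one_mul]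
      rw [h2, mul_one]
      exact tsum_of_norm_bounded (habs h0 h1) fun u => (hnorm p u).le
    · exact integrable_const _
    · refine Eventually.of_forall fun p => ?_
      exact (hlim _ _ (hz _) (hz _)).mul_const _
  have hGs := coeff_eq_integral_torus (habs hG0 hG).summable s t
  rw [← hGs] at key
  refine key.congr' ?_
  filter_upwards [hF0, hF] with n h0 h1
  exact (coeff_eq_integral_torus (habs h0 h1).summable s t).symm

theorem pmean2_eq_tsum_prod {F : ℕ → ℕ → ℝ} (hF0 : ∀ s t, 0 ≤ F s t)
    (hF : Summable fun u : ℕ × ℕ => F u.1 u.2) {φ : ℕ × ℕ → ℕ × ℕ → ℝ} {C : ℝ}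
    (hφ : ∀ u z, |φ u z| ≤ C) :
    Summable (fun p : (ℕ × ℕ) × (ℕ × ℕ) => φ p.1 p.2 * (F p.1.1 p.1.2 * F p.2.1 p.2.2)) ∧
    pmean2 F φ = ∑' p : (ℕ × ℕ) × (ℕ × ℕ), φ p.1 p.2 * (F p.1.1 p.1.2 * F p.2.1 p.2.2) := by
  have hprod : Summable fun p : (ℕ × ℕ) × (ℕ × ℕ) => F p.1.1 p.1.2 * F p.2.1 p.2.2 :=
    hF.mul_of_nonneg hF (fun _ => hF0 _ _) (fun _ => hF0 _ _)
  have hs : Summable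
      (fun p : (ℕ × ℕ) × (ℕ × ℕ) => φ p.1 p.2 * (F p.1.1 p.1.2 * F p.2.1 p.2.2)) := by
    refine Summable.of_norm_bounded (hprod.mul_left C) fun p => ?_
    have h0 : 0 ≤ F p.1.1 p.1.2 * F p.2.1 p.2.2 := mul_nonneg (hF0 _ _) (hF0 _ _)
    rw [norm_mul, Real.norm_of_nonneg h0]
    exact mul_le_mul_of_nonneg_right (hφ _ _) h0
  refine ⟨hs, ?_⟩
  rw [hs.tsum_prod, pmean2]
  simp only [mul_assoc]

theorem hasSum_pmf_prod {F : ℕ → ℕ → ℝ} (hF0 : ∀ s t, 0 ≤ F s t)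
    (hF : HasSum (fun u : ℕ × ℕ => F u.1 u.2) 1) :
    HasSum (fun p : (ℕ × ℕ) × (ℕ × ℕ) => F p.1.1 p.1.2 * F p.2.1 p.2.2) 1 := by
  have hprod : Summable fun p : (ℕ × ℕ) × (ℕ × ℕ) => F p.1.1 p.1.2 * F p.2.1 p.2.2 :=
    hF.summable.mul_of_nonneg hF.summable (fun _ => hF0 _ _) (fun _ => hF0 _ _)
  simpa using hF.mul hF hprod

theorem abs_real_sign_le_one (x : ℝ) : |Real.sign x| ≤ 1 := by
  rcases Real.sign_apply_eq x with h | h | h <;> simp [h]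

theorem pmean2_eq_zero_of_antisymm {F : ℕ → ℕ → ℝ} (hF0 : ∀ s t, 0 ≤ F s t)
    (hF : Summable fun u : ℕ × ℕ => F u.1 u.2) {φ : ℕ × ℕ → ℕ × ℕ → ℝ} {C : ℝ}
    (hφ : ∀ u z, |φ u z| ≤ C) (hanti : ∀ u z, φ z u = -φ u z) : pmean2 F φ = 0 := by
  obtain ⟨-, h⟩ := pmean2_eq_tsum_prod hF0 hF hφ
  have h2 := (Equiv.prodComm (ℕ × ℕ) (ℕ × ℕ)).tsum_eq
    (fun p => φ p.1 p.2 * (F p.1.1 p.1.2 * F p.2.1 p.2.2))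
  have h3 : (∑' c, φ ((Equiv.prodComm (ℕ × ℕ) (ℕ × ℕ)) c).1 ((Equiv.prodComm _ _) c).2 *
      (F ((Equiv.prodComm (ℕ × ℕ) (ℕ × ℕ)) c).1.1 ((Equiv.prodComm (ℕ × ℕ) (ℕ × ℕ)) c).1.2 *
        F ((Equiv.prodComm (ℕ × ℕ) (ℕ × ℕ)) c).2.1 ((Equiv.prodComm (ℕ × ℕ) (ℕ × ℕ)) c).2.2)) =
      -pmean2 F φ := by
    rw [h, ← tsum_neg]
    refine tsum_congr fun c => ?_
    simp only [Equiv.prodComm_apply, Prod.fst_swap, Prod.snd_swap]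
    rw [hanti]; ring
  rw [h3, ← h] at h2
  linarith

theorem pmean2_pos {F : ℕ → ℕ → ℝ} (hF0 : ∀ s t, 0 ≤ F s t)
    (hF : Summable fun u : ℕ × ℕ => F u.1 u.2) {φ : ℕ × ℕ → ℕ × ℕ → ℝ} {C : ℝ}
    (hφ : ∀ u z, |φ u z| ≤ C) (hφ0 : ∀ u z, 0 ≤ φ u z) {u z : ℕ × ℕ} (huz : 0 < φ u z)
    (hu : 0 < F u.1 u.2) (hz : 0 < F z.1 z.2) : 0 < pmean2 F φ := by
  obtain ⟨hs, h⟩ := pmean2_eq_tsum_prod hF0 hF hφ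
  rw [h]
  exact hs.tsum_pos (fun p => mul_nonneg (hφ0 _ _) (mul_nonneg (hF0 _ _) (hF0 _ _))) (u, z)
    (mul_pos huz (mul_pos hu hz))

/-- Kendall's rank correlation is continuous with respect to pointwise convergence of probability
mass functions at limits with nondegenerate marginals. -/
theorem tendsto_kendall_of_tendsto_pmf {F : ℕ → ℕ → ℕ → ℝ} {G : ℕ → ℕ → ℝ}
    (hF0 : ∀ᶠ n in atTop, ∀ s t, 0 ≤ F n s t)
    (hF : ∀ᶠ n in atTop, HasSum (fun u : ℕ × ℕ => F n u.1 u.2) 1)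
    (hG0 : ∀ s t, 0 ≤ G s t) (hG : HasSum (fun u : ℕ × ℕ => G u.1 u.2) 1)
    (hlim : ∀ s t, Tendsto (fun n => F n s t) atTop (𝓝 (G s t)))
    {u z : ℕ × ℕ} (h1 : u.1 ≠ z.1) (h2 : u.2 ≠ z.2) (hu : 0 < G u.1 u.2) (hz : 0 < G z.1 z.2) :
    Tendsto (fun n => kendall (F n)) atTop (𝓝 (kendall G)) := by
  have hcont : ∀ {φ : ℕ × ℕ → ℕ × ℕ → ℝ}, (∀ u z, |φ u z| ≤ 1) →
      Tendsto (fun n => pmean2 (F n) φ) atTop (𝓝 (pmean2 G φ)) := by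
    intro φ hφ
    rw [(pmean2_eq_tsum_prod hG0 hG.summable hφ).2]
    have := tendsto_tsum_mul_of_tendsto_pmf
      (F := fun n (p : (ℕ × ℕ) × (ℕ × ℕ)) => F n p.1.1 p.1.2 * F n p.2.1 p.2.2)
      (hF0.mono fun n h p => mul_nonneg (h _ _) (h _ _))
      ((hF0.and hF).mono fun n h => hasSum_pmf_prod h.1 h.2)
      (fun p => mul_nonneg (hG0 _ _) (hG0 _ _)) (hasSum_pmf_prod hG0 hG)
      (fun p => (hlim _ _).mul (hlim _ _)) (φ := fun p => φ p.1 p.2) (C := 1) (fun p => hφ _ _)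
    refine this.congr' ?_
    filter_upwards [hF0, hF] with n h0 h1
    exact (pmean2_eq_tsum_prod h0 h1.summable hφ).2.symm
  have hs := abs_real_sign_le_one
  have hsq : ∀ x : ℝ, |Real.sign x ^ 2| ≤ 1 := fun x => by
    rw [abs_pow]; exact pow_le_one₀ (abs_nonneg _) (hs x)
  have hanti : ∀ x y : ℝ, Real.sign (x - y) = -Real.sign (y - x) := fun x y => by
    rw [← Real.sign_neg, neg_sub]
  have hsgn : ∀ {x y : ℕ}, x ≠ y → 0 < Real.sign ((x : ℝ) - y) ^ 2 := by
    intro x y hxy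
    have : Real.sign ((x : ℝ) - y) ≠ 0 := by
      rw [Ne, Real.sign_eq_zero_iff, sub_eq_zero]; exact_mod_cast hxy
    positivity
  have hz1 : pmean2 G (fun u z => Real.sign ((u.1 : ℝ) - z.1)) = 0 :=
    pmean2_eq_zero_of_antisymm hG0 hG.summable (fun u z => hs _) (fun u z => hanti _ _)
  have hz2 : pmean2 G (fun u z => Real.sign ((u.2 : ℝ) - z.2)) = 0 :=
    pmean2_eq_zero_of_antisymm hG0 hG.summable (fun u z => hs _) (fun u z => hanti _ _)
  have hp1 : 0 < pmean2 G (fun u z => Real.sign ((u.1 : ℝ) - z.1) ^ 2) :=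
    pmean2_pos hG0 hG.summable (fun u z => hsq _) (fun u z => sq_nonneg _) (hsgn h1) hu hz
  have hp2 : 0 < pmean2 G (fun u z => Real.sign ((u.2 : ℝ) - z.2) ^ 2) :=
    pmean2_pos hG0 hG.summable (fun u z => hsq _) (fun u z => sq_nonneg _) (hsgn h2) hu hz
  have hm1 := hcont (φ := fun u z => Real.sign ((u.1 : ℝ) - z.1)) (fun u z => hs _)
  have hm2 := hcont (φ := fun u z => Real.sign ((u.2 : ℝ) - z.2)) (fun u z => hs _)
  have hv1 := hcont (φ := fun u z => Real.sign ((u.1 : ℝ) - z.1) ^ 2) (fun u z => hsq _)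
  have hv2 := hcont (φ := fun u z => Real.sign ((u.2 : ℝ) - z.2) ^ 2) (fun u z => hsq _)
  have hc := hcont (φ := fun u z => Real.sign ((u.1 : ℝ) - z.1) * Real.sign ((u.2 : ℝ) - z.2))
    (fun u z => by rw [abs_mul]; exact mul_le_one₀ (hs _) (abs_nonneg _) (hs _))
  unfold kendall
  refine Tendsto.div (hc.sub (hm1.mul hm2))
    (((hv1.sub (hm1.pow 2)).sqrt).mul ((hv2.sub (hm2.pow 2)).sqrt)) ?_
  rw [hz1, hz2]
  have a1 := Real.sqrt_pos.2 hp1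
  have a2 := Real.sqrt_pos.2 hp2
  simpa using ⟨a1.ne', a2.ne'⟩

theorem hasSum_complex_congr {ι : Type*} {f g : ι → ℂ} {a : ℂ} (h : HasSum f a)
    (e : ∀ i, g i = f i) : HasSum g a := by
  rw [funext e]
  exact h

/-- A nonnegative function `F` on `ℕ` has generating function `φ` on the unit circle. -/
structure HasPgf (F : ℕ → ℝ) (φ : ℂ → ℂ) : Prop where
  nonneg : ∀ s, 0 ≤ F s
  hasSum : ∀ z : ℂ, ‖z‖ = 1 → HasSum (fun s => (F s : ℂ) * z ^ s) (φ z)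

/-- A nonnegative function `F` on `ℕ × ℕ` has generating function `φ` on the torus. -/
structure HasPgf2 (F : ℕ → ℕ → ℝ) (φ : ℂ → ℂ → ℂ) : Prop where
  nonneg : ∀ s t, 0 ≤ F s t
  hasSum : ∀ z w : ℂ, ‖z‖ = 1 → ‖w‖ = 1 →
    HasSum (fun u : ℕ × ℕ => (F u.1 u.2 : ℂ) * z ^ u.1 * w ^ u.2) (φ z w)

theorem HasPgf.hasSum_re {F : ℕ → ℝ} {φ : ℂ → ℂ} (h : HasPgf F φ) : HasSum F (φ 1).re := by
  have := Complex.hasSum_re (h.hasSum 1 (by simp))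
  simpa using this

theorem HasPgf2.hasSum_re {F : ℕ → ℕ → ℝ} {φ : ℂ → ℂ → ℂ} (h : HasPgf2 F φ) :
    HasSum (fun u : ℕ × ℕ => F u.1 u.2) (φ 1 1).re := by
  have := Complex.hasSum_re (h.hasSum 1 1 (by simp) (by simp))
  simpa using this

theorem HasPgf.norm_term {F : ℕ → ℝ} {φ : ℂ → ℂ} (h : HasPgf F φ) {z : ℂ} (hz : ‖z‖ = 1) (s : ℕ) :
    ‖(F s : ℂ) * z ^ s‖ = F s := by
  rw [norm_mul, norm_pow, hz, one_pow, mul_one, Complex.norm_real, Real.norm_of_nonneg (h.nonneg s)]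

theorem HasPgf2.norm_term {F : ℕ → ℕ → ℝ} {φ : ℂ → ℂ → ℂ} (h : HasPgf2 F φ) {z w : ℂ}
    (hz : ‖z‖ = 1) (hw : ‖w‖ = 1) (u : ℕ × ℕ) :
    ‖(F u.1 u.2 : ℂ) * z ^ u.1 * w ^ u.2‖ = F u.1 u.2 := by
  rw [norm_mul, norm_mul, norm_pow, norm_pow, hz, hw, one_pow, one_pow, mul_one, mul_one,
    Complex.norm_real, Real.norm_of_nonneg (h.nonneg _ _)]

theorem HasPgf.congr {F : ℕ → ℝ} {φ ψ : ℂ → ℂ} (h : HasPgf F φ) (hφ : ∀ z, φ z = ψ z) :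
    HasPgf F ψ := by
  obtain rfl : φ = ψ := funext hφ
  exact h

theorem HasPgf.conv {F G : ℕ → ℝ} {φ ψ : ℂ → ℂ} (hF : HasPgf F φ) (hG : HasPgf G ψ) :
    HasPgf (conv F G) (fun z => φ z * ψ z) := by
  refine ⟨fun s => Finset.sum_nonneg fun i _ => mul_nonneg (hF.nonneg _) (hG.nonneg _), ?_⟩
  intro z hz
  have hFn : Summable fun s => ‖(F s : ℂ) * z ^ s‖ := by
    simpa only [hF.norm_term hz] using hF.hasSum_re.summable
  have hGn : Summable fun s => ‖(G s : ℂ) * z ^ s‖ := by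
    simpa only [hG.norm_term hz] using hG.hasSum_re.summable
  have hs := (summable_norm_sum_mul_range_of_summable_norm hFn hGn).of_norm
  have ht := tsum_mul_tsum_eq_tsum_sum_range_of_summable_norm hFn hGn
  rw [(hF.hasSum z hz).tsum_eq, (hG.hasSum z hz).tsum_eq] at ht
  show HasSum _ (φ z * ψ z)
  rw [ht]
  refine hasSum_complex_congr hs.hasSum fun s => ?_
  rw [_root_.conv, Complex.ofReal_sum, Finset.sum_mul]
  refine Finset.sum_congr rfl fun i hi => ?_
  have hi' : i ≤ s := Nat.lt_succ_iff.1 (Finset.mem_range.1 hi)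
  conv_lhs => rw [← Nat.add_sub_cancel' hi', pow_add]
  rw [Nat.add_sub_cancel' hi']
  push_cast
  ring

theorem HasPgf.convPow {F : ℕ → ℝ} {φ : ℂ → ℂ} (hF : HasPgf F φ) (j : ℕ) :
    HasPgf (convPow F j) (fun z => φ z ^ j) := by
  induction j with
  | zero =>
    refine ⟨fun s => ?_, fun z _ => ?_⟩
    · simp only [_root_.convPow]; split <;> norm_num
    · have := hasSum_ite_eq (0 : ℕ) (1 : ℂ)
      simp only [pow_zero]
      refine hasSum_complex_congr this fun s => ?_
      by_cases hs : s = 0 <;> simp [_root_.convPow, hs]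
  | succ j ih =>
    exact (hF.conv ih).congr fun z => (pow_succ' _ _).symm

theorem hasPgf_mixture {v : ℕ → ℝ} {H : ℕ → ℕ → ℝ} {ψ : ℕ → ℂ → ℂ} {Ψ : ℂ → ℂ}
    (hv : ∀ j, 0 ≤ v j) (hH : ∀ j, HasPgf (H j) (ψ j))
    (hΨ : ∀ z : ℂ, ‖z‖ = 1 → HasSum (fun j => (v j : ℂ) * ψ j z) (Ψ z)) :
    HasPgf (fun s => ∑' j, v j * H j s) Ψ := by
  have h0 : ∀ p : ℕ × ℕ, 0 ≤ v p.1 * H p.1 p.2 := fun p => mul_nonneg (hv _) ((hH _).nonneg _)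
  have hre : ∀ j, HasSum (fun s => v j * H j s) (v j * (ψ j 1).re) := fun j =>
    (hH j).hasSum_re.mul_left _
  have hsum : Summable fun p : ℕ × ℕ => v p.1 * H p.1 p.2 := by
    refine (summable_prod_of_nonneg h0).2 ⟨fun j => (hre j).summable, ?_⟩
    have h1 := (Complex.hasSum_re (hΨ 1 (by simp))).summable
    refine h1.congr fun j => ?_
    rw [(hre j).tsum_eq, Complex.re_ofReal_mul]
  have hcol : ∀ s, Summable fun j : ℕ => v j * H j s := fun s =>
    hsum.comp_injective (i := fun j => (j, s)) fun a b h => by simpa using h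
  refine ⟨fun s => tsum_nonneg fun j => h0 (j, s), fun z hz => ?_⟩
  have hC : Summable fun p : ℕ × ℕ => ((v p.1 * H p.1 p.2 : ℝ) : ℂ) * z ^ p.2 := by
    refine Summable.of_norm (hsum.congr fun p => ?_)
    rw [norm_mul, norm_pow, hz, one_pow, mul_one, Complex.norm_real, Real.norm_of_nonneg (h0 p)]
  have hrow : ∀ j, HasSum (fun s => ((v j * H j s : ℝ) : ℂ) * z ^ s) ((v j : ℂ) * ψ j z) := by
    intro j
    refine hasSum_complex_congr (((hH j).hasSum z hz).mul_left (v j : ℂ)) fun s => ?_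
    push_cast; ring
  have hval : HasSum (fun p : ℕ × ℕ => ((v p.1 * H p.1 p.2 : ℝ) : ℂ) * z ^ p.2) (Ψ z) := by
    rw [(hΨ z hz).unique (hC.hasSum.prod_fiberwise hrow)]
    exact hC.hasSum
  have hswap : HasSum (fun p : ℕ × ℕ => ((v p.2 * H p.2 p.1 : ℝ) : ℂ) * z ^ p.1) (Ψ z) :=
    (Equiv.prodComm ℕ ℕ).hasSum_iff.2 hval
  refine hswap.prod_fiberwise fun s => ?_
  exact (Complex.hasSum_ofReal.2 (hcol s).hasSum).mul_right (z ^ s)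

theorem HasPgf.cpoi {F : ℕ → ℝ} {φ : ℂ → ℂ} (hF : HasPgf F φ) {l : ℝ} (hl : 0 ≤ l) :
    HasPgf (cpoi l F) (fun z => Complex.exp (l * (φ z - 1))) := by
  refine hasPgf_mixture (v := fun j => Real.exp (-l) * l ^ j / (j.factorial : ℝ))
    (H := _root_.convPow F) (ψ := fun j z => φ z ^ j) (fun j => by positivity) hF.convPow ?_
  intro z _
  have h1 := (NormedSpace.expSeries_div_hasSum_exp (𝔸 := ℂ) ((l : ℂ) * φ z)).mul_left
    (Complex.exp (-(l : ℂ)))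
  rw [← Complex.exp_eq_exp_ℂ, ← Complex.exp_add] at h1
  have h2 : -(l : ℂ) + l * φ z = l * (φ z - 1) := by ring
  rw [h2] at h1
  refine hasSum_complex_congr h1 fun j => ?_
  push_cast
  rw [mul_pow]; ring

/-- Pairs of elements of `ℕ × ℕ` with a given sum. -/
abbrev antidiagonalProd : Finset.HasAntidiagonal (ℕ × ℕ) where
  antidiagonal n := (Finset.HasAntidiagonal.antidiagonal n.1 ×ˢ
    Finset.HasAntidiagonal.antidiagonal n.2).map (Equiv.prodProdProdComm ℕ ℕ ℕ ℕ).toEmbedding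
  mem_antidiagonal := by
    rintro ⟨a, b⟩ ⟨⟨c, d⟩, ⟨e, f⟩⟩
    simp only [Finset.mem_map_equiv, Equiv.prodProdProdComm_symm, Equiv.prodProdProdComm_apply,
      Finset.mem_product, Finset.HasAntidiagonal.mem_antidiagonal, Prod.mk_add_mk, Prod.mk.injEq]

theorem sum_antidiagonalProd (f g : ℕ × ℕ → ℂ) (n : ℕ × ℕ) :
    ∑ c ∈ antidiagonalProd.antidiagonal n, f c.1 * g c.2 =
      ∑ i ∈ Finset.range (n.1 + 1), ∑ j ∈ Finset.range (n.2 + 1),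
        f (i, j) * g (n.1 - i, n.2 - j) := by
  have e1 : ∀ (k : ℕ) (h : ℕ × ℕ → ℂ), ∑ c ∈ Finset.HasAntidiagonal.antidiagonal k, h c =
      ∑ i ∈ Finset.range (k + 1), h (i, k - i) := fun k h =>
    Finset.Nat.sum_antidiagonal_eq_sum_range_succ_mk h k
  show Finset.sum ((Finset.HasAntidiagonal.antidiagonal n.1 ×ˢ
    Finset.HasAntidiagonal.antidiagonal n.2).map (Equiv.prodProdProdComm ℕ ℕ ℕ ℕ).toEmbedding) _ = _
  rw [Finset.sum_map, Finset.sum_product, e1]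
  refine Finset.sum_congr rfl fun i _ => ?_
  rw [e1]
  rfl

theorem hasSum_cauchy_prod {f g : ℕ × ℕ → ℂ} {a b : ℂ} (hf : HasSum f a) (hg : HasSum g b)
    (hfn : Summable fun u => ‖f u‖) (hgn : Summable fun u => ‖g u‖) :
    HasSum (fun n : ℕ × ℕ => ∑ i ∈ Finset.range (n.1 + 1), ∑ j ∈ Finset.range (n.2 + 1),
        f (i, j) * g (n.1 - i, n.2 - j)) (a * b) := by
  have hm := summable_mul_of_summable_norm hfn hgn
  have hs := @summable_sum_mul_antidiagonal_of_summable_mul ℂ (ℕ × ℕ) _ antidiagonalProd _ _ f g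
    _ _ hm
  have ht := @Summable.tsum_mul_tsum_eq_tsum_sum_antidiagonal ℂ (ℕ × ℕ) _ antidiagonalProd _ _ f g
    _ _ hf.summable hg.summable hm
  rw [hf.tsum_eq, hg.tsum_eq] at ht
  rw [ht]
  exact hasSum_complex_congr hs.hasSum fun n => (sum_antidiagonalProd f g n).symm

theorem HasPgf2.conv2 {F G : ℕ → ℕ → ℝ} {φ ψ : ℂ → ℂ → ℂ} (hF : HasPgf2 F φ) (hG : HasPgf2 G ψ) :
    HasPgf2 (conv2 F G) (fun z w => φ z w * ψ z w) := by
  refine ⟨fun s t => Finset.sum_nonneg fun i _ => Finset.sum_nonneg fun j _ =>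
    mul_nonneg (hF.nonneg _ _) (hG.nonneg _ _), ?_⟩
  intro z w hz hw
  have hFn : Summable fun u : ℕ × ℕ => ‖(F u.1 u.2 : ℂ) * z ^ u.1 * w ^ u.2‖ := by
    simpa only [hF.norm_term hz hw] using hF.hasSum_re.summable
  have hGn : Summable fun u : ℕ × ℕ => ‖(G u.1 u.2 : ℂ) * z ^ u.1 * w ^ u.2‖ := by
    simpa only [hG.norm_term hz hw] using hG.hasSum_re.summable
  refine hasSum_complex_congr (hasSum_cauchy_prod (hF.hasSum z w hz hw) (hG.hasSum z w hz hw)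
    hFn hGn) fun n => ?_
  rw [_root_.conv2, Complex.ofReal_sum, Finset.sum_mul, Finset.sum_mul]
  refine Finset.sum_congr rfl fun i hi => ?_
  rw [Complex.ofReal_sum, Finset.sum_mul, Finset.sum_mul]
  refine Finset.sum_congr rfl fun j hj => ?_
  have hi' : i ≤ n.1 := Nat.lt_succ_iff.1 (Finset.mem_range.1 hi)
  have hj' : j ≤ n.2 := Nat.lt_succ_iff.1 (Finset.mem_range.1 hj)
  have ez : z ^ n.1 = z ^ i * z ^ (n.1 - i) := by rw [← pow_add, Nat.add_sub_cancel' hi']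
  have ew : w ^ n.2 = w ^ j * w ^ (n.2 - j) := by rw [← pow_add, Nat.add_sub_cancel' hj']
  rw [ez, ew]
  push_cast
  ring

theorem HasPgf.tensor {F G : ℕ → ℝ} {φ ψ : ℂ → ℂ} (hF : HasPgf F φ) (hG : HasPgf G ψ) :
    HasPgf2 (fun s t => F s * G t) (fun z w => φ z * ψ w) := by
  refine ⟨fun s t => mul_nonneg (hF.nonneg _) (hG.nonneg _), fun z w hz hw => ?_⟩
  have hFn : Summable fun s => ‖(F s : ℂ) * z ^ s‖ := by
    simpa only [hF.norm_term hz] using hF.hasSum_re.summable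
  have hGn : Summable fun s => ‖(G s : ℂ) * w ^ s‖ := by
    simpa only [hG.norm_term hw] using hG.hasSum_re.summable
  have h1 := summable_mul_of_summable_norm hFn hGn
  have h2 := (hF.hasSum z hz).mul (hG.hasSum w hw) h1
  have h3 : (fun u : ℕ × ℕ => ((F u.1 * G u.2 : ℝ) : ℂ) * z ^ u.1 * w ^ u.2) =
    fun x => (F x.1 : ℂ) * z ^ x.1 * (G x.2 * w ^ x.2) := by
    funext u
    push_cast; ring
  show HasSum (fun u : ℕ × ℕ => ((F u.1 * G u.2 : ℝ) : ℂ) * z ^ u.1 * w ^ u.2) (φ z * ψ w)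
  rw [h3]
  exact h2

theorem hasPgf2_delta11 : HasPgf2 delta11 (fun z w => z * w) := by
  refine ⟨fun s t => ?_, fun z w _ _ => ?_⟩
  · unfold delta11; split <;> norm_num
  · refine hasSum_complex_congr (hasSum_ite_eq ((1, 1) : ℕ × ℕ) (z * w)) fun u => ?_
    by_cases h : u = (1, 1)
    · subst h; simp [delta11]
    · have : ¬ (u.1 = 1 ∧ u.2 = 1) := fun h' => h (Prod.ext h'.1 h'.2)
      simp [delta11, h, this]

theorem binP_nonneg {x : ℕ} {y : ℝ} (hy : y ∈ Set.Icc (0 : ℝ) 1) (s : ℕ) : 0 ≤ binP x y s := by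
  have h1 := hy.1
  have h2 : 0 ≤ 1 - y := sub_nonneg.2 hy.2
  unfold binP; positivity

theorem hasSum_binP (x : ℕ) (y : ℝ) (z : ℂ) :
    HasSum (fun s => (binP x y s : ℂ) * z ^ s) ((1 - y + y * z) ^ x) := by
  have h : HasSum (fun s => (binP x y s : ℂ) * z ^ s)
      (∑ s ∈ Finset.range (x + 1), (binP x y s : ℂ) * z ^ s) :=
    hasSum_sum_of_ne_finset_zero fun s hs => by
      have : x < s := by simpa using hs
      simp [binP, Nat.choose_eq_zero_of_lt this]
  convert h using 1
  rw [add_comm, add_pow]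
  refine Finset.sum_congr rfl fun s _ => ?_
  simp only [binP]
  push_cast
  rw [mul_pow]; ring

theorem hasPgf_binP (x : ℕ) {y : ℝ} (hy : y ∈ Set.Icc (0 : ℝ) 1) :
    HasPgf (binP x y) (fun z => (1 - y + y * z) ^ x) :=
  ⟨binP_nonneg hy, fun z _ => hasSum_binP x y z⟩

theorem continuous_binP (x s : ℕ) : Continuous fun y => binP x y s := by
  unfold binP; fun_prop

/-- Generating functions of mixtures are mixtures of generating functions. -/
theorem hasSum_integral_mixture {α ι : Type*} [MeasurableSpace α] [Countable ι] {P : Measure α}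
    {k : ι → α → ℝ} (hk : ∀ i, AEStronglyMeasurable (k i) P) (h0 : ∀ᵐ p ∂P, ∀ i, 0 ≤ k i p)
    {K : α → ℝ} (hK : ∀ᵐ p ∂P, HasSum (fun i => k i p) (K p)) (hKi : Integrable K P)
    {c : ι → ℂ} (hc : ∀ i, ‖c i‖ = 1) {Φ : α → ℂ}
    (hΦ : ∀ᵐ p ∂P, HasSum (fun i => (k i p : ℂ) * c i) (Φ p)) :
    HasSum (fun i => ((∫ p, k i p ∂P : ℝ) : ℂ) * c i) (∫ p, Φ p ∂P) := by
  have h := hasSum_integral_of_dominated_convergence (μ := P) (F := fun i p => (k i p : ℂ) * c i)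
    (f := Φ) (fun i p => k i p) (fun i => ?_) (fun i => ?_) ?_ ?_ hΦ
  · refine hasSum_complex_congr h fun i => ?_
    rw [integral_mul_const, integral_complex_ofReal]
  · exact (Complex.continuous_ofReal.comp_aestronglyMeasurable (hk i)).mul_const _
  · filter_upwards [h0] with p hp
    rw [norm_mul, hc, mul_one, Complex.norm_real, Real.norm_of_nonneg (hp i)]
  · exact hK.mono fun p hp => hp.summable
  · exact hKi.congr (hK.mono fun p hp => hp.tsum_eq.symm)

theorem measurable_of_continuous_snd {E : Type*} [TopologicalSpace E] [MeasurableSpace E]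
    [BorelSpace E] {f : ℕ × ℝ → E} (hf : ∀ x, Continuous fun y => f (x, y)) : Measurable f :=
  (continuous_prod_of_discrete_left.2 hf).measurable

theorem hasPgf_gInc {P : Measure (ℕ × ℝ)} (hP : ∀ᵐ p ∂P, p.2 ∈ Set.Icc (0 : ℝ) 1)
    (h_int : Integrable (fun p : ℕ × ℝ => (p.1 : ℝ)) P) :
    HasPgf (gInc P) (fun z =>
      (∫ p, (p.1 : ℂ) * (1 - p.2 + p.2 * z) ^ (p.1 - 1) ∂P) / (mom P 1 0 : ℂ)) := by
  have hm : 0 ≤ mom P 1 0 := by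
    refine integral_nonneg fun p => ?_
    simp
  constructor
  · intro s
    refine div_nonneg (integral_nonneg_of_ae ?_) hm
    filter_upwards [hP] with p hp
    exact mul_nonneg (Nat.cast_nonneg _) (binP_nonneg hp s)
  · intro z hz
    have h := hasSum_integral_mixture (P := P) (k := fun s p => (p.1 : ℝ) * binP (p.1 - 1) p.2 s)
      (K := fun p => p.1) (c := fun s => z ^ s)
      (Φ := fun p => (p.1 : ℂ) * (1 - p.2 + p.2 * z) ^ (p.1 - 1)) ?_ ?_ ?_ h_int ?_ ?_
    · refine hasSum_complex_congr (h.div_const (mom P 1 0 : ℂ)) fun s => ?_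
      simp only [gInc]; push_cast; ring
    · intro s
      refine (measurable_of_continuous_snd fun x => ?_).aestronglyMeasurable
      have := continuous_binP (x - 1) s
      show Continuous fun y : ℝ => (x : ℝ) * binP (x - 1) y s
      fun_prop
    · filter_upwards [hP] with p hp s
      exact mul_nonneg (Nat.cast_nonneg _) (binP_nonneg hp s)
    · filter_upwards [hP] with p hp
      have := (hasPgf_binP (p.1 - 1) hp).hasSum_re.mul_left (p.1 : ℝ)
      simpa using this
    · intro s; simp [hz]
    · refine Eventually.of_forall fun p => ?_
      refine hasSum_complex_congr ((hasSum_binP (p.1 - 1) p.2 z).mul_left (p.1 : ℂ)) fun s => ?_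
      push_cast; ring

theorem hasPgf2_f2p {P : Measure (ℕ × ℝ)} (hP : ∀ᵐ p ∂P, p.2 ∈ Set.Icc (0 : ℝ) 1)
    (h_int : Integrable (fun p : ℕ × ℝ => (p.1.descFactorial 2 : ℝ) * p.2) P) :
    HasPgf2 (f2p P) (fun z w =>
      (∫ p, (p.1.descFactorial 2 : ℂ) * p.2 * (1 - p.2 + p.2 * z) ^ (p.1 - 2) *
        (1 - p.2 + p.2 * w) ^ (p.1 - 2) ∂P) / (mom P 2 1 : ℂ)) := by
  have hm : 0 ≤ mom P 2 1 := by
    refine integral_nonneg_of_ae ?_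
    filter_upwards [hP] with p hp
    have := hp.1
    simp only [Pi.zero_apply]
    positivity
  have hk0 : ∀ᵐ p ∂P, ∀ u : ℕ × ℕ, 0 ≤ (p.1.descFactorial 2 : ℝ) * p.2 *
      binP (p.1 - 2) p.2 u.1 * binP (p.1 - 2) p.2 u.2 := by
    filter_upwards [hP] with p hp u
    exact mul_nonneg (mul_nonneg (mul_nonneg (Nat.cast_nonneg _) hp.1) (binP_nonneg hp _))
      (binP_nonneg hp _)
  constructor
  · intro s t
    refine div_nonneg (integral_nonneg_of_ae ?_) hm
    exact hk0.mono fun p hp => hp (s, t)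
  · intro z w hz hw
    have h := hasSum_integral_mixture (P := P) (k := fun (u : ℕ × ℕ) p =>
        (p.1.descFactorial 2 : ℝ) * p.2 * binP (p.1 - 2) p.2 u.1 * binP (p.1 - 2) p.2 u.2)
      (K := fun p => (p.1.descFactorial 2 : ℝ) * p.2) (c := fun u => z ^ u.1 * w ^ u.2)
      (Φ := fun p => (p.1.descFactorial 2 : ℂ) * p.2 * (1 - p.2 + p.2 * z) ^ (p.1 - 2) *
        (1 - p.2 + p.2 * w) ^ (p.1 - 2)) ?_ hk0 ?_ h_int ?_ ?_
    · refine hasSum_complex_congr (h.div_const (mom P 2 1 : ℂ)) fun s => ?_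
      simp only [f2p]; push_cast; ring
    · intro u
      refine (measurable_of_continuous_snd fun x => ?_).aestronglyMeasurable
      have h1 := continuous_binP (x - 2) u.1
      have h2 := continuous_binP (x - 2) u.2
      show Continuous fun y : ℝ =>
        (x.descFactorial 2 : ℝ) * y * binP (x - 2) y u.1 * binP (x - 2) y u.2
      fun_prop
    · filter_upwards [hP] with p hp
      have := (((hasPgf_binP (p.1 - 2) hp).tensor (hasPgf_binP (p.1 - 2) hp)).hasSum_re.mul_left
        ((p.1.descFactorial 2 : ℝ) * p.2))
      simpa [mul_assoc] using this
    · intro s; simp [hz, hw]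
    · filter_upwards [hP] with p hp
      have h := (((hasPgf_binP (p.1 - 2) hp).tensor (hasPgf_binP (p.1 - 2) hp)).hasSum z w hz
        hw).mul_left ((p.1.descFactorial 2 : ℂ) * p.2)
      rw [← mul_assoc] at h
      refine hasSum_complex_congr h fun s => ?_
      push_cast
      generalize (p.1.descFactorial 2 : ℂ) = a
      ring

theorem hasPgf2_barf2 {mu : ℝ} (hmu : 0 ≤ mu) {P : Measure (ℕ × ℝ)}
    (hP : ∀ᵐ p ∂P, p.2 ∈ Set.Icc (0 : ℝ) 1)
    (hint10 : Integrable (fun p : ℕ × ℝ => (p.1 : ℝ)) P) (h10 : 0 < mom P 1 0)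
    (hint21 : Integrable (fun p : ℕ × ℝ => (p.1.descFactorial 2 : ℝ) * p.2) P) :
    HasPgf2 (barf2 mu P) (fun z w => z * w *
      (Complex.exp (mu * ((∫ p, (p.1 : ℂ) * (1 - p.2 + p.2 * z) ^ (p.1 - 1) ∂P) - mom P 1 0)) *
       Complex.exp (mu * ((∫ p, (p.1 : ℂ) * (1 - p.2 + p.2 * w) ^ (p.1 - 1) ∂P) - mom P 1 0))) *
      ((∫ p, (p.1.descFactorial 2 : ℂ) * p.2 * (1 - p.2 + p.2 * z) ^ (p.1 - 2) *
        (1 - p.2 + p.2 * w) ^ (p.1 - 2) ∂P) / (mom P 2 1 : ℂ))) := by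
  have hb : HasPgf (barf1 mu P) (fun z => Complex.exp
      (mu * ((∫ p, (p.1 : ℂ) * (1 - p.2 + p.2 * z) ^ (p.1 - 1) ∂P) - mom P 1 0))) := by
    refine ((hasPgf_gInc hP hint10).cpoi (mul_nonneg hmu h10.le)).congr fun z => ?_
    congr 1
    have : (mom P 1 0 : ℂ) ≠ 0 := by exact_mod_cast h10.ne'
    generalize (∫ p, (p.1 : ℂ) * (1 - p.2 + p.2 * z) ^ (p.1 - 1) ∂P) = I
    push_cast
    field_simp
  exact (hasPgf2_delta11.conv2 (hb.tensor hb)).conv2 (hasPgf2_f2p hP hint21)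

theorem eventually_lt_integral_of_tendsto {Ω : Type*} [MeasurableSpace Ω] [TopologicalSpace Ω]
    [OpensMeasurableSpace Ω] [HasOuterApproxClosed Ω] {μs : ℕ → ProbabilityMeasure Ω}
    {μ : ProbabilityMeasure Ω} (hw : Tendsto μs atTop (𝓝 μ)) {f : Ω → ℝ} (hf : Continuous f)
    (h0 : ∀ p, 0 ≤ f p) (hi : Integrable f (μ : Measure Ω))
    (hin : ∀ n, Integrable f (μs n : Measure Ω)) {a : ℝ} (ha : a < ∫ p, f p ∂(μ : Measure Ω)) :
    ∀ᶠ n in atTop, a < ∫ p, f p ∂(μs n : Measure Ω) := by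
  have key : ∫⁻ p, ENNReal.ofReal (f p) ∂(μ : Measure Ω) ≤
      atTop.liminf fun n => ∫⁻ p, ENNReal.ofReal (f p) ∂(μs n : Measure Ω) :=
    lintegral_le_liminf_lintegral_of_forall_isOpen_measure_le_liminf_measure hf h0
      fun G hG => ProbabilityMeasure.le_liminf_measure_open_of_tendsto hw hG
  rw [← ofReal_integral_eq_lintegral_ofReal hi (Eventually.of_forall h0)] at key
  rcases lt_or_ge a 0 with hneg | hpos
  · exact Eventually.of_forall fun n => hneg.trans_le (integral_nonneg h0)
  · have h1 : ENNReal.ofReal a < atTop.liminf fun n =>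
        ∫⁻ p, ENNReal.ofReal (f p) ∂(μs n : Measure Ω) :=
      ((ENNReal.ofReal_lt_ofReal_iff (hpos.trans_lt ha)).2 ha).trans_le key
    filter_upwards [eventually_lt_of_lt_liminf h1] with n hn
    rw [← ofReal_integral_eq_lintegral_ofReal (hin n) (Eventually.of_forall h0)] at hn
    exact (ENNReal.ofReal_lt_ofReal_iff_of_nonneg hpos).1 hn

/-- Dominated convergence along a weakly convergent sequence of probability measures. -/
theorem tendsto_integral_of_abs_le {Ω : Type*} [MeasurableSpace Ω] [TopologicalSpace Ω]
    [OpensMeasurableSpace Ω] [HasOuterApproxClosed Ω] {μs : ℕ → ProbabilityMeasure Ω}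
    {μ : ProbabilityMeasure Ω} (hw : Tendsto μs atTop (𝓝 μ)) {f h : Ω → ℝ} (hf : Continuous f)
    (hh : Continuous h) (hle : ∀ p, |h p| ≤ f p)
    (hfi : Integrable f (μ : Measure Ω)) (hfn : ∀ n, Integrable f (μs n : Measure Ω))
    (hhi : Integrable h (μ : Measure Ω)) (hhn : ∀ n, Integrable h (μs n : Measure Ω))
    (hlim : Tendsto (fun n => ∫ p, f p ∂(μs n : Measure Ω)) atTop
      (𝓝 (∫ p, f p ∂(μ : Measure Ω)))) :
    Tendsto (fun n => ∫ p, h p ∂(μs n : Measure Ω)) atTop (𝓝 (∫ p, h p ∂(μ : Measure Ω))) := by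
  rw [tendsto_order]
  rw [tendsto_order] at hlim
  constructor
  · intro a ha
    set d := ∫ p, h p ∂(μ : Measure Ω) - a with hd
    have h1 := eventually_lt_integral_of_tendsto hw (hf.add hh)
      (fun p => by have := (abs_le.1 (hle p)).1; simp only [Pi.add_apply]; linarith)
      (hfi.add hhi) (fun n => (hfn n).add (hhn n))
      (a := ∫ p, f p ∂(μ : Measure Ω) + ∫ p, h p ∂(μ : Measure Ω) - d / 2)
      (by rw [integral_add' hfi hhi]; linarith)
    filter_upwards [h1, hlim.2 (∫ p, f p ∂(μ : Measure Ω) + d / 2) (by linarith)] with n h2 h3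
    rw [integral_add' (hfn n) (hhn n)] at h2
    linarith
  · intro a ha
    set d := a - ∫ p, h p ∂(μ : Measure Ω) with hd
    have h1 := eventually_lt_integral_of_tendsto hw (hf.sub hh)
      (fun p => by have := (abs_le.1 (hle p)).2; simp only [Pi.sub_apply]; linarith)
      (hfi.sub hhi) (fun n => (hfn n).sub (hhn n))
      (a := ∫ p, f p ∂(μ : Measure Ω) - ∫ p, h p ∂(μ : Measure Ω) - d / 2)
      (by rw [integral_sub' hfi hhi]; linarith)
    filter_upwards [h1, hlim.2 (∫ p, f p ∂(μ : Measure Ω) + d / 2) (by linarith)] with n h2 h3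
    rw [integral_sub' (hfn n) (hhn n)] at h2
    linarith

theorem integrable_of_support_le {E : Type*} [NormedAddCommGroup E] [MeasurableSpace E]
    [BorelSpace E] [SecondCountableTopology E]
    {Q : Measure (ℕ × ℝ)} [IsFiniteMeasure Q] {n : ℕ}
    (hQ : ∀ᵐ p ∂Q, p.1 ≤ n ∧ p.2 ∈ Set.Icc (0 : ℝ) 1) {f : ℕ × ℝ → E}
    (hf : ∀ x, Continuous fun y => f (x, y)) : Integrable f Q := by
  have hK : IsCompact ((Set.Iic n) ×ˢ Set.Icc (0 : ℝ) 1) :=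
    (Set.finite_Iic n).isCompact.prod isCompact_Icc
  have hfc : Continuous f := continuous_prod_of_discrete_left.2 hf
  obtain ⟨C, hC⟩ := hK.exists_bound_of_continuousOn hfc.continuousOn
  refine Integrable.of_bound hfc.measurable.aestronglyMeasurable C ?_
  filter_upwards [hQ] with p hp
  exact hC p ⟨hp.1, hp.2⟩

section WeakConvergence

variable {Pn : ℕ → ProbabilityMeasure (ℕ × ℝ)} {P : ProbabilityMeasure (ℕ × ℝ)}

theorem tendsto_integral_of_dominated (hw : Tendsto Pn atTop (𝓝 P))
    (hs : ∀ n, ∀ᵐ p ∂(Pn n : Measure (ℕ × ℝ)), p.1 ≤ n ∧ p.2 ∈ Set.Icc (0 : ℝ) 1)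
    (hPs : ∀ᵐ p ∂(P : Measure (ℕ × ℝ)), p.2 ∈ Set.Icc (0 : ℝ) 1) {f h : ℕ × ℝ → ℝ}
    (hf : ∀ x, Continuous fun y => f (x, y)) (hh : ∀ x, Continuous fun y => h (x, y))
    (hle : ∀ x, ∀ y ∈ Set.Icc (0 : ℝ) 1, |h (x, y)| ≤ f (x, y))
    (h_int : Integrable f (P : Measure (ℕ × ℝ)))
    (hlim : Tendsto (fun n => ∫ p, f p ∂(Pn n : Measure (ℕ × ℝ))) atTop
      (𝓝 (∫ p, f p ∂(P : Measure (ℕ × ℝ))))) :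
    Tendsto (fun n => ∫ p, h p ∂(Pn n : Measure (ℕ × ℝ))) atTop
      (𝓝 (∫ p, h p ∂(P : Measure (ℕ × ℝ)))) := by
  let c : ℕ × ℝ → ℕ × ℝ := fun p => (p.1, max 0 (min p.2 1))
  have hcc : Continuous c := by unfold c; fun_prop
  have hc : ∀ p : ℕ × ℝ, p.2 ∈ Set.Icc (0 : ℝ) 1 → c p = p := fun p hp => by
    simp [c, hp.1, hp.2]
  have hcm : ∀ p, (c p).2 ∈ Set.Icc (0 : ℝ) 1 := fun p =>
    ⟨le_max_left _ _, max_le zero_le_one (min_le_right _ _)⟩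
  have hfc : Continuous f := continuous_prod_of_discrete_left.2 hf
  have hhc : Continuous h := continuous_prod_of_discrete_left.2 hh
  have hcP : ∀ g : ℕ × ℝ → ℝ, (fun p => g (c p)) =ᵐ[(P : Measure (ℕ × ℝ))] g := fun g =>
    hPs.mono fun p hp => by simp only [hc p hp]
  have hcn : ∀ n (g : ℕ × ℝ → ℝ), (fun p => g (c p)) =ᵐ[(Pn n : Measure (ℕ × ℝ))] g := fun n g =>
    (hs n).mono fun p hp => by simp only [hc p hp.2]
  have hhi : Integrable h (P : Measure (ℕ × ℝ)) := by
    refine h_int.mono' hhc.measurable.aestronglyMeasurable ?_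
    filter_upwards [hPs] with p hp
    exact hle p.1 p.2 hp
  have hle' : ∀ p, |h (c p)| ≤ f (c p) := fun p => hle (c p).1 (c p).2 (hcm p)
  have := tendsto_integral_of_abs_le hw (hfc.comp hcc) (hhc.comp hcc) hle'
    (h_int.congr (hcP f).symm) (fun n => (integrable_of_support_le (hs n) hf).congr (hcn n f).symm)
    (hhi.congr (hcP h).symm) (fun n => (integrable_of_support_le (hs n) hh).congr (hcn n h).symm)
    (by
      simp only [Function.comp_apply]
      rw [integral_congr_ae (hcP f)]
      exact hlim.congr fun n => (integral_congr_ae (hcn n f)).symm)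
  simp only [Function.comp_apply] at this
  rw [integral_congr_ae (hcP h)] at this
  exact this.congr fun n => integral_congr_ae (hcn n h)

theorem tendsto_integral_complex_of_dominated (hw : Tendsto Pn atTop (𝓝 P))
    (hs : ∀ n, ∀ᵐ p ∂(Pn n : Measure (ℕ × ℝ)), p.1 ≤ n ∧ p.2 ∈ Set.Icc (0 : ℝ) 1)
    (hPs : ∀ᵐ p ∂(P : Measure (ℕ × ℝ)), p.2 ∈ Set.Icc (0 : ℝ) 1) {f : ℕ × ℝ → ℝ} {h : ℕ × ℝ → ℂ}
    (hf : ∀ x, Continuous fun y => f (x, y)) (hh : ∀ x, Continuous fun y => h (x, y))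
    (hle : ∀ x, ∀ y ∈ Set.Icc (0 : ℝ) 1, ‖h (x, y)‖ ≤ f (x, y))
    (h_int : Integrable f (P : Measure (ℕ × ℝ)))
    (hlim : Tendsto (fun n => ∫ p, f p ∂(Pn n : Measure (ℕ × ℝ))) atTop
      (𝓝 (∫ p, f p ∂(P : Measure (ℕ × ℝ))))) :
    Tendsto (fun n => ∫ p, h p ∂(Pn n : Measure (ℕ × ℝ))) atTop
      (𝓝 (∫ p, h p ∂(P : Measure (ℕ × ℝ)))) := by
  have hhi : Integrable h (P : Measure (ℕ × ℝ)) := by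
    refine h_int.mono' (measurable_of_continuous_snd hh).aestronglyMeasurable ?_
    filter_upwards [hPs] with p hp
    exact hle p.1 p.2 hp
  have e : ∀ (Q : Measure (ℕ × ℝ)), Integrable h Q →
      ∫ p, h p ∂Q = ((∫ p, (h p).re ∂Q : ℝ) : ℂ) + ((∫ p, (h p).im ∂Q : ℝ) : ℂ) * Complex.I := by
    intro Q hQ
    exact (integral_re_add_im hQ).symm
  rw [e _ hhi]
  have h1 := tendsto_integral_of_dominated hw hs hPs hf (h := fun p => (h p).re)
    (fun x => Complex.continuous_re.comp (hh x))
    (fun x y hy => (Complex.abs_re_le_norm _).trans (hle x y hy)) h_int hlim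
  have h2 := tendsto_integral_of_dominated hw hs hPs hf (h := fun p => (h p).im)
    (fun x => Complex.continuous_im.comp (hh x))
    (fun x y hy => (Complex.abs_im_le_norm _).trans (hle x y hy)) h_int hlim
  refine (((Complex.continuous_ofReal.tendsto _).comp h1).add
    (((Complex.continuous_ofReal.tendsto _).comp h2).mul_const Complex.I)).congr fun n => ?_
  rw [e _ (integrable_of_support_le (hs n) hh)]
  rfl

/-- Under convergence of `E f`, the size-biased moment `E (f X)` is `o(n)` as `X ≤ n`. -/
theorem tendsto_integral_mul_fst_div (hw : Tendsto Pn atTop (𝓝 P))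
    (hs : ∀ n, ∀ᵐ p ∂(Pn n : Measure (ℕ × ℝ)), p.1 ≤ n ∧ p.2 ∈ Set.Icc (0 : ℝ) 1)
    (hPs : ∀ᵐ p ∂(P : Measure (ℕ × ℝ)), p.2 ∈ Set.Icc (0 : ℝ) 1) {f : ℕ × ℝ → ℝ}
    (hf : ∀ x, Continuous fun y => f (x, y))
    (h0 : ∀ x, ∀ y ∈ Set.Icc (0 : ℝ) 1, 0 ≤ f (x, y))
    (h_int : Integrable f (P : Measure (ℕ × ℝ)))
    (hlim : Tendsto (fun n => ∫ p, f p ∂(Pn n : Measure (ℕ × ℝ))) atTop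
      (𝓝 (∫ p, f p ∂(P : Measure (ℕ × ℝ))))) :
    Tendsto (fun n => (∫ p, f p * p.1 ∂(Pn n : Measure (ℕ × ℝ))) / n) atTop (𝓝 0) := by
  let t : ℕ → ℕ × ℝ → ℝ := fun K p => if K < p.1 then f p else 0
  have htc : ∀ K x, Continuous fun y => t K (x, y) := by
    intro K x
    by_cases h : K < x
    · simpa [t, h] using hf x
    · simp only [t, h, if_false]; exact continuous_const
  have ht0 : Tendsto (fun K => ∫ p, t K p ∂(P : Measure (ℕ × ℝ))) atTop (𝓝 0) := by
    have := tendsto_integral_of_dominated_convergence (μ := (P : Measure (ℕ × ℝ))) (F := t)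
      (f := fun _ => 0) (fun p => |f p|)
      (fun K => (measurable_of_continuous_snd (htc K)).aestronglyMeasurable) h_int.abs
      (fun K => Eventually.of_forall fun p => by
        by_cases h : K < p.1 <;> simp [t, h])
      (Eventually.of_forall fun p => by
        refine tendsto_const_nhds.congr' ?_
        filter_upwards [eventually_ge_atTop p.1] with K hK
        simp [t, not_lt.2 hK])
    simpa using this
  have hnn : ∀ n, 0 ≤ (∫ p, f p * p.1 ∂(Pn n : Measure (ℕ × ℝ))) / n := fun n => by
    refine div_nonneg (integral_nonneg_of_ae ?_) (Nat.cast_nonneg _)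
    filter_upwards [hs n] with p hp
    exact mul_nonneg (h0 p.1 p.2 hp.2) (Nat.cast_nonneg _)
  refine tendsto_order.2 ⟨fun a ha => Eventually.of_forall fun n => ha.trans_le (hnn n),
    fun ε hε => ?_⟩
  obtain ⟨K, hK⟩ := ((tendsto_order.1 ht0).2 (ε / 2) (by positivity)).exists
  have h1 := tendsto_integral_of_dominated hw hs hPs hf (htc K) (fun x y hy => by
    have := h0 x y hy
    by_cases h : K < x <;> simp [t, h, this, abs_of_nonneg]) h_int hlim
  have h2 : Tendsto (fun n : ℕ => (K : ℝ) * (∫ p, f p ∂(Pn n : Measure (ℕ × ℝ))) / n +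
      ∫ p, t K p ∂(Pn n : Measure (ℕ × ℝ))) atTop
      (𝓝 (0 + ∫ p, t K p ∂(P : Measure (ℕ × ℝ)))) :=
    ((hlim.const_mul (K : ℝ)).div_atTop tendsto_natCast_atTop_atTop).add h1
  rw [zero_add] at h2
  filter_upwards [(tendsto_order.1 h2).2 ε (by linarith), eventually_gt_atTop 0] with n hn hn0
  refine lt_of_le_of_lt ?_ hn
  have hn0' : (0 : ℝ) < n := by exact_mod_cast hn0
  have hle : ∫ p, f p * p.1 ∂(Pn n : Measure (ℕ × ℝ)) ≤
      ∫ p, ((K : ℝ) * f p + n * t K p) ∂(Pn n : Measure (ℕ × ℝ)) := by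
    refine integral_mono_ae (integrable_of_support_le (hs n) fun x => ?_)
      (integrable_of_support_le (hs n) fun x => ?_) ?_
    · show Continuous fun y : ℝ => f (x, y) * (x : ℝ)
      exact (hf x).mul continuous_const
    · exact ((hf x).const_mul _).add ((htc K x).const_mul _)
    · filter_upwards [hs n] with p hp
      have hfp := h0 p.1 p.2 hp.2
      have hx : (p.1 : ℝ) ≤ n := by exact_mod_cast hp.1
      by_cases h : K < p.1
      · simp only [t, h, if_true]
        have : 0 ≤ (K : ℝ) * f p := mul_nonneg (Nat.cast_nonneg _) hfp
        nlinarith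
      · simp only [t, h, if_false]
        have : (p.1 : ℝ) ≤ K := by exact_mod_cast not_lt.1 h
        nlinarith
  rw [integral_add ((integrable_of_support_le (hs n) hf).const_mul _)
    ((integrable_of_support_le (hs n) (htc K)).const_mul _), integral_const_mul,
    integral_const_mul] at hle
  rw [div_le_iff₀ hn0', add_mul, div_mul_cancel₀ _ hn0'.ne']
  linarith

end WeakConvergence

instance (n : ℕ) : DiscreteMeasurableSpace (Finset (Fin n)) := ⟨fun _ => trivial⟩

/-- The node set and the edge indicators of a layer. -/
abbrev LayerGraph (n : ℕ) := Finset (Fin n) × (Sym2 (Fin n) → Bool)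

theorem toNNReal_min_one {y : ℝ} (hy : y ∈ Set.Icc (0 : ℝ) 1) :
    ((min (Real.toNNReal y) 1 : NNReal) : ℝ) = y := by
  rw [NNReal.coe_min, Real.coe_toNNReal _ hy.1, NNReal.coe_one, min_eq_left hy.2]

theorem measurable_bern (b : Bool) : Measurable fun y : ℝ => bern y {b} := by
  have h : ∀ y, bern y {b} = bif b then ((min (Real.toNNReal y) 1 : NNReal) : ℝ≥0∞)
      else ((1 - min (Real.toNNReal y) 1 : NNReal) : ℝ≥0∞) := by
    intro y
    rw [bern, PMF.toMeasure_apply_singleton _ _ (MeasurableSet.singleton _), PMF.bernoulli_apply]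
    cases b <;> simp
  simp only [h]
  cases b
  · simp only [cond_false]
    fun_prop
  · simp only [cond_true]
    fun_prop

theorem integral_bern {E : Type*} [NormedAddCommGroup E] [NormedSpace ℝ E] [CompleteSpace E]
    {y : ℝ} (hy : y ∈ Set.Icc (0 : ℝ) 1) (g : Bool → E) :
    ∫ b, g b ∂bern y = y • g true + (1 - y) • g false := by
  have h := toNNReal_min_one hy
  have h1 : (((min (Real.toNNReal y) 1 : NNReal) : ℝ≥0∞)).toReal = y := h
  have h2 : (((1 - min (Real.toNNReal y) 1 : NNReal) : ℝ≥0∞)).toReal = 1 - y := by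
    rw [ENNReal.coe_toReal, NNReal.coe_sub (min_le_right _ _), h, NNReal.coe_one]
  rw [bern, PMF.integral_eq_sum, Fintype.sum_bool, PMF.bernoulli_apply, PMF.bernoulli_apply,
    cond_true, cond_false, h1, h2]

theorem measurable_edgeFactor {n : ℕ} (V : Finset (Fin n)) (e : Sym2 (Fin n)) (b : Bool) :
    Measurable fun y : ℝ => edgeFactor n V y e {b} := by
  unfold edgeFactor
  split
  · exact measurable_bern b
  · exact measurable_const

theorem edgeMeasure_singleton {n : ℕ} (V : Finset (Fin n)) (y : ℝ) (f : Sym2 (Fin n) → Bool) :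
    edgeMeasure n V y {f} = ∏ e, edgeFactor n V y e {f e} := by
  rw [edgeMeasure, ← Set.univ_pi_singleton, Measure.pi_pi]

theorem measurable_edgeMeasure {n : ℕ} (V : Finset (Fin n)) (f : Sym2 (Fin n) → Bool) :
    Measurable fun y : ℝ => edgeMeasure n V y {f} := by
  simp only [edgeMeasure_singleton]
  exact Finset.measurable_prod _ fun e _ => measurable_edgeFactor V e (f e)

/-- The conditional law of a layer given its type. -/
def layerCond (n : ℕ) (xy : ℕ × ℝ) : Measure (Layer n) :=
  (vertexMeasure n xy.1).bind fun V => (edgeMeasure n V xy.2).map fun f => (xy, V, f)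

theorem layerMeasure_eq_bind (n : ℕ) (Q : Measure (ℕ × ℝ)) :
    layerMeasure n Q = Q.bind (layerCond n) := rfl

theorem layerCond_apply {n : ℕ} (xy : ℕ × ℝ) {s : Set (Layer n)} (hs : MeasurableSet s) :
    layerCond n xy s = ∑ V, ∑ f, (if (xy, V, f) ∈ s then 1 else 0) *
      edgeMeasure n V xy.2 {f} * vertexMeasure n xy.1 {V} := by
  rw [layerCond, Measure.bind_apply hs (Measurable.of_discrete).aemeasurable, lintegral_fintype]
  refine Finset.sum_congr rfl fun V _ => ?_
  have hg : Measurable fun f : Sym2 (Fin n) → Bool => ((xy, V, f) : Layer n) :=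
    measurable_const.prodMk (measurable_const.prodMk measurable_id)
  rw [Measure.map_apply hg hs, ← Finset.sum_mul]
  congr 1
  rw [← lintegral_indicator_one (hg hs), lintegral_fintype]
  refine Finset.sum_congr rfl fun f _ => ?_
  simp [Set.indicator_apply]

theorem measurable_layerCond (n : ℕ) : Measurable (layerCond n) := by
  refine Measure.measurable_of_measurable_coe _ fun s hs => ?_
  simp only [layerCond_apply _ hs]
  refine Finset.measurable_sum _ fun V _ => Finset.measurable_sum _ fun f _ => ?_
  refine (Measurable.mul (Measurable.ite ?_ measurable_const measurable_const) ?_).mul ?_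
  · exact (measurable_id.prodMk (measurable_const.prodMk measurable_const)) hs
  · exact (measurable_edgeMeasure V f).comp measurable_snd
  · exact (Measurable.of_discrete (f := fun x : ℕ => vertexMeasure n x {V})).comp measurable_fst

instance (n : ℕ) (xy : ℕ × ℝ) : IsProbabilityMeasure (layerCond n xy) := by
  constructor
  rw [layerCond_apply _ MeasurableSet.univ]
  simp only [Set.mem_univ, if_true, one_mul, ← Finset.sum_mul]
  have h1 : ∀ V, ∑ f, edgeMeasure n V xy.2 {f} = 1 := fun V => by
    rw [sum_measure_singleton]; simp
  simp only [h1, one_mul]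
  rw [sum_measure_singleton]; simp

instance (n : ℕ) (Q : Measure (ℕ × ℝ)) [IsProbabilityMeasure Q] :
    IsProbabilityMeasure (layerMeasure n Q) := by
  constructor
  rw [layerMeasure_eq_bind, Measure.bind_apply MeasurableSet.univ
    (measurable_layerCond n).aemeasurable]
  simp

theorem layerMeasure_real_singleton {n : ℕ} (Q : Measure (ℕ × ℝ)) [IsProbabilityMeasure Q]
    (s : LayerGraph n) :
    ((layerMeasure n Q).map Prod.snd).real {s} =
      ∫ p, (vertexMeasure n p.1).real {s.1} * (edgeMeasure n s.1 p.2).real {s.2} ∂Q := by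
  have hs : MeasurableSet (Prod.snd ⁻¹' {s} : Set (Layer n)) :=
    measurable_snd (MeasurableSet.singleton s)
  have h1 : ∀ p, layerCond n p (Prod.snd ⁻¹' {s}) =
      edgeMeasure n s.1 p.2 {s.2} * vertexMeasure n p.1 {s.1} := by
    intro p
    rw [layerCond_apply _ hs, Finset.sum_eq_single s.1, Finset.sum_eq_single s.2]
    · simp
    · intro f _ hf
      have : (s.1, f) ≠ s := fun h => hf (by rw [← h])
      simp [this]
    · simp
    · intro V _ hV
      refine Finset.sum_eq_zero fun f _ => ?_
      have : (V, f) ≠ s := fun h => hV (by rw [← h])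
      simp [this]
    · simp
  rw [measureReal_def, Measure.map_apply measurable_snd (MeasurableSet.singleton s),
    layerMeasure_eq_bind, Measure.bind_apply hs (measurable_layerCond n).aemeasurable]
  simp only [h1]
  rw [← integral_toReal]
  · refine integral_congr_ae (Eventually.of_forall fun p => ?_)
    simp only [ENNReal.toReal_mul, measureReal_def, mul_comm]
  · refine Measurable.aemeasurable ?_
    exact ((measurable_edgeMeasure s.1 s.2).comp measurable_snd).mul
      ((Measurable.of_discrete (f := fun x : ℕ => vertexMeasure n x {s.1})).comp measurable_fst)
  · exact Eventually.of_forall fun p => ENNReal.mul_lt_top (measure_lt_top _ _)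
      (measure_lt_top _ _)

theorem integral_layerMeasure {E : Type*} [NormedAddCommGroup E] [NormedSpace ℝ E]
    [CompleteSpace E] {n : ℕ} (Q : Measure (ℕ × ℝ)) [IsProbabilityMeasure Q]
    (G : LayerGraph n → E) :
    ∫ L, G L.2 ∂layerMeasure n Q =
      ∫ p, ∑ V, (vertexMeasure n p.1).real {V} • ∫ f, G (V, f) ∂edgeMeasure n V p.2 ∂Q := by
  have hprod : ∀ s : LayerGraph n, Integrable (fun p : ℕ × ℝ =>
      (vertexMeasure n p.1).real {s.1} * (edgeMeasure n s.1 p.2).real {s.2}) Q := by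
    intro s
    refine Integrable.of_bound (C := 1) (Measurable.aestronglyMeasurable ?_) ?_
    · refine Measurable.mul ?_ ?_
      · exact (Measurable.of_discrete (f := fun x : ℕ => (vertexMeasure n x).real {s.1})).comp
          measurable_fst
      · exact ((measurable_edgeMeasure s.1 s.2).comp measurable_snd).ennreal_toReal
    · refine Eventually.of_forall fun p => ?_
      rw [Real.norm_of_nonneg (mul_nonneg measureReal_nonneg measureReal_nonneg)]
      exact mul_le_one₀ measureReal_le_one measureReal_nonneg measureReal_le_one
  have h1 : ∫ L, G L.2 ∂layerMeasure n Q = ∫ s, G s ∂(layerMeasure n Q).map Prod.snd :=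
    (integral_map measurable_snd.aemeasurable
      (StronglyMeasurable.of_discrete (f := G)).aestronglyMeasurable).symm
  rw [h1, integral_fintype .of_finite]
  simp only [layerMeasure_real_singleton]
  rw [Fintype.sum_prod_type]
  have h2 : ∀ p : ℕ × ℝ, ∑ V, (vertexMeasure n p.1).real {V} • ∫ f, G (V, f) ∂edgeMeasure n V p.2 =
      ∑ V, ∑ f, ((vertexMeasure n p.1).real {V} * (edgeMeasure n V p.2).real {f}) • G (V, f) := by
    intro p
    refine Finset.sum_congr rfl fun V _ => ?_
    rw [integral_fintype .of_finite, Finset.smul_sum]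
    simp only [mul_smul]
  simp only [h2]
  rw [integral_finsetSum _ fun V _ => integrable_finsetSum _ fun f _ =>
    (hprod (V, f)).smul_const _]
  refine Finset.sum_congr rfl fun V _ => ?_
  rw [integral_finsetSum _ fun f _ => (hprod (V, f)).smul_const _]
  refine Finset.sum_congr rfl fun f _ => ?_
  rw [integral_smul_const]

/-- The edge set determined by a node set and edge indicators. -/
def gEdges {n : ℕ} (s : LayerGraph n) : Finset (Sym2 (Fin n)) :=
  Finset.univ.filter fun e => s.2 e = true ∧ ¬ e.IsDiag ∧ ∀ v ∈ e, v ∈ s.1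

/-- The degree of a node within one layer. -/
def gDeg {n : ℕ} (s : LayerGraph n) (v : Fin n) : ℕ :=
  ((gEdges s).filter fun e => v ∈ e).card

theorem layerEdges_eq {n : ℕ} (L : Layer n) : layerEdges L = gEdges L.2 := rfl

theorem mem_gEdges {n : ℕ} {s : LayerGraph n} {e : Sym2 (Fin n)} :
    e ∈ gEdges s ↔ s.2 e = true ∧ ¬ e.IsDiag ∧ ∀ v ∈ e, v ∈ s.1 := by
  simp [gEdges]

theorem integral_edgeMeasure_prod {n : ℕ} (V : Finset (Fin n)) {y : ℝ}
    (hy : y ∈ Set.Icc (0 : ℝ) 1) (h : Sym2 (Fin n) → Bool → ℂ) :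
    ∫ f, ∏ e, h e (f e) ∂edgeMeasure n V y =
      ∏ e : Sym2 (Fin n), if ¬ e.IsDiag ∧ ∀ v ∈ e, v ∈ V then y * h e true + (1 - y) * h e false
        else h e false := by
  rw [edgeMeasure, integral_fintype_prod_eq_prod (𝕜 := ℂ) (f := h)]
  refine Finset.prod_congr rfl fun e _ => ?_
  unfold edgeFactor
  split_ifs
  · rw [integral_bern hy]
    simp
  · rw [integral_dirac]

theorem card_edges_at {n : ℕ} (V : Finset (Fin n)) {v : Fin n} (hv : v ∈ V) :
    (Finset.univ.filter fun e : Sym2 (Fin n) => (¬ e.IsDiag ∧ ∀ u ∈ e, u ∈ V) ∧ v ∈ e).card =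
      V.card - 1 := by
  rw [← Finset.card_erase_of_mem hv]
  symm
  refine Finset.card_bij (fun u _ => s(v, u)) ?_ ?_ ?_
  · intro u hu
    rw [Finset.mem_erase] at hu
    simp [hv, hu.2, hu.1.symm]
  · intro a _ b _ h
    exact Sym2.congr_right.1 h
  · intro e he
    rw [Finset.mem_filter] at he
    obtain ⟨_, ⟨hd, hV⟩, hve⟩ := he
    obtain ⟨u, rfl⟩ := Sym2.mem_iff_exists.1 hve
    refine ⟨u, Finset.mem_erase.2 ⟨fun h => hd ?_, hV u (Sym2.mem_mk_right v u)⟩, rfl⟩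
    simp [h]

theorem prod_edges_at {n : ℕ} (V : Finset (Fin n)) {v : Fin n} (hv : v ∈ V) (a : ℂ) :
    ∏ e : Sym2 (Fin n), (if (¬ e.IsDiag ∧ ∀ u ∈ e, u ∈ V) ∧ v ∈ e then a else 1) =
      a ^ (V.card - 1) := by
  rw [Finset.prod_ite, Finset.prod_const, Finset.prod_const_one, mul_one, card_edges_at V hv]

theorem pow_gDeg {n : ℕ} (V : Finset (Fin n)) (f : Sym2 (Fin n) → Bool) (v : Fin n) (z : ℂ) :
    z ^ gDeg (V, f) v = ∏ e : Sym2 (Fin n),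
      if f e = true ∧ (¬ e.IsDiag ∧ ∀ u ∈ e, u ∈ V) ∧ v ∈ e then z else 1 := by
  rw [Finset.prod_ite, Finset.prod_const, Finset.prod_const_one, mul_one, gDeg, gEdges,
    Finset.filter_filter]
  simp only [and_assoc]

theorem integral_pow_gDeg {n : ℕ} (V : Finset (Fin n)) {y : ℝ} (hy : y ∈ Set.Icc (0 : ℝ) 1)
    (v : Fin n) (z : ℂ) :
    ∫ f, z ^ gDeg (V, f) v ∂edgeMeasure n V y =
      if v ∈ V then (1 - y + y * z) ^ (V.card - 1) else 1 := by
  simp only [pow_gDeg]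
  rw [integral_edgeMeasure_prod V hy (fun e b =>
    if b = true ∧ (¬ e.IsDiag ∧ ∀ u ∈ e, u ∈ V) ∧ v ∈ e then z else 1)]
  split_ifs with hv
  · rw [← prod_edges_at V hv]
    refine Finset.prod_congr rfl fun e _ => ?_
    by_cases h1 : ¬ e.IsDiag ∧ ∀ u ∈ e, u ∈ V
    · rw [if_pos h1]
      by_cases h2 : v ∈ e
      · rw [if_pos ⟨rfl, h1, h2⟩, if_neg (by simp), if_pos ⟨h1, h2⟩]
        ring
      · rw [if_neg (fun h => h2 h.2.2), if_neg (by simp), if_neg (fun h => h2 h.2)]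
        ring
    · simp only [h1]; simp
  · refine Finset.prod_eq_one fun e _ => ?_
    by_cases h1 : ¬ e.IsDiag ∧ ∀ u ∈ e, u ∈ V
    · have h2 : v ∉ e := fun h => hv (h1.2 v h)
      simp only [h1, h2]; simp
    · simp only [h1]; simp

theorem integral_edge_pow_gDeg {n : ℕ} (V : Finset (Fin n)) {y : ℝ} (hy : y ∈ Set.Icc (0 : ℝ) 1)
    {u v : Fin n} (huv : u ≠ v) (z w : ℂ) :
    ∫ f, (if s(u, v) ∈ gEdges (V, f) then z ^ gDeg (V, f) u * w ^ gDeg (V, f) v else 0)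
        ∂edgeMeasure n V y =
      if {u, v} ⊆ V then z * w * y * (1 - y + y * z) ^ (V.card - 2) *
        (1 - y + y * w) ^ (V.card - 2) else 0 := by
  let ok : Sym2 (Fin n) → Prop := fun e => ¬ e.IsDiag ∧ ∀ u ∈ e, u ∈ V
  let h : Sym2 (Fin n) → Bool → ℂ := fun e b =>
    (if b = true ∧ ok e ∧ u ∈ e then z else 1) * (if b = true ∧ ok e ∧ v ∈ e then w else 1) *
      (if e = s(u, v) then (if b = true ∧ ok e then 1 else 0) else 1)
  have h_int : ∀ f : Sym2 (Fin n) → Bool,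
      (if s(u, v) ∈ gEdges (V, f) then z ^ gDeg (V, f) u * w ^ gDeg (V, f) v else 0) =
        ∏ e, h e (f e) := by
    intro f
    simp only [h, Finset.prod_mul_distrib]
    rw [← pow_gDeg, ← pow_gDeg, Finset.prod_ite_eq' Finset.univ (s(u, v))
      (fun e => if f e = true ∧ ok e then (1 : ℂ) else 0)]
    by_cases hm : s(u, v) ∈ gEdges (V, f)
    · rw [if_pos hm, if_pos (Finset.mem_univ _), if_pos (mem_gEdges.1 hm), mul_one]
    · rw [if_neg hm, if_pos (Finset.mem_univ _), if_neg (fun h' => hm (mem_gEdges.2 h')), mul_zero]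
  simp only [h_int]
  rw [integral_edgeMeasure_prod V hy h]
  have hnd : ¬ (s(u, v)).IsDiag := by simpa using huv
  by_cases hV : {u, v} ⊆ V
  · rw [if_pos hV]
    have hu : u ∈ V := hV (by simp)
    have hv : v ∈ V := hV (by simp)
    have hok : ok s(u, v) := ⟨hnd, fun t ht => by
      rcases Sym2.mem_iff.1 ht with rfl | rfl <;> assumption⟩
    have hfac : ∀ (t : Fin n), t ∈ V → t ∈ s(u, v) → ∀ a : ℂ,
        ∏ e ∈ Finset.univ.erase s(u, v), (if ok e ∧ t ∈ e then a else 1) = a ^ (V.card - 2) := by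
      intro t htV ht a
      rw [Finset.prod_ite, Finset.prod_const, Finset.prod_const_one, mul_one,
        Finset.filter_erase, Finset.card_erase_of_mem (by simp [hok, ht]),
        card_edges_at V htV, Nat.sub_sub]
    rw [← Finset.mul_prod_erase _ _ (Finset.mem_univ s(u, v))]
    have hrest : ∏ e ∈ Finset.univ.erase s(u, v), (if ¬ e.IsDiag ∧ ∀ v ∈ e, v ∈ V then
        y * h e true + (1 - y) * h e false else h e false) =
        (∏ e ∈ Finset.univ.erase s(u, v), (if ok e ∧ u ∈ e then 1 - y + y * z else 1)) *
        ∏ e ∈ Finset.univ.erase s(u, v), (if ok e ∧ v ∈ e then 1 - y + y * w else 1) := by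
      rw [← Finset.prod_mul_distrib]
      refine Finset.prod_congr rfl fun e he => ?_
      have hne : e ≠ s(u, v) := (Finset.mem_erase.1 he).1
      show (if ok e then _ else _) = _
      by_cases hoke : ok e
      · by_cases h1 : u ∈ e
        · have h2 : v ∉ e := fun h2 => hne ((Sym2.mem_and_mem_iff huv).1 ⟨h1, h2⟩)
          simp only [h, hoke, h1, h2, hne]; simp; ring
        · by_cases h2 : v ∈ e
          · simp only [h, hoke, h1, h2, hne]; simp; ring
          · simp only [h, hoke, h1, h2, hne]; simp
      · simp only [h, hoke, hne]; simp
    rw [hrest, hfac u hu (by simp), hfac v hv (by simp)]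
    show (if ok s(u, v) then _ else _) * _ = _
    rw [if_pos hok]
    simp only [h, hok]
    simp
    ring
  · rw [if_neg hV]
    have hok : ¬ ok s(u, v) := fun hok => hV fun t ht => by
      rcases Finset.mem_insert.1 ht with rfl | ht
      · exact hok.2 _ (Sym2.mem_mk_left _ _)
      · rw [Finset.mem_singleton.1 ht]; exact hok.2 _ (Sym2.mem_mk_right _ _)
    refine Finset.prod_eq_zero (Finset.mem_univ s(u, v)) ?_
    show (if ok s(u, v) then _ else _) = _
    rw [if_neg hok]
    simp [h]

theorem vertexMeasure_real_singleton {n x : ℕ} (hx : x ≤ n) (V : Finset (Fin n)) :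
    (vertexMeasure n x).real {V} = if V.card = x then ((n.choose x : ℝ))⁻¹ else 0 := by
  have hne : (Finset.powersetCard x (Finset.univ : Finset (Fin n))).Nonempty := by
    rw [Finset.powersetCard_nonempty]; simpa using hx
  rw [vertexMeasure, dif_pos hne, measureReal_def,
    PMF.toMeasure_apply_singleton _ _ (MeasurableSet.singleton _), PMF.uniformOfFinset_apply]
  simp only [Finset.mem_powersetCard, Finset.subset_univ, true_and, Finset.card_powersetCard,
    Finset.card_univ, Fintype.card_fin]
  split_ifs <;> simp

theorem sum_vertexMeasure {E : Type*} [NormedAddCommGroup E] [NormedSpace ℝ E] {n x : ℕ}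
    (hx : x ≤ n) (T : Finset (Fin n)) (φ : ℕ → E) :
    ∑ V, (vertexMeasure n x).real {V} • (if T ⊆ V then φ V.card else 0) =
      ((x.descFactorial T.card : ℝ) / (n.descFactorial T.card : ℝ)) • φ x := by
  have h1 : ∀ V : Finset (Fin n), (vertexMeasure n x).real {V} • (if T ⊆ V then φ V.card else 0) =
      if V ∈ (Finset.powersetCard x (Finset.univ : Finset (Fin n))).filter (T ⊆ ·) then
        ((n.choose x : ℝ))⁻¹ • φ x else 0 := by
    intro V
    rw [vertexMeasure_real_singleton hx]
    simp only [Finset.mem_filter, Finset.mem_powersetCard, Finset.subset_univ, true_and]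
    by_cases h1 : V.card = x <;> by_cases h2 : T ⊆ V <;> simp [h1, h2]
  simp only [h1]
  rw [Finset.sum_ite_mem, Finset.univ_inter, Finset.sum_const, ← Nat.cast_smul_eq_nsmul ℝ,
    smul_smul]
  congr 1
  have hT : T.card ≤ n := by simpa using Finset.card_le_univ T
  rcases le_or_gt T.card x with hTx | hTx
  · rw [Finset.card_filter_powersetCard_subset T Finset.univ x (Finset.subset_univ T) hTx,
      Finset.card_univ,
      Fintype.card_fin]
    have hc : 0 < (n.choose x : ℝ) := by exact_mod_cast Nat.choose_pos hx
    have hd : 0 < (n.descFactorial T.card : ℝ) := by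
      exact_mod_cast Nat.pos_of_ne_zero (by rw [Ne, Nat.descFactorial_eq_zero_iff_lt]; omega)
    rw [← div_eq_mul_inv, div_eq_div_iff hc.ne' hd.ne']
    have := Nat.choose_mul (n := n) (k := x) (s := T.card) hTx
    rw [Nat.descFactorial_eq_factorial_mul_choose, Nat.descFactorial_eq_factorial_mul_choose]
    have h2 : (n.choose x : ℝ) * x.choose T.card =
      n.choose T.card * (n - T.card).choose (x - T.card) := by exact_mod_cast this
    push_cast
    linear_combination -(T.card.factorial : ℝ) * h2
  · have h0 : (Finset.powersetCard x (Finset.univ : Finset (Fin n))).filter (T ⊆ ·) = ∅ := by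
      refine Finset.filter_eq_empty_iff.2 fun V hV hTV => ?_
      have := Finset.card_le_card hTV
      rw [(Finset.mem_powersetCard.1 hV).2] at this
      omega
    rw [h0, Nat.descFactorial_of_lt hTx]
    simp

theorem integral_edge_indicator {n : ℕ} {V : Finset (Fin n)} {y : ℝ} (hy : y ∈ Set.Icc (0 : ℝ) 1)
    {u v : Fin n} (huv : u ≠ v) :
    ∫ f, (if s(u, v) ∈ gEdges (V, f) then (1 : ℝ) else 0) ∂edgeMeasure n V y =
      if {u, v} ⊆ V then y else 0 := by
  have h := integral_edge_pow_gDeg V hy huv 1 1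
  have h2 : ∀ f, (if s(u, v) ∈ gEdges (V, f) then (1 : ℂ) ^ gDeg (V, f) u * 1 ^ gDeg (V, f) v
      else 0) = ((if s(u, v) ∈ gEdges (V, f) then (1 : ℝ) else 0 : ℝ) : ℂ) := fun f => by
    split_ifs <;> simp
  simp only [h2] at h
  rw [integral_complex_ofReal] at h
  split_ifs at h ⊢ with hV
  · have h3 : (1 : ℂ) * 1 * y * (1 - y + y * 1) ^ (V.card - 2) * (1 - y + y * 1) ^ (V.card - 2) =
      (y : ℂ) := by simp
    rw [h3] at h
    exact_mod_cast h
  · exact_mod_cast h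

section LayerIntegrals

variable {n : ℕ} {Q : Measure (ℕ × ℝ)} [IsProbabilityMeasure Q]

theorem integral_layer_of_subset (hQ : ∀ᵐ p ∂Q, p.1 ≤ n ∧ p.2 ∈ Set.Icc (0 : ℝ) 1)
    {E : Type*} [NormedAddCommGroup E] [NormedSpace ℝ E]
    [CompleteSpace E] (G : LayerGraph n → E) (T : Finset (Fin n)) (φ : ℕ → ℝ → E)
    (hG : ∀ V, ∀ y ∈ Set.Icc (0 : ℝ) 1, ∫ f, G (V, f) ∂edgeMeasure n V y =
      if T ⊆ V then φ V.card y else 0) :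
    ∫ L, G L.2 ∂layerMeasure n Q =
      (n.descFactorial T.card : ℝ)⁻¹ •
        ∫ p, (p.1.descFactorial T.card : ℝ) • φ p.1 p.2 ∂Q := by
  rw [integral_layerMeasure, ← integral_smul]
  refine integral_congr_ae ?_
  filter_upwards [hQ] with p hp
  simp only [hG _ _ hp.2]
  rw [sum_vertexMeasure hp.1 T (fun k => φ k p.2), smul_smul, div_eq_inv_mul]

theorem integral_layer_pow_sub_one (hQ : ∀ᵐ p ∂Q, p.1 ≤ n ∧ p.2 ∈ Set.Icc (0 : ℝ) 1)
    (v : Fin n) (z : ℂ) :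
    ∫ L, (z ^ gDeg L.2 v - 1) ∂layerMeasure n Q =
      (n : ℝ)⁻¹ • ∫ p, (p.1 : ℝ) • ((1 - p.2 + p.2 * z) ^ (p.1 - 1) - 1 : ℂ) ∂Q := by
  have h := integral_layer_of_subset hQ (fun s => z ^ gDeg s v - 1) {v}
    (fun x y => ((1 - y + y * z) ^ (x - 1) - 1 : ℂ)) fun V y hy => by
      rw [integral_sub .of_finite .of_finite, integral_pow_gDeg V hy]
      by_cases hv : v ∈ V <;> simp [hv]
  simpa using h

theorem integral_layer_edge (hQ : ∀ᵐ p ∂Q, p.1 ≤ n ∧ p.2 ∈ Set.Icc (0 : ℝ) 1)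
    {u v : Fin n} (huv : u ≠ v) (z w : ℂ) :
    ∫ L, (if s(u, v) ∈ gEdges L.2 then z ^ gDeg L.2 u * w ^ gDeg L.2 v else 0) ∂layerMeasure n Q =
      (n.descFactorial 2 : ℝ)⁻¹ • ∫ p, (p.1.descFactorial 2 : ℝ) •
        (z * w * p.2 * (1 - p.2 + p.2 * z) ^ (p.1 - 2) *
          (1 - p.2 + p.2 * w) ^ (p.1 - 2) : ℂ) ∂Q := by
  have h := integral_layer_of_subset hQ
    (fun s => if s(u, v) ∈ gEdges s then z ^ gDeg s u * w ^ gDeg s v else 0) {u, v}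
    (fun x y => (z * w * y * (1 - y + y * z) ^ (x - 2) * (1 - y + y * w) ^ (x - 2) : ℂ))
    fun V y hy => integral_edge_pow_gDeg V hy huv z w
  rw [Finset.card_pair huv] at h
  exact h

theorem integral_layer_edge_mul_card (hQ : ∀ᵐ p ∂Q, p.1 ≤ n ∧ p.2 ∈ Set.Icc (0 : ℝ) 1)
    {u v : Fin n} (huv : u ≠ v) :
    ∫ L, (if s(u, v) ∈ gEdges L.2 then (L.2.1.card : ℝ) else 0) ∂layerMeasure n Q =
      (n.descFactorial 2 : ℝ)⁻¹ * ∫ p, (p.1.descFactorial 2 : ℝ) * p.2 * p.1 ∂Q := by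
  have h := integral_layer_of_subset hQ
    (fun s => if s(u, v) ∈ gEdges s then (s.1.card : ℝ) else 0) {u, v}
    (fun x y => y * x) fun V y hy => by
      have h1 := integral_edge_indicator (V := V) hy huv
      have h2 : ∀ f, (if s(u, v) ∈ gEdges (V, f) then (V.card : ℝ) else 0) =
        (if s(u, v) ∈ gEdges (V, f) then (1 : ℝ) else 0) * V.card := fun f => by
          split_ifs <;> simp
      simp only [h2]
      rw [integral_mul_const, h1]
      split_ifs <;> simp
  rw [Finset.card_pair huv] at h
  simpa only [smul_eq_mul, mul_assoc] using h

theorem measureReal_edge (hQ : ∀ᵐ p ∂Q, p.1 ≤ n ∧ p.2 ∈ Set.Icc (0 : ℝ) 1)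
    {u v : Fin n} (huv : u ≠ v) :
    (layerMeasure n Q).real {L | s(u, v) ∈ gEdges L.2} =
      (n.descFactorial 2 : ℝ)⁻¹ * mom Q 2 1 := by
  have h := integral_layer_of_subset hQ
    (fun s => if s(u, v) ∈ gEdges s then (1 : ℝ) else 0) {u, v}
    (fun _ y => y) fun V y hy => integral_edge_indicator hy huv
  rw [Finset.card_pair huv] at h
  have hm : MeasurableSet {L : Layer n | s(u, v) ∈ gEdges L.2} :=
    measurable_snd (MeasurableSet.of_discrete (s := {s : LayerGraph n | s(u, v) ∈ gEdges s}))
  rw [← integral_indicator_one hm]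
  simp only [smul_eq_mul] at h
  simp only [mom, pow_one]
  rw [← h]
  refine integral_congr_ae (Eventually.of_forall fun L => ?_)
  simp [Set.indicator_apply]

theorem measureReal_pair (hQ : ∀ᵐ p ∂Q, p.1 ≤ n ∧ p.2 ∈ Set.Icc (0 : ℝ) 1)
    {u v : Fin n} (huv : u ≠ v) :
    (layerMeasure n Q).real {L | u ∈ L.2.1 ∧ v ∈ L.2.1} =
      (n.descFactorial 2 : ℝ)⁻¹ * ∫ p, (p.1.descFactorial 2 : ℝ) ∂Q := by
  have h := integral_layer_of_subset hQ
    (fun s => if u ∈ s.1 ∧ v ∈ s.1 then (1 : ℝ) else 0) {u, v}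
    (fun _ _ => 1) fun V y hy => by
      by_cases h : u ∈ V ∧ v ∈ V <;> simp [Finset.insert_subset_iff, h]
  rw [Finset.card_pair huv] at h
  have hm : MeasurableSet {L : Layer n | u ∈ L.2.1 ∧ v ∈ L.2.1} :=
    measurable_snd (MeasurableSet.of_discrete (s := {s : LayerGraph n | u ∈ s.1 ∧ v ∈ s.1}))
  rw [← integral_indicator_one hm]
  simp only [smul_eq_mul, mul_one] at h
  rw [← h]
  refine integral_congr_ae (Eventually.of_forall fun L => ?_)
  simp [Set.indicator_apply]

end LayerIntegrals

section Integrability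

variable {E : Type*} [NormedAddCommGroup E] {n m : ℕ} {Q : Measure (ℕ × ℝ)}
  [IsProbabilityMeasure Q]

instance (n m : ℕ) (Q : Measure (ℕ × ℝ)) [IsProbabilityMeasure Q] :
    IsProbabilityMeasure (modelMeasure n m Q) := by
  unfold modelMeasure; infer_instance

theorem integrable_layer (g : LayerGraph n → E) :
    Integrable (fun L => g L.2) (layerMeasure n Q) := by
  obtain ⟨C, hC⟩ := (Set.finite_range fun s => ‖g s‖).bddAbove
  exact Integrable.of_bound ((StronglyMeasurable.of_discrete (f := g)).comp_measurable
    measurable_snd).aestronglyMeasurable C (Eventually.of_forall fun L => hC ⟨L.2, rfl⟩)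

theorem measurable_layerGraphs : Measurable fun (ω : Fin m → Layer n) k => (ω k).2 :=
  measurable_pi_lambda _ fun k => measurable_snd.comp (measurable_pi_apply k)

theorem integrable_model (g : (Fin m → LayerGraph n) → E) :
    Integrable (fun ω => g fun k => (ω k).2) (modelMeasure n m Q) := by
  obtain ⟨C, hC⟩ := (Set.finite_range fun s => ‖g s‖).bddAbove
  exact Integrable.of_bound ((StronglyMeasurable.of_discrete (f := g)).comp_measurable
    measurable_layerGraphs).aestronglyMeasurable C
    (Eventually.of_forall fun ω => hC ⟨fun k => (ω k).2, rfl⟩)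

theorem measurableSet_layer (p : LayerGraph n → Prop) : MeasurableSet {L : Layer n | p L.2} :=
  measurable_snd (MeasurableSet.of_discrete (s := {s | p s}))

theorem measurableSet_model (p : (Fin m → LayerGraph n) → Prop) :
    MeasurableSet {ω : Fin m → Layer n | p fun k => (ω k).2} :=
  measurable_layerGraphs (MeasurableSet.of_discrete (s := {s | p s}))

theorem model_real_forall_mem (T : Finset (Fin m)) (S : Fin m → Set (Layer n)) :
    (modelMeasure n m Q).real {ω | ∀ q ∈ T, ω q ∈ S q} =
      ∏ q ∈ T, (layerMeasure n Q).real (S q) := by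
  have h : {ω : Fin m → Layer n | ∀ q ∈ T, ω q ∈ S q} =
      Set.univ.pi fun q => if q ∈ T then S q else Set.univ := by
    ext ω
    simp only [Set.mem_ofPred_eq, Set.mem_univ_pi]
    refine forall_congr' fun q => ?_
    by_cases hq : q ∈ T <;> simp [hq]
  rw [h, measureReal_def, modelMeasure, Measure.pi_pi, ENNReal.toReal_prod,
    ← Finset.univ_inter T, ← Finset.prod_ite_mem]
  refine Finset.prod_congr rfl fun q _ => ?_
  by_cases hq : q ∈ T <;> simp [hq, measureReal_def]

end Integrability

/-- The sum of the layer degrees of a node, counting overlapping edges with multiplicity. -/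
def sumDeg {n m : ℕ} (ω : Fin m → Layer n) (v : Fin n) : ℕ := ∑ k, gDeg (ω k).2 v

/-- Some edge incident to `v` is present in two different layers. -/
def Overlap {n m : ℕ} (ω : Fin m → Layer n) (v : Fin n) : Prop :=
  ∃ k l, k ≠ l ∧ ∃ t, t ≠ v ∧ s(v, t) ∈ gEdges (ω k).2 ∧ s(v, t) ∈ gEdges (ω l).2

theorem mem_graphEdges {n m : ℕ} {ω : Fin m → Layer n} {e : Sym2 (Fin n)} :
    e ∈ graphEdges ω ↔ ∃ k, e ∈ gEdges (ω k).2 := by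
  simp [graphEdges, layerEdges_eq]

theorem deg_eq_sumDeg {n m : ℕ} {ω : Fin m → Layer n} {v : Fin n} (h : ¬ Overlap ω v) :
    deg ω v = sumDeg ω v := by
  have h1 : (graphEdges ω).filter (fun e => ∃ u : Fin n, u ∈ e ∧ (u : ℕ) = v) =
      Finset.univ.biUnion fun k => (gEdges (ω k).2).filter fun e => v ∈ e := by
    ext e
    have h2 : (∃ u : Fin n, u ∈ e ∧ (u : ℕ) = v) ↔ v ∈ e :=
      ⟨fun ⟨u, hu, huv⟩ => Fin.ext huv ▸ hu, fun hv => ⟨v, hv, rfl⟩⟩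
    simp only [Finset.mem_filter, mem_graphEdges, h2, Finset.mem_biUnion, Finset.mem_univ,
      true_and]
    exact ⟨fun ⟨⟨k, hk⟩, hv⟩ => ⟨k, hk, hv⟩, fun ⟨k, hk, hv⟩ => ⟨⟨k, hk⟩, hv⟩⟩
  rw [deg, h1, Finset.card_biUnion]
  · rfl
  · intro k _ l _ hkl
    refine Finset.disjoint_left.2 fun e hk hl => h ?_
    rw [Finset.mem_filter] at hk hl
    obtain ⟨t, rfl⟩ := Sym2.mem_iff_exists.1 hk.2
    refine ⟨k, l, hkl, t, fun htv => (mem_gEdges.1 hk.1).2.1 ?_, hk.1, hl.1⟩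
    simp [htv]

theorem mem_adjEvent {n m : ℕ} {u v : Fin n} (hu : (u : ℕ) = 0) (hv : (v : ℕ) = 1)
    {ω : Fin m → Layer n} : ω ∈ adjEvent n m ↔ s(u, v) ∈ graphEdges ω := by
  constructor
  · rintro ⟨e, he, ⟨a, ha, ha0⟩, b, hb, hb1⟩
    have hau : a = u := Fin.ext (ha0.trans hu.symm)
    have hbv : b = v := Fin.ext (hb1.trans hv.symm)
    subst hau hbv
    have hab : a ≠ b := fun h => by rw [h, hv] at hu; exact one_ne_zero hu
    rwa [← (Sym2.mem_and_mem_iff hab).1 ⟨ha, hb⟩]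
  · exact fun h => ⟨_, h, ⟨u, Sym2.mem_mk_left _ _, hu⟩, v, Sym2.mem_mk_right _ _, hv⟩

section Overlap

variable {n m : ℕ} {Q : Measure (ℕ × ℝ)} [IsProbabilityMeasure Q]

theorem gDeg_le_card {s : LayerGraph n} (u : Fin n) :
    ∑ t, (if t ≠ u ∧ s(u, t) ∈ gEdges s then (1 : ℝ) else 0) ≤ s.1.card := by
  rw [Finset.sum_boole, Nat.cast_le]
  refine Finset.card_le_card fun t ht => ?_
  exact (mem_gEdges.1 (Finset.mem_filter.1 ht).2.2).2.2 t (Sym2.mem_mk_right _ _)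

theorem sum_measureReal_edge_inter (hQ : ∀ᵐ p ∂Q, p.1 ≤ n ∧ p.2 ∈ Set.Icc (0 : ℝ) 1)
    {a b : Fin n} (hab : a ≠ b) (u : Fin n) :
    ∑ t, (layerMeasure n Q).real {L | (t ≠ u ∧ s(u, t) ∈ gEdges L.2) ∧ s(a, b) ∈ gEdges L.2} ≤
      (n.descFactorial 2 : ℝ)⁻¹ * ∫ p, (p.1.descFactorial 2 : ℝ) * p.2 * p.1 ∂Q := by
  rw [← integral_layer_edge_mul_card hQ hab]
  have h1 : ∀ t, (layerMeasure n Q).real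
      {L | (t ≠ u ∧ s(u, t) ∈ gEdges L.2) ∧ s(a, b) ∈ gEdges L.2} =
      ∫ L, (if (t ≠ u ∧ s(u, t) ∈ gEdges L.2) ∧ s(a, b) ∈ gEdges L.2 then (1 : ℝ) else 0)
        ∂layerMeasure n Q := fun t => by
    rw [← integral_indicator_one (measurableSet_layer fun s =>
      (t ≠ u ∧ s(u, t) ∈ gEdges s) ∧ s(a, b) ∈ gEdges s)]
    refine integral_congr_ae (Eventually.of_forall fun L => ?_)
    simp only [Set.indicator_apply, Set.mem_ofPred_eq, Pi.one_apply]
  simp only [h1]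
  rw [← integral_finsetSum _ fun t _ => integrable_layer fun s =>
    if (t ≠ u ∧ s(u, t) ∈ gEdges s) ∧ s(a, b) ∈ gEdges s then (1 : ℝ) else 0]
  refine integral_mono (integrable_layer fun s => ∑ t,
    if (t ≠ u ∧ s(u, t) ∈ gEdges s) ∧ s(a, b) ∈ gEdges s then (1 : ℝ) else 0)
    (integrable_layer fun s => if s(a, b) ∈ gEdges s then (s.1.card : ℝ) else 0) fun L => ?_
  by_cases h : s(a, b) ∈ gEdges L.2
  · simpa only [h, and_true, if_true] using gDeg_le_card u
  · simp only [h, and_false, if_false, Finset.sum_const_zero, le_refl]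

/-- The probability that a fixed pair is linked and some edge at `u` is covered by two layers. -/
theorem model_real_overlap_le (hQ : ∀ᵐ p ∂Q, p.1 ≤ n ∧ p.2 ∈ Set.Icc (0 : ℝ) 1)
    {a b : Fin n} (hab : a ≠ b) (u : Fin n) :
    (modelMeasure n m Q).real {ω | s(a, b) ∈ graphEdges ω ∧ Overlap ω u} ≤
      m ^ 3 * n * ((n.descFactorial 2 : ℝ)⁻¹ * mom Q 2 1) ^ 3 + 2 * m ^ 2 *
        ((n.descFactorial 2 : ℝ)⁻¹ * mom Q 2 1) *
        ((n.descFactorial 2 : ℝ)⁻¹ * ∫ p, (p.1.descFactorial 2 : ℝ) * p.2 * p.1 ∂Q) := by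
  set p := (n.descFactorial 2 : ℝ)⁻¹ * mom Q 2 1 with hp
  set r := (n.descFactorial 2 : ℝ)⁻¹ * ∫ p, (p.1.descFactorial 2 : ℝ) * p.2 * p.1 ∂Q with hr
  let q : Fin n → ℝ := fun t => (layerMeasure n Q).real
    {L | (t ≠ u ∧ s(u, t) ∈ gEdges L.2) ∧ s(a, b) ∈ gEdges L.2}
  have hq : ∑ t, q t ≤ r := sum_measureReal_edge_inter hQ hab u
  have hq0 : ∀ t, 0 ≤ q t := fun t => measureReal_nonneg
  have hp0 : 0 ≤ p := by
    rw [hp, ← measureReal_edge hQ hab]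
    exact measureReal_nonneg
  let B : Fin m × Fin m × Fin m × Fin n → Set (Fin m → Layer n) := fun x =>
    {ω | x.2.1 ≠ x.2.2.1 ∧ x.2.2.2 ≠ u ∧ s(a, b) ∈ gEdges (ω x.1).2 ∧
      s(u, x.2.2.2) ∈ gEdges (ω x.2.1).2 ∧ s(u, x.2.2.2) ∈ gEdges (ω x.2.2.1).2}
  have hB : ∀ x, (modelMeasure n m Q).real (B x) ≤
      p ^ 3 + (if x.1 = x.2.1 then q x.2.2.2 * p else 0) +
        (if x.1 = x.2.2.1 then q x.2.2.2 * p else 0) := by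
    rintro ⟨j, k, l, t⟩
    simp only [B]
    have hqp : 0 ≤ q t * p := mul_nonneg (hq0 t) hp0
    have hp3 : 0 ≤ p ^ 3 := pow_nonneg hp0 3
    by_cases hkl : k = l
    · simp only [hkl, ne_eq, not_true, false_and, Set.ofPred_false, measureReal_empty]
      split_ifs <;> positivity
    by_cases htu : t = u
    · simp only [htu, ne_eq, not_true, false_and, and_false, Set.ofPred_false, measureReal_empty]
      subst htu
      split_ifs <;> positivity
    have hE := measureReal_edge hQ (Ne.symm htu)
    have hF := measureReal_edge hQ hab
    rw [← hp] at hE hF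
    by_cases hjk : j = k
    · subst hjk
      have h1 := model_real_forall_mem (Q := Q) {j, l} fun i => if i = j then
        {L : Layer n | (t ≠ u ∧ s(u, t) ∈ gEdges L.2) ∧ s(a, b) ∈ gEdges L.2}
        else {L | s(u, t) ∈ gEdges L.2}
      rw [Finset.prod_pair hkl, if_pos rfl, if_neg (Ne.symm hkl), hE] at h1
      have h2 : q t * p ≤ p ^ 3 + (if j = j then q t * p else 0) +
          (if j = l then q t * p else 0) := by simp [hkl, hp3]
      refine le_trans (le_of_le_of_eq (measureReal_mono ?_) h1) h2
      rintro ω ⟨-, -, h3, h4, h5⟩ i hi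
      rcases Finset.mem_insert.1 hi with rfl | hi
      · rw [if_pos rfl]; exact ⟨⟨htu, h4⟩, h3⟩
      · rw [Finset.mem_singleton.1 hi, if_neg (Ne.symm hkl)]; exact h5
    by_cases hjl : j = l
    · subst hjl
      have h1 := model_real_forall_mem (Q := Q) {j, k} fun i => if i = j then
        {L : Layer n | (t ≠ u ∧ s(u, t) ∈ gEdges L.2) ∧ s(a, b) ∈ gEdges L.2}
        else {L | s(u, t) ∈ gEdges L.2}
      rw [Finset.prod_pair hjk, if_pos rfl, if_neg hkl, hE] at h1
      have h2 : q t * p ≤ p ^ 3 + (if j = k then q t * p else 0) +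
          (if j = j then q t * p else 0) := by simp [hjk, hp3]
      refine le_trans (le_of_le_of_eq (measureReal_mono ?_) h1) h2
      rintro ω ⟨-, -, h3, h4, h5⟩ i hi
      rcases Finset.mem_insert.1 hi with rfl | hi
      · rw [if_pos rfl]; exact ⟨⟨htu, h5⟩, h3⟩
      · rw [Finset.mem_singleton.1 hi, if_neg hkl]; exact h4
    have h1 := model_real_forall_mem (Q := Q) {j, k, l} fun i => if i = j then
      {L : Layer n | s(a, b) ∈ gEdges L.2} else {L | s(u, t) ∈ gEdges L.2}
    have h3 : ∀ i : Fin m, (layerMeasure n Q).real (if i = j then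
      {L : Layer n | s(a, b) ∈ gEdges L.2} else {L | s(u, t) ∈ gEdges L.2}) = p := fun i => by
        split_ifs
        · exact hF
        · exact hE
    simp only [h3] at h1
    rw [Finset.prod_const, Finset.card_eq_three.2 ⟨j, k, l, hjk, hjl, hkl, rfl⟩] at h1
    simp only [hjk, hjl, if_false, add_zero]
    refine le_of_le_of_eq (measureReal_mono ?_) h1
    rintro ω ⟨-, -, h4, h5, h6⟩ i hi
    simp only [Finset.mem_insert, Finset.mem_singleton] at hi
    rcases hi with rfl | rfl | rfl
    · rw [if_pos rfl]; exact h4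
    · rw [if_neg (Ne.symm hjk)]; exact h5
    · rw [if_neg (Ne.symm hjl)]; exact h6
  have hsub : {ω : Fin m → Layer n | s(a, b) ∈ graphEdges ω ∧ Overlap ω u} ⊆ ⋃ x, B x := by
    rintro ω ⟨h1, k, l, hkl, t, ht, hk, hl⟩
    obtain ⟨j, hj⟩ := mem_graphEdges.1 h1
    exact Set.mem_iUnion.2 ⟨(j, k, l, t), hkl, ht, hj, hk, hl⟩
  have hsum : (modelMeasure n m Q).real {ω | s(a, b) ∈ graphEdges ω ∧ Overlap ω u} ≤
      ∑ x : Fin m × Fin m × Fin m × Fin n,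
        (p ^ 3 + (if x.1 = x.2.1 then q x.2.2.2 * p else 0) +
        (if x.1 = x.2.2.1 then q x.2.2.2 * p else 0)) :=
    (measureReal_mono hsub).trans ((measureReal_iUnion_fintype_le B).trans
      (Finset.sum_le_sum fun x _ => hB x))
  refine hsum.trans ?_
  have e1 : ∀ j k : Fin m, ∑ t, (if j = k then q t * p else 0) =
      if j = k then (∑ t, q t) * p else 0 := fun j k => by
    split_ifs
    · rw [Finset.sum_mul]
    · simp
  simp only [Finset.sum_add_distrib, Fintype.sum_prod_type, e1]
  simp only [Finset.sum_const, Finset.card_univ, Fintype.card_fin, nsmul_eq_mul, Finset.sum_ite_eq,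
    Finset.mem_univ, if_true, mul_ite, mul_zero]
  have e2 : (m : ℝ) ^ 2 * p * ∑ t, q t ≤ m ^ 2 * p * r :=
    mul_le_mul_of_nonneg_left hq (by positivity)
  linarith

end Overlap

/-- The unnormalized generating function of the degrees of the two first nodes on the event that
they are linked. -/
def linkedPgf (n m : ℕ) (Q : Measure (ℕ × ℝ)) [IsProbabilityMeasure Q] (z w : ℂ) : ℂ :=
  ∫ ω, (if ω ∈ adjEvent n m then z ^ deg ω 0 * w ^ deg ω 1 else 0) ∂modelMeasure n m Q

/-- The scaled first order term of the generating function of a layer degree. -/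
def layerPgf (Q : Measure (ℕ × ℝ)) (z : ℂ) : ℂ :=
  ∫ p, (p.1 : ℝ) • ((1 - p.2 + p.2 * z) ^ (p.1 - 1) - 1 : ℂ) ∂Q

/-- The unnormalized generating function of the degrees of a linked pair in a layer. -/
def layerEdgePgf (Q : Measure (ℕ × ℝ)) (z w : ℂ) : ℂ :=
  ∫ p, (p.1.descFactorial 2 : ℝ) •
    (z * w * p.2 * (1 - p.2 + p.2 * z) ^ (p.1 - 2) * (1 - p.2 + p.2 * w) ^ (p.1 - 2) : ℂ) ∂Q

section

variable {n m : ℕ} {Q : Measure (ℕ × ℝ)} [IsProbabilityMeasure Q]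

theorem norm_pow_mul_pow {z w : ℂ} (hz : ‖z‖ = 1) (hw : ‖w‖ = 1) (a b : ℕ) :
    ‖z ^ a * w ^ b‖ = 1 := by
  rw [norm_mul, norm_pow, norm_pow, hz, hw, one_pow, one_pow, one_mul]

theorem norm_integral_le_one {α : Type*} [MeasurableSpace α] {μ : Measure α}
    [IsProbabilityMeasure μ] {f : α → ℂ} (hf : ∀ x, ‖f x‖ ≤ 1) : ‖∫ x, f x ∂μ‖ ≤ 1 := by
  simpa using norm_integral_le_of_norm_le_const (μ := μ) (Eventually.of_forall hf)

theorem integral_model_linked_sumDeg (u v : Fin n) (z w : ℂ) :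
    ∫ ω, (if s(u, v) ∈ graphEdges ω then z ^ sumDeg ω u * w ^ sumDeg ω v else 0)
        ∂modelMeasure n m Q =
      (∫ L, z ^ gDeg L.2 u * w ^ gDeg L.2 v ∂layerMeasure n Q) ^ m -
        (∫ L, (if s(u, v) ∈ gEdges L.2 then 0 else z ^ gDeg L.2 u * w ^ gDeg L.2 v)
          ∂layerMeasure n Q) ^ m := by
  have h1 : ∀ ω : Fin m → Layer n,
      (if s(u, v) ∈ graphEdges ω then z ^ sumDeg ω u * w ^ sumDeg ω v else 0) =
      (∏ k, z ^ gDeg (ω k).2 u * w ^ gDeg (ω k).2 v) -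
        ∏ k, (if s(u, v) ∈ gEdges (ω k).2 then 0
          else z ^ gDeg (ω k).2 u * w ^ gDeg (ω k).2 v) := by
    intro ω
    have h2 : z ^ sumDeg ω u * w ^ sumDeg ω v =
        ∏ k, z ^ gDeg (ω k).2 u * w ^ gDeg (ω k).2 v := by
      rw [Finset.prod_mul_distrib, Finset.prod_pow_eq_pow_sum, Finset.prod_pow_eq_pow_sum]
      rfl
    by_cases h : s(u, v) ∈ graphEdges ω
    · obtain ⟨k, hk⟩ := mem_graphEdges.1 h
      have h3 : ∏ k, (if s(u, v) ∈ gEdges (ω k).2 then 0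
          else z ^ gDeg (ω k).2 u * w ^ gDeg (ω k).2 v) = 0 :=
        Finset.prod_eq_zero (Finset.mem_univ k) (if_pos hk)
      rw [if_pos h, h3, sub_zero, h2]
    · rw [if_neg h, eq_comm, sub_eq_zero]
      refine Finset.prod_congr rfl fun k _ => ?_
      rw [if_neg fun hk => h (mem_graphEdges.2 ⟨k, hk⟩)]
  simp only [h1]
  refine (integral_sub
    (integrable_model fun σ => ∏ k, z ^ gDeg (σ k) u * w ^ gDeg (σ k) v)
    (integrable_model fun σ => ∏ k, if s(u, v) ∈ gEdges (σ k) then 0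
      else z ^ gDeg (σ k) u * w ^ gDeg (σ k) v)).trans (congrArg₂ _ ?_ ?_)
  · exact (integral_fintype_prod_eq_pow (ι := Fin m)
      (f := fun L : Layer n => z ^ gDeg L.2 u * w ^ gDeg L.2 v)).trans (by rw [Fintype.card_fin])
  · exact (integral_fintype_prod_eq_pow (ι := Fin m) (f := fun L : Layer n =>
      if s(u, v) ∈ gEdges L.2 then 0 else z ^ gDeg L.2 u * w ^ gDeg L.2 v)).trans
      (by rw [Fintype.card_fin])

theorem gDeg_eq_zero {s : LayerGraph n} {v : Fin n} (hv : v ∉ s.1) : gDeg s v = 0 := by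
  rw [gDeg, Finset.card_eq_zero, Finset.filter_eq_empty_iff]
  exact fun e he hve => hv ((mem_gEdges.1 he).2.2 v hve)

theorem norm_pow_sub_one_le {z : ℂ} (hz : ‖z‖ = 1) (a : ℕ) : ‖z ^ a - 1‖ ≤ 2 := by
  refine (norm_sub_le _ _).trans ?_
  rw [norm_pow, hz, one_pow, norm_one]
  norm_num

theorem integral_layer_pow_mul_pow (hQ : ∀ᵐ p ∂Q, p.1 ≤ n ∧ p.2 ∈ Set.Icc (0 : ℝ) 1)
    (hn : 0 < n) {u v : Fin n} (huv : u ≠ v) {z w : ℂ} (hz : ‖z‖ = 1) (hw : ‖w‖ = 1) :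
    ‖n * (∫ L, z ^ gDeg L.2 u * w ^ gDeg L.2 v ∂layerMeasure n Q - 1) -
      (layerPgf Q z + layerPgf Q w)‖ ≤
      n * (4 * ((n.descFactorial 2 : ℝ)⁻¹ * ∫ p, (p.1.descFactorial 2 : ℝ) ∂Q)) := by
  have hz1 : _ = (n : ℝ)⁻¹ • layerPgf Q z := integral_layer_pow_sub_one hQ u z
  have hw1 : _ = (n : ℝ)⁻¹ • layerPgf Q w := integral_layer_pow_sub_one hQ v w
  have hn' : (n : ℂ) ≠ 0 := by exact_mod_cast hn.ne'
  have hsplit : ∫ L, z ^ gDeg L.2 u * w ^ gDeg L.2 v ∂layerMeasure n Q - 1 =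
      ∫ L, (z ^ gDeg L.2 u - 1) ∂layerMeasure n Q + ∫ L, (w ^ gDeg L.2 v - 1) ∂layerMeasure n Q +
      ∫ L, (z ^ gDeg L.2 u - 1) * (w ^ gDeg L.2 v - 1) ∂layerMeasure n Q := by
    rw [← integral_add (integrable_layer fun s => z ^ gDeg s u - 1)
      (integrable_layer fun s => w ^ gDeg s v - 1),
      ← integral_add (integrable_layer fun s => z ^ gDeg s u - 1 + (w ^ gDeg s v - 1))
      (integrable_layer fun s => (z ^ gDeg s u - 1) * (w ^ gDeg s v - 1))]
    have h1 : ∫ L, z ^ gDeg L.2 u * w ^ gDeg L.2 v ∂layerMeasure n Q - 1 =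
        ∫ L, (z ^ gDeg L.2 u * w ^ gDeg L.2 v - 1) ∂layerMeasure n Q := by
      rw [integral_sub (integrable_layer fun s => z ^ gDeg s u * w ^ gDeg s v)
        (integrable_const _)]
      simp
    rw [h1]
    refine integral_congr_ae (Eventually.of_forall fun L => ?_)
    ring
  have hcross : ‖∫ L, (z ^ gDeg L.2 u - 1) * (w ^ gDeg L.2 v - 1) ∂layerMeasure n Q‖ ≤
      4 * ((n.descFactorial 2 : ℝ)⁻¹ * ∫ p, (p.1.descFactorial 2 : ℝ) ∂Q) := by
    rw [← measureReal_pair hQ huv, ← integral_indicator_one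
      (measurableSet_layer fun s => u ∈ s.1 ∧ v ∈ s.1), ← integral_const_mul]
    refine norm_integral_le_of_norm_le ?_ (Eventually.of_forall fun L => ?_)
    · refine Integrable.const_mul ?_ _
      exact (integrable_const (1 : ℝ)).indicator (measurableSet_layer fun s => u ∈ s.1 ∧ v ∈ s.1)
    · by_cases h : u ∈ L.2.1 ∧ v ∈ L.2.1
      · rw [Set.indicator_of_mem (show L ∈ {L : Layer n | u ∈ L.2.1 ∧ v ∈ L.2.1} from h), norm_mul]
        have h1 := norm_pow_sub_one_le hz (gDeg L.2 u)
        have h2 := norm_pow_sub_one_le hw (gDeg L.2 v)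
        have := mul_le_mul h1 h2 (norm_nonneg _) zero_le_two
        simp only [Pi.one_apply]
        linarith
      · rw [Set.indicator_of_notMem (show L ∉ {L : Layer n | u ∈ L.2.1 ∧ v ∈ L.2.1} from h)]
        rcases not_and_or.1 h with h | h
        · simp [gDeg_eq_zero h]
        · simp [gDeg_eq_zero h]
  have hfinal : n * (∫ L, z ^ gDeg L.2 u * w ^ gDeg L.2 v ∂layerMeasure n Q - 1) -
      (layerPgf Q z + layerPgf Q w) =
      n * ∫ L, (z ^ gDeg L.2 u - 1) * (w ^ gDeg L.2 v - 1) ∂layerMeasure n Q := by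
    rw [hsplit, hz1, hw1]
    simp only [Complex.real_smul, Complex.ofReal_inv, Complex.ofReal_natCast]
    field_simp
    ring
  rw [hfinal, norm_mul, Complex.norm_natCast]
  exact mul_le_mul_of_nonneg_left hcross (Nat.cast_nonneg _)

theorem linkedPgf_sub_le (hQ : ∀ᵐ p ∂Q, p.1 ≤ n ∧ p.2 ∈ Set.Icc (0 : ℝ) 1)
    {u v : Fin n} (hu : (u : ℕ) = 0) (hv : (v : ℕ) = 1) {z w : ℂ} (hz : ‖z‖ = 1) (hw : ‖w‖ = 1) :
    ‖linkedPgf n m Q z w -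
      ∫ ω, (if s(u, v) ∈ graphEdges ω then z ^ sumDeg ω u * w ^ sumDeg ω v else 0)
        ∂modelMeasure n m Q‖ ≤
      4 * (m ^ 3 * n * ((n.descFactorial 2 : ℝ)⁻¹ * mom Q 2 1) ^ 3 + 2 * m ^ 2 *
        ((n.descFactorial 2 : ℝ)⁻¹ * mom Q 2 1) *
        ((n.descFactorial 2 : ℝ)⁻¹ * ∫ p, (p.1.descFactorial 2 : ℝ) * p.2 * p.1 ∂Q)) := by
  have huv : u ≠ v := fun h => by rw [h, hv] at hu; exact one_ne_zero hu
  have hbu := model_real_overlap_le (m := m) hQ huv u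
  have hbv := model_real_overlap_le (m := m) hQ huv v
  have hms : ∀ t : Fin n,
      MeasurableSet {ω : Fin m → Layer n | s(u, v) ∈ graphEdges ω ∧ Overlap ω t} :=
    fun t => measurableSet_model fun σ =>
      s(u, v) ∈ graphEdges (fun k => (((0 : ℕ), (0 : ℝ)), σ k)) ∧
        Overlap (fun k => (((0 : ℕ), (0 : ℝ)), σ k)) t
  have hi1 : Integrable (fun ω : Fin m → Layer n =>
      if s(u, v) ∈ graphEdges ω then z ^ deg ω 0 * w ^ deg ω 1 else 0) (modelMeasure n m Q) :=
    integrable_model fun σ => if s(u, v) ∈ graphEdges (fun k => (((0 : ℕ), (0 : ℝ)), σ k)) then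
      z ^ deg (fun k => (((0 : ℕ), (0 : ℝ)), σ k)) 0 *
        w ^ deg (fun k => (((0 : ℕ), (0 : ℝ)), σ k)) 1 else 0
  have hi2 : Integrable (fun ω : Fin m → Layer n =>
      if s(u, v) ∈ graphEdges ω then z ^ sumDeg ω u * w ^ sumDeg ω v else 0)
      (modelMeasure n m Q) :=
    integrable_model fun σ => if s(u, v) ∈ graphEdges (fun k => (((0 : ℕ), (0 : ℝ)), σ k)) then
      z ^ sumDeg (fun k => (((0 : ℕ), (0 : ℝ)), σ k)) u *
        w ^ sumDeg (fun k => (((0 : ℕ), (0 : ℝ)), σ k)) v else 0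
  simp only [linkedPgf, mem_adjEvent hu hv]
  rw [← integral_sub hi1 hi2]
  have hiu := fun t => (integrable_const (μ := modelMeasure n m Q) (2 : ℝ)).indicator (hms t)
  refine (norm_integral_le_of_norm_le ((hiu u).add (hiu v))
    (Eventually.of_forall fun ω => ?_)).trans ?_
  · have hnn : ∀ t, 0 ≤ {ω : Fin m → Layer n | s(u, v) ∈ graphEdges ω ∧ Overlap ω t}.indicator
        (fun _ => (2 : ℝ)) ω := fun t => Set.indicator_nonneg (fun _ _ => zero_le_two) _
    by_cases he : s(u, v) ∈ graphEdges ω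
    · rw [if_pos he, if_pos he, Pi.add_apply]
      have h2 : ‖z ^ deg ω 0 * w ^ deg ω 1 - z ^ sumDeg ω u * w ^ sumDeg ω v‖ ≤ 2 := by
        refine (norm_sub_le _ _).trans ?_
        rw [norm_pow_mul_pow hz hw, norm_pow_mul_pow hz hw]
        norm_num
      by_cases hou : Overlap ω u
      · have := hnn v
        rw [Set.indicator_of_mem (show ω ∈ {ω : Fin m → Layer n | s(u, v) ∈ graphEdges ω ∧
          Overlap ω u} from ⟨he, hou⟩)]
        linarith
      by_cases hov : Overlap ω v
      · have := hnn u
        rw [Set.indicator_of_mem (show ω ∈ {ω : Fin m → Layer n | s(u, v) ∈ graphEdges ω ∧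
          Overlap ω v} from ⟨he, hov⟩)]
        linarith
      rw [← deg_eq_sumDeg hou, ← deg_eq_sumDeg hov, hu, hv, sub_self, norm_zero]
      exact add_nonneg (hnn u) (hnn v)
    · rw [if_neg he, if_neg he, sub_self, norm_zero]
      exact add_nonneg (hnn u) (hnn v)
  · rw [integral_add' (hiu u) (hiu v), integral_indicator_const _ (hms u),
      integral_indicator_const _ (hms v)]
    simp only [smul_eq_mul]
    linarith

theorem exists_linkedPgf_approx (hQ : ∀ᵐ p ∂Q, p.1 ≤ n ∧ p.2 ∈ Set.Icc (0 : ℝ) 1)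
    (hn : 2 ≤ n) {z w : ℂ} (hz : ‖z‖ = 1) (hw : ‖w‖ = 1) :
    ∃ B C : ℂ, ‖B‖ ≤ 1 ∧ ‖B - C‖ ≤ 1 ∧
      C = (n.descFactorial 2 : ℝ)⁻¹ • layerEdgePgf Q z w ∧
      ‖n * (B - 1) - (layerPgf Q z + layerPgf Q w)‖ ≤
        n * (4 * ((n.descFactorial 2 : ℝ)⁻¹ * ∫ p, (p.1.descFactorial 2 : ℝ) ∂Q)) ∧
      ‖linkedPgf n m Q z w - (B ^ m - (B - C) ^ m)‖ ≤
        4 * (m ^ 3 * n * ((n.descFactorial 2 : ℝ)⁻¹ * mom Q 2 1) ^ 3 + 2 * m ^ 2 *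
          ((n.descFactorial 2 : ℝ)⁻¹ * mom Q 2 1) *
          ((n.descFactorial 2 : ℝ)⁻¹ * ∫ p, (p.1.descFactorial 2 : ℝ) * p.2 * p.1 ∂Q)) := by
  let u : Fin n := ⟨0, by omega⟩
  let v : Fin n := ⟨1, by omega⟩
  have huv : u ≠ v := fun h => zero_ne_one (congrArg Fin.val h)
  have hBC : ∫ L, z ^ gDeg L.2 u * w ^ gDeg L.2 v ∂layerMeasure n Q -
      ∫ L, (if s(u, v) ∈ gEdges L.2 then z ^ gDeg L.2 u * w ^ gDeg L.2 v else 0)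
        ∂layerMeasure n Q =
      ∫ L, (if s(u, v) ∈ gEdges L.2 then 0 else z ^ gDeg L.2 u * w ^ gDeg L.2 v)
        ∂layerMeasure n Q := by
    rw [← integral_sub (integrable_layer fun s => z ^ gDeg s u * w ^ gDeg s v)
      (integrable_layer fun s => if s(u, v) ∈ gEdges s then z ^ gDeg s u * w ^ gDeg s v else 0)]
    refine integral_congr_ae (Eventually.of_forall fun L => ?_)
    by_cases h : s(u, v) ∈ gEdges L.2 <;> simp [h]
  refine ⟨∫ L, z ^ gDeg L.2 u * w ^ gDeg L.2 v ∂layerMeasure n Q,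
    ∫ L, (if s(u, v) ∈ gEdges L.2 then z ^ gDeg L.2 u * w ^ gDeg L.2 v else 0)
      ∂layerMeasure n Q, ?_, ?_, integral_layer_edge hQ huv z w, ?_, ?_⟩
  · exact norm_integral_le_one fun L => (norm_pow_mul_pow hz hw _ _).le
  · rw [hBC]
    refine norm_integral_le_one fun L => ?_
    split_ifs
    · simp
    · exact (norm_pow_mul_pow hz hw _ _).le
  · exact integral_layer_pow_mul_pow hQ (by omega) huv hz hw
  · rw [hBC, ← integral_model_linked_sumDeg]
    exact linkedPgf_sub_le hQ rfl rfl hz hw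

end

theorem norm_pow_sub_pow_le_mul {a b : ℂ} (ha : ‖a‖ ≤ 1) (hb : ‖b‖ ≤ 1) (k : ℕ) :
    ‖a ^ k - b ^ k‖ ≤ k * ‖a - b‖ := by
  induction k with
  | zero => simp
  | succ k ih =>
    have h : a ^ (k + 1) - b ^ (k + 1) = a ^ k * (a - b) + (a ^ k - b ^ k) * b := by ring
    rw [h]
    refine (norm_add_le _ _).trans ?_
    rw [norm_mul, norm_mul, norm_pow]
    have h1 : ‖a‖ ^ k * ‖a - b‖ ≤ 1 * ‖a - b‖ :=
      mul_le_mul_of_nonneg_right (pow_le_one₀ (norm_nonneg _) ha) (norm_nonneg _)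
    have h2 : ‖a ^ k - b ^ k‖ * ‖b‖ ≤ k * ‖a - b‖ * 1 :=
      mul_le_mul ih hb (norm_nonneg _) (by positivity)
    push_cast
    linarith

/-- A triangular version of `(1 + b / n) ^ k → exp (μ b)` as `k / n → μ` inside the unit disc. -/
theorem tendsto_pow_exp_of_norm_le_one {x : ℕ → ℂ} (hx : ∀ᶠ n in atTop, ‖x n‖ ≤ 1) {b : ℂ}
    (hb : Tendsto (fun n : ℕ => n * (x n - 1)) atTop (𝓝 b)) {k : ℕ → ℕ} {mu : ℝ}
    (hk : Tendsto (fun n : ℕ => (k n : ℝ) / n) atTop (𝓝 mu)) :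
    Tendsto (fun n => x n ^ k n) atTop (𝓝 (Complex.exp (mu * b))) := by
  have hkc : Tendsto (fun n : ℕ => (k n : ℂ) / n) atTop (𝓝 (mu : ℂ)) :=
    ((Complex.continuous_ofReal.tendsto _).comp hk).congr fun n => by simp
  have hmain : Tendsto (fun n : ℕ => (k n : ℂ) * (x n - 1)) atTop (𝓝 (mu * b)) := by
    refine (hkc.mul hb).congr' ?_
    filter_upwards [eventually_ne_atTop 0] with n hn
    have : (n : ℂ) ≠ 0 := by exact_mod_cast hn
    field_simp
  have hx1 : Tendsto (fun n => x n - 1) atTop (𝓝 0) := by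
    have h0 : Tendsto (fun n : ℕ => ((n : ℂ))⁻¹) atTop (𝓝 0) :=
      tendsto_inv_atTop_nhds_zero_nat
    have := h0.mul hb
    rw [zero_mul] at this
    refine this.congr' ?_
    filter_upwards [eventually_ne_atTop 0] with n hn
    have : (n : ℂ) ≠ 0 := by exact_mod_cast hn
    field_simp
  have herr : Tendsto (fun n => ‖(k n : ℂ) * (x n - 1)‖ * ‖x n - 1‖) atTop (𝓝 0) := by
    have := hmain.norm.mul hx1.norm
    simpa using this
  have hdiff : Tendsto (fun n => x n ^ k n - Complex.exp (k n * (x n - 1))) atTop (𝓝 0) := by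
    refine squeeze_zero_norm' ?_ herr
    filter_upwards [hx, hx1.norm.eventually (ge_mem_nhds (a := (1 : ℝ)) (by simp))] with n h1 h2
    have h3 : ‖Complex.exp (x n - 1)‖ ≤ 1 := by
      rw [Complex.norm_exp, Real.exp_le_one_iff, Complex.sub_re, Complex.one_re]
      have := (Complex.re_le_norm (x n)).trans h1
      linarith
    rw [Complex.exp_nat_mul]
    refine (norm_pow_sub_pow_le_mul h1 h3 _).trans ?_
    have h4 := Complex.norm_exp_sub_one_sub_id_le (x := x n - 1) h2
    have h5 : ‖x n - Complex.exp (x n - 1)‖ ≤ ‖x n - 1‖ ^ 2 := by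
      rw [norm_sub_rev]
      have e : Complex.exp (x n - 1) - x n = Complex.exp (x n - 1) - 1 - (x n - 1) := by ring
      rw [e]
      exact h4
    rw [norm_mul, Complex.norm_natCast, mul_assoc, ← sq]
    exact mul_le_mul_of_nonneg_left h5 (Nat.cast_nonneg _)
  have := hdiff.add ((Complex.continuous_exp.tendsto _).comp hmain)
  rw [zero_add] at this
  exact this.congr fun n => by simp

theorem norm_pow_sub_pow_sub_le {B C : ℂ} (hB : ‖B‖ ≤ 1) (hBC : ‖B - C‖ ≤ 1) (m : ℕ) :
    ‖B ^ m - (B - C) ^ m - C * (m * B ^ m)‖ ≤ ‖C‖ * (m * (m * ‖C‖ + ‖B - 1‖)) := by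
  have h1 : B ^ m - (B - C) ^ m - C * (m * B ^ m) =
      C * ∑ i ∈ Finset.range m, (B ^ i * (B - C) ^ (m - 1 - i) - B ^ m) := by
    rw [← geom_sum₂_mul, Finset.sum_sub_distrib, Finset.sum_const, Finset.card_range, nsmul_eq_mul]
    ring
  rw [h1, norm_mul]
  refine mul_le_mul_of_nonneg_left ((norm_sum_le _ _).trans ?_) (norm_nonneg _)
  refine (Finset.sum_le_card_nsmul _ _ (m * ‖C‖ + ‖B - 1‖) fun i hi => ?_).trans_eq
    (by rw [Finset.card_range, nsmul_eq_mul])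
  have hi := Finset.mem_range.1 hi
  have h2 : B ^ i * (B - C) ^ (m - 1 - i) - B ^ m =
      B ^ i * ((B - C) ^ (m - 1 - i) - B ^ (m - 1 - i)) - B ^ (m - 1) * (B - 1) := by
    obtain ⟨j, rfl⟩ : ∃ j, m = i + j + 1 := ⟨m - i - 1, by omega⟩
    have : i + j + 1 - 1 - i = j := by omega
    rw [this, Nat.add_sub_cancel]
    ring
  rw [h2]
  refine (norm_sub_le _ _).trans ?_
  rw [norm_mul, norm_mul, norm_pow, norm_pow]
  have h3 : ‖B‖ ^ (m - 1) * ‖B - 1‖ ≤ 1 * ‖B - 1‖ :=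
    mul_le_mul_of_nonneg_right (pow_le_one₀ (norm_nonneg _) hB) (norm_nonneg _)
  have h4 := norm_pow_sub_pow_le_mul hBC hB (m - 1 - i)
  rw [sub_sub_cancel_left, norm_neg] at h4
  have h5 : ((m - 1 - i : ℕ) : ℝ) * ‖C‖ ≤ m * ‖C‖ :=
    mul_le_mul_of_nonneg_right (by exact_mod_cast (by omega : m - 1 - i ≤ m)) (norm_nonneg _)
  have h6 : ‖B‖ ^ i * ‖(B - C) ^ (m - 1 - i) - B ^ (m - 1 - i)‖ ≤ 1 * (m * ‖C‖) :=
    mul_le_mul (pow_le_one₀ (norm_nonneg _) hB) (h4.trans h5) (norm_nonneg _) zero_le_one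
  linarith

theorem tendsto_nat_mul_pow_sub_pow {B C : ℕ → ℂ} (hB : ∀ᶠ n in atTop, ‖B n‖ ≤ 1)
    (hBC : ∀ᶠ n in atTop, ‖B n - C n‖ ≤ 1) {b c : ℂ}
    (hb : Tendsto (fun n : ℕ => n * (B n - 1)) atTop (𝓝 b))
    (hc : Tendsto (fun n : ℕ => (n : ℂ) ^ 2 * C n) atTop (𝓝 c)) {m : ℕ → ℕ} {mu : ℝ}
    (hm : Tendsto (fun n : ℕ => (m n : ℝ) / n) atTop (𝓝 mu)) :
    Tendsto (fun n : ℕ => n * (B n ^ m n - (B n - C n) ^ m n)) atTop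
      (𝓝 (mu * c * Complex.exp (mu * b))) := by
  have hmc : Tendsto (fun n : ℕ => (m n : ℂ) / n) atTop (𝓝 (mu : ℂ)) :=
    ((Complex.continuous_ofReal.tendsto _).comp hm).congr fun n => by simp
  have h0 : Tendsto (fun n : ℕ => ((n : ℝ))⁻¹) atTop (𝓝 0) := tendsto_inv_atTop_nhds_zero_nat
  have hpow := tendsto_pow_exp_of_norm_le_one hB hb hm
  have h1 : Tendsto (fun n : ℕ => n * (C n * (m n * B n ^ m n))) atTop
      (𝓝 (mu * c * Complex.exp (mu * b))) := by
    refine ((hmc.mul hc).mul hpow).congr' ?_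
    filter_upwards [eventually_ne_atTop 0] with n hn
    have : (n : ℂ) ≠ 0 := by exact_mod_cast hn
    field_simp
  have herr : Tendsto (fun n : ℕ => ((m n : ℝ) / n * ‖(n : ℂ) ^ 2 * C n‖) *
      (((m n : ℝ) / n * ‖(n : ℂ) ^ 2 * C n‖ + ‖n * (B n - 1)‖) * ((n : ℝ))⁻¹)) atTop (𝓝 0) := by
    have := (hm.mul hc.norm).mul (((hm.mul hc.norm).add hb.norm).mul h0)
    simpa only [mul_zero] using this
  have h2 : Tendsto (fun n : ℕ => n * (B n ^ m n - (B n - C n) ^ m n - C n * (m n * B n ^ m n)))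
      atTop (𝓝 0) := by
    refine squeeze_zero_norm' ?_ herr
    filter_upwards [hB, hBC, eventually_ne_atTop 0] with n h3 h4 hn
    have hn' : (n : ℝ) ≠ 0 := by exact_mod_cast hn
    rw [norm_mul, norm_mul, norm_mul, norm_pow, Complex.norm_natCast]
    refine (mul_le_mul_of_nonneg_left (norm_pow_sub_pow_sub_le h3 h4 (m n))
      (Nat.cast_nonneg n)).trans_eq ?_
    field_simp
  have := h2.add h1
  rw [zero_add] at this
  exact this.congr fun n => by ring

theorem norm_one_sub_add_mul_le {y : ℝ} (hy : y ∈ Set.Icc (0 : ℝ) 1) {z : ℂ} (hz : ‖z‖ = 1) :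
    ‖(1 - y + y * z : ℂ)‖ ≤ 1 := by
  refine (norm_add_le _ _).trans ?_
  have h1 : ‖(1 - y : ℂ)‖ = 1 - y := by
    rw [← Complex.ofReal_one, ← Complex.ofReal_sub, Complex.norm_real, Real.norm_eq_abs,
      abs_of_nonneg (sub_nonneg.2 hy.2)]
  rw [h1, norm_mul, hz, mul_one, Complex.norm_real, Real.norm_eq_abs, abs_of_nonneg hy.1]
  simp

theorem norm_one_sub_add_mul_pow_le {y : ℝ} (hy : y ∈ Set.Icc (0 : ℝ) 1) {z : ℂ} (hz : ‖z‖ = 1)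
    (k : ℕ) : ‖(1 - y + y * z : ℂ) ^ k‖ ≤ 1 := by
  rw [norm_pow]
  exact pow_le_one₀ (norm_nonneg _) (norm_one_sub_add_mul_le hy hz)

theorem tendsto_sq_mul_inv_descFactorial :
    Tendsto (fun n : ℕ => (n : ℝ) ^ 2 * (n.descFactorial 2 : ℝ)⁻¹) atTop (𝓝 1) := by
  have h := tendsto_natCast_div_add_atTop (𝕜 := ℝ) (-1 : ℝ)
  refine h.congr' ?_
  filter_upwards [eventually_ge_atTop 2] with n hn
  have h1 : (n.descFactorial 2 : ℝ) = n * (n - 1) := by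
    rw [Nat.cast_descFactorial_two]
  have h2 : (2 : ℝ) ≤ n := by exact_mod_cast hn
  rw [h1, ← sub_eq_add_neg]
  have h3 : (n : ℝ) - 1 ≠ 0 := by linarith
  have h4 : (n : ℝ) ≠ 0 := by linarith
  field_simp

theorem layerEdgePgf_one_one (Q : Measure (ℕ × ℝ)) : layerEdgePgf Q 1 1 = mom Q 2 1 := by
  unfold layerEdgePgf mom
  rw [← integral_complex_ofReal]
  refine integral_congr_ae (Eventually.of_forall fun p => ?_)
  simp

theorem layerPgf_one (Q : Measure (ℕ × ℝ)) : layerPgf Q 1 = 0 := by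
  unfold layerPgf
  simp

section WeakLimit

variable {Pn : ℕ → ProbabilityMeasure (ℕ × ℝ)} {P : ProbabilityMeasure (ℕ × ℝ)}

theorem tendsto_layerEdgePgf (hw : Tendsto Pn atTop (𝓝 P))
    (hs : ∀ n, ∀ᵐ p ∂(Pn n : Measure (ℕ × ℝ)), p.1 ≤ n ∧ p.2 ∈ Set.Icc (0 : ℝ) 1)
    (hPs : ∀ᵐ p ∂(P : Measure (ℕ × ℝ)), p.2 ∈ Set.Icc (0 : ℝ) 1)
    (h_int : Integrable (fun p : ℕ × ℝ => (p.1.descFactorial 2 : ℝ) * p.2 ^ 1)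
      (P : Measure (ℕ × ℝ)))
    (h21 : Tendsto (fun n : ℕ => mom (Pn n : Measure (ℕ × ℝ)) 2 1) atTop
      (𝓝 (mom (P : Measure (ℕ × ℝ)) 2 1))) {z w : ℂ} (hz : ‖z‖ = 1) (hw' : ‖w‖ = 1) :
    Tendsto (fun n => layerEdgePgf (Pn n : Measure (ℕ × ℝ)) z w) atTop
      (𝓝 (layerEdgePgf (P : Measure (ℕ × ℝ)) z w)) := by
  refine tendsto_integral_complex_of_dominated hw hs hPs
    (f := fun p => (p.1.descFactorial 2 : ℝ) * p.2 ^ 1) (fun x => ?_) (fun x => ?_) ?_ h_int h21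
  · fun_prop
  · show Continuous fun y : ℝ => (x.descFactorial 2 : ℝ) •
      (z * w * y * (1 - y + y * z) ^ (x - 2) * (1 - y + y * w) ^ (x - 2) : ℂ)
    fun_prop
  · intro x y hy
    simp only [norm_smul, norm_mul, hz, hw', one_mul, pow_one, Complex.norm_real]
    have h1 := norm_one_sub_add_mul_pow_le hy hz (x - 2)
    have h2 := norm_one_sub_add_mul_pow_le hy hw' (x - 2)
    rw [Real.norm_of_nonneg (Nat.cast_nonneg _), Real.norm_of_nonneg hy.1]
    refine mul_le_mul_of_nonneg_left ?_ (Nat.cast_nonneg _)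
    rw [mul_assoc]
    exact mul_le_of_le_one_right hy.1 (mul_le_one₀ h1 (norm_nonneg _) h2)

theorem layerPgf_eq_sub {Q : Measure (ℕ × ℝ)} (hQ : ∀ᵐ p ∂Q, p.2 ∈ Set.Icc (0 : ℝ) 1)
    (h_int : Integrable (fun p : ℕ × ℝ => (p.1 : ℝ)) Q) {z : ℂ} (hz : ‖z‖ = 1) :
    layerPgf Q z = (∫ p, (p.1 : ℂ) * (1 - p.2 + p.2 * z) ^ (p.1 - 1) ∂Q) - mom Q 1 0 := by
  have h1 : ((mom Q 1 0 : ℝ) : ℂ) = ∫ p, (p.1 : ℂ) ∂Q := by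
    unfold mom
    rw [← integral_complex_ofReal]
    simp
  rw [h1, ← integral_sub]
  · refine integral_congr_ae (Eventually.of_forall fun p => ?_)
    simp only [Complex.real_smul, Complex.ofReal_natCast]
    ring
  · refine h_int.mono' (measurable_of_continuous_snd fun x => ?_).aestronglyMeasurable ?_
    · show Continuous fun y : ℝ => (x : ℂ) * (1 - y + y * z) ^ (x - 1)
      fun_prop
    · filter_upwards [hQ] with p hp
      rw [norm_mul, Complex.norm_natCast]
      exact mul_le_of_le_one_right (Nat.cast_nonneg _) (norm_one_sub_add_mul_pow_le hp hz _)
  · simpa using h_int.ofReal (𝕜 := ℂ)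

theorem tendsto_layerPgf (hw : Tendsto Pn atTop (𝓝 P))
    (hs : ∀ n, ∀ᵐ p ∂(Pn n : Measure (ℕ × ℝ)), p.1 ≤ n ∧ p.2 ∈ Set.Icc (0 : ℝ) 1)
    (hPs : ∀ᵐ p ∂(P : Measure (ℕ × ℝ)), p.2 ∈ Set.Icc (0 : ℝ) 1)
    (h_int : Integrable (fun p : ℕ × ℝ => (p.1 : ℝ)) (P : Measure (ℕ × ℝ)))
    (h10 : Tendsto (fun n : ℕ => mom (Pn n : Measure (ℕ × ℝ)) 1 0) atTop
      (𝓝 (mom (P : Measure (ℕ × ℝ)) 1 0))) {z : ℂ} (hz : ‖z‖ = 1) :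
    Tendsto (fun n => layerPgf (Pn n : Measure (ℕ × ℝ)) z) atTop
      (𝓝 (layerPgf (P : Measure (ℕ × ℝ)) z)) := by
  have hmom : ∀ Q : Measure (ℕ × ℝ), mom Q 1 0 = ∫ p, (p.1 : ℝ) ∂Q := fun Q => by simp [mom]
  have hintn : ∀ n, Integrable (fun p : ℕ × ℝ => (p.1 : ℝ)) (Pn n : Measure (ℕ × ℝ)) := fun n =>
    integrable_of_support_le (hs n) fun x => by show Continuous fun _ : ℝ => (x : ℝ); fun_prop
  have h1 : ∀ n, layerPgf (Pn n : Measure (ℕ × ℝ)) z = _ := fun n =>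
    layerPgf_eq_sub ((hs n).mono fun p hp => hp.2) (hintn n) hz
  rw [layerPgf_eq_sub hPs h_int hz]
  simp only [h1]
  refine Tendsto.sub ?_ ((Complex.continuous_ofReal.tendsto _).comp h10)
  simp only [hmom] at h10
  refine tendsto_integral_complex_of_dominated hw hs hPs (fun x => ?_) (fun x => ?_) ?_ h_int h10
  · show Continuous fun _ : ℝ => (x : ℝ)
    fun_prop
  · show Continuous fun y : ℝ => (x : ℂ) * (1 - y + y * z) ^ (x - 1)
    fun_prop
  · intro x y hy
    rw [norm_mul, Complex.norm_natCast]
    exact mul_le_of_le_one_right (Nat.cast_nonneg _) (norm_one_sub_add_mul_pow_le hy hz _)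

theorem tendsto_integral_descFactorial_two_div (hw : Tendsto Pn atTop (𝓝 P))
    (hs : ∀ n, ∀ᵐ p ∂(Pn n : Measure (ℕ × ℝ)), p.1 ≤ n ∧ p.2 ∈ Set.Icc (0 : ℝ) 1)
    (hPs : ∀ᵐ p ∂(P : Measure (ℕ × ℝ)), p.2 ∈ Set.Icc (0 : ℝ) 1)
    (h_int : Integrable (fun p : ℕ × ℝ => (p.1 : ℝ)) (P : Measure (ℕ × ℝ)))
    (h10 : Tendsto (fun n : ℕ => mom (Pn n : Measure (ℕ × ℝ)) 1 0) atTop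
      (𝓝 (mom (P : Measure (ℕ × ℝ)) 1 0))) :
    Tendsto (fun n => (∫ p, (p.1.descFactorial 2 : ℝ) ∂(Pn n : Measure (ℕ × ℝ))) / n) atTop
      (𝓝 0) := by
  have hmom : ∀ Q : Measure (ℕ × ℝ), mom Q 1 0 = ∫ p, (p.1 : ℝ) ∂Q := fun Q => by simp [mom]
  simp only [hmom] at h10
  have h := tendsto_integral_mul_fst_div hw hs hPs (f := fun p => (p.1 : ℝ))
    (fun x => by show Continuous fun _ : ℝ => (x : ℝ); fun_prop)
    (fun x y _ => Nat.cast_nonneg _) h_int h10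
  refine squeeze_zero (fun n => div_nonneg (integral_nonneg fun p => Nat.cast_nonneg _)
    (Nat.cast_nonneg _)) (fun n => ?_) h
  refine div_le_div_of_nonneg_right (integral_mono ?_ ?_ fun p => ?_) (Nat.cast_nonneg _)
  · exact integrable_of_support_le (hs n) fun x => by
      show Continuous fun _ : ℝ => (x.descFactorial 2 : ℝ); fun_prop
  · exact integrable_of_support_le (hs n) fun x => by
      show Continuous fun _ : ℝ => (x : ℝ) * (x : ℝ); fun_prop
  · have := Nat.descFactorial_le_pow p.1 2
    have h2 : ((p.1.descFactorial 2 : ℕ) : ℝ) ≤ (p.1 : ℝ) ^ 2 := by exact_mod_cast this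
    simpa [sq] using h2

theorem tendsto_nat_mul_linkedPgf {mu : ℝ} {m : ℕ → ℕ}
    (hm : Tendsto (fun n : ℕ => (m n : ℝ) / n) atTop (𝓝 mu)) (hw : Tendsto Pn atTop (𝓝 P))
    (hs : ∀ n, ∀ᵐ p ∂(Pn n : Measure (ℕ × ℝ)), p.1 ≤ n ∧ p.2 ∈ Set.Icc (0 : ℝ) 1)
    (hPs : ∀ᵐ p ∂(P : Measure (ℕ × ℝ)), p.2 ∈ Set.Icc (0 : ℝ) 1)
    (hint10 : Integrable (fun p : ℕ × ℝ => (p.1 : ℝ)) (P : Measure (ℕ × ℝ)))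
    (hint21 : Integrable (fun p : ℕ × ℝ => (p.1.descFactorial 2 : ℝ) * p.2 ^ 1)
      (P : Measure (ℕ × ℝ)))
    (h10 : Tendsto (fun n : ℕ => mom (Pn n : Measure (ℕ × ℝ)) 1 0) atTop
      (𝓝 (mom (P : Measure (ℕ × ℝ)) 1 0)))
    (h21 : Tendsto (fun n : ℕ => mom (Pn n : Measure (ℕ × ℝ)) 2 1) atTop
      (𝓝 (mom (P : Measure (ℕ × ℝ)) 2 1))) {z w : ℂ} (hz : ‖z‖ = 1) (hw' : ‖w‖ = 1) :
    Tendsto (fun n : ℕ => n * linkedPgf n (m n) (Pn n : Measure (ℕ × ℝ)) z w) atTop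
      (𝓝 (mu * layerEdgePgf (P : Measure (ℕ × ℝ)) z w *
        Complex.exp (mu * (layerPgf (P : Measure (ℕ × ℝ)) z +
          layerPgf (P : Measure (ℕ × ℝ)) w)))) := by
  have key : ∀ n : ℕ, ∃ B C : ℂ, 2 ≤ n → _ := fun n => by
    by_cases hn : 2 ≤ n
    · obtain ⟨B, C, h⟩ := exists_linkedPgf_approx (m := m n) (hs n) hn hz hw'
      exact ⟨B, C, fun _ => h⟩
    · exact ⟨0, 0, fun h => absurd h hn⟩
  choose B C hBC using key
  have hinv : Tendsto (fun n : ℕ => ((n : ℝ))⁻¹) atTop (𝓝 0) := tendsto_inv_atTop_nhds_zero_nat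
  have hsq := tendsto_sq_mul_inv_descFactorial
  have hc : Tendsto (fun n : ℕ => (n : ℂ) ^ 2 * C n) atTop
      (𝓝 (layerEdgePgf (P : Measure (ℕ × ℝ)) z w)) := by
    have h := ((Complex.continuous_ofReal.tendsto _).comp hsq).mul
      (tendsto_layerEdgePgf hw hs hPs hint21 h21 hz hw')
    rw [Complex.ofReal_one, one_mul] at h
    refine h.congr' ?_
    filter_upwards [eventually_ge_atTop 2] with n hn
    rw [(hBC n hn).2.2.1, Complex.real_smul]
    simp [mul_assoc]
  have hb : Tendsto (fun n : ℕ => n * (B n - 1)) atTop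
      (𝓝 (layerPgf (P : Measure (ℕ × ℝ)) z + layerPgf (P : Measure (ℕ × ℝ)) w)) := by
    have h1 := (tendsto_layerPgf hw hs hPs hint10 h10 hz).add
      (tendsto_layerPgf hw hs hPs hint10 h10 hw')
    have h2 := ((hsq.const_mul 4).mul (tendsto_integral_descFactorial_two_div hw hs hPs hint10 h10))
    rw [mul_zero] at h2
    have h3 : Tendsto (fun n : ℕ => n * (B n - 1) - (layerPgf (Pn n : Measure (ℕ × ℝ)) z +
        layerPgf (Pn n : Measure (ℕ × ℝ)) w)) atTop (𝓝 0) := by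
      refine squeeze_zero_norm' ?_ h2
      filter_upwards [eventually_ge_atTop 2] with n hn
      refine (hBC n hn).2.2.2.1.trans_eq ?_
      have : (n : ℝ) ≠ 0 := by norm_cast; omega
      field_simp
    have := h3.add h1
    rw [zero_add] at this
    exact this.congr fun n => by ring
  have hmain := tendsto_nat_mul_pow_sub_pow
    ((eventually_ge_atTop 2).mono fun n hn => (hBC n hn).1)
    ((eventually_ge_atTop 2).mono fun n hn => (hBC n hn).2.1) hb hc hm
  have hR := tendsto_integral_mul_fst_div hw hs hPs
    (f := fun p => (p.1.descFactorial 2 : ℝ) * p.2 ^ 1)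
    (fun x => by show Continuous fun y : ℝ => (x.descFactorial 2 : ℝ) * y ^ 1; fun_prop)
    (fun x y hy => by have := hy.1; positivity) hint21 h21
  have herr : Tendsto (fun n : ℕ => n * (4 * ((m n : ℝ) ^ 3 * n *
      ((n.descFactorial 2 : ℝ)⁻¹ * mom (Pn n : Measure (ℕ × ℝ)) 2 1) ^ 3 + 2 * (m n : ℝ) ^ 2 *
      ((n.descFactorial 2 : ℝ)⁻¹ * mom (Pn n : Measure (ℕ × ℝ)) 2 1) *
      ((n.descFactorial 2 : ℝ)⁻¹ *
        ∫ p, (p.1.descFactorial 2 : ℝ) * p.2 * p.1 ∂(Pn n : Measure (ℕ × ℝ)))))) atTop (𝓝 0) := by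
    have h1 := (((((hm.pow 3).mul (hsq.pow 3)).mul (h21.pow 3)).mul hinv).add
      (((((hm.pow 2).mul (hsq.pow 2)).mul h21).mul hR).const_mul 2)).const_mul 4
    simp only [mul_zero, add_zero] at h1
    refine h1.congr' ?_
    filter_upwards [eventually_ge_atTop 2] with n hn
    have : (n : ℝ) ≠ 0 := by norm_cast; omega
    simp only [pow_one]
    field_simp
  have hdiff : Tendsto (fun n : ℕ => n * (linkedPgf n (m n) (Pn n : Measure (ℕ × ℝ)) z w -
      (B n ^ m n - (B n - C n) ^ m n))) atTop (𝓝 0) := by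
    refine squeeze_zero_norm' ?_ herr
    filter_upwards [eventually_ge_atTop 2] with n hn
    rw [norm_mul, Complex.norm_natCast]
    exact mul_le_mul_of_nonneg_left (hBC n hn).2.2.2.2 (Nat.cast_nonneg _)
  have := hdiff.add hmain
  rw [zero_add] at this
  exact this.congr fun n => by ring

end WeakLimit

section Bidegree

variable (n m : ℕ) (Q : Measure (ℕ × ℝ)) [IsProbabilityMeasure Q]

theorem measurableSet_adjEvent : MeasurableSet (adjEvent n m) :=
  measurableSet_model fun s => (fun k => (((0 : ℕ), (0 : ℝ)), s k)) ∈ adjEvent n m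

theorem measurableSet_deg_eq (s t : ℕ) :
    MeasurableSet {ω : Fin m → Layer n | deg ω 0 = s ∧ deg ω 1 = t} :=
  measurableSet_model fun σ => deg (fun k => (((0 : ℕ), (0 : ℝ)), σ k)) 0 = s ∧
    deg (fun k => (((0 : ℕ), (0 : ℝ)), σ k)) 1 = t

theorem linkedPgf_one_one : linkedPgf n m Q 1 1 = (modelMeasure n m Q).real (adjEvent n m) := by
  have h : (fun ω : Fin m → Layer n => if ω ∈ adjEvent n m then
      (1 : ℂ) ^ deg ω 0 * 1 ^ deg ω 1 else 0) = (adjEvent n m).indicator fun _ => (1 : ℂ) := by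
    ext ω
    simp [Set.indicator]
  unfold linkedPgf
  rw [h, integral_indicator (measurableSet_adjEvent n m)]
  simp

theorem bidegree_eq (s t : ℕ) : bidegree n m Q s t =
    ((modelMeasure n m Q).real (adjEvent n m))⁻¹ *
      ∫ ω, (if ω ∈ adjEvent n m ∧ deg ω 0 = s ∧ deg ω 1 = t then (1 : ℝ) else 0)
        ∂modelMeasure n m Q := by
  have hs := (measurableSet_adjEvent n m).inter (measurableSet_deg_eq n m s t)
  have h : (fun ω : Fin m → Layer n =>
      if ω ∈ adjEvent n m ∧ deg ω 0 = s ∧ deg ω 1 = t then (1 : ℝ) else 0) =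
      (adjEvent n m ∩ {ω | deg ω 0 = s ∧ deg ω 1 = t}).indicator fun _ => (1 : ℝ) := by
    ext ω
    simp [Set.indicator]
  rw [h, integral_indicator hs, bidegree, cond_apply (measurableSet_adjEvent n m)]
  simp [Measure.real]

theorem bidegree_nonneg (s t : ℕ) : 0 ≤ bidegree n m Q s t := ENNReal.toReal_nonneg

theorem hasSum_bidegree {z w : ℂ} (hz : ‖z‖ = 1) (hw : ‖w‖ = 1) :
    HasSum (fun u : ℕ × ℕ => (bidegree n m Q u.1 u.2 : ℂ) * z ^ u.1 * w ^ u.2)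
      (linkedPgf n m Q z w / linkedPgf n m Q 1 1) := by
  have hsum : ∀ (f : ℕ × ℕ → ℂ) (ω : Fin m → Layer n),
      HasSum (fun u : ℕ × ℕ => if ω ∈ adjEvent n m ∧ deg ω 0 = u.1 ∧ deg ω 1 = u.2 then f u else 0)
        (if ω ∈ adjEvent n m then f (deg ω 0, deg ω 1) else 0) := by
    intro f ω
    have h := hasSum_single (f := fun u : ℕ × ℕ =>
      if ω ∈ adjEvent n m ∧ deg ω 0 = u.1 ∧ deg ω 1 = u.2 then f u else 0) (deg ω 0, deg ω 1)
      (fun u hu => if_neg fun h => hu (Prod.ext h.2.1.symm h.2.2.symm))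
    simpa using h
  have hmix := hasSum_integral_mixture (P := modelMeasure n m Q)
    (k := fun (u : ℕ × ℕ) ω =>
      if ω ∈ adjEvent n m ∧ deg ω 0 = u.1 ∧ deg ω 1 = u.2 then (1 : ℝ) else 0)
    (K := fun ω => if ω ∈ adjEvent n m then (1 : ℝ) else 0)
    (c := fun u => z ^ u.1 * w ^ u.2)
    (Φ := fun ω => if ω ∈ adjEvent n m then z ^ deg ω 0 * w ^ deg ω 1 else 0)
    (fun u => (Measurable.ite ((measurableSet_adjEvent n m).inter
      (measurableSet_deg_eq n m u.1 u.2)) measurable_const measurable_const).aestronglyMeasurable)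
    (Eventually.of_forall fun ω u => by positivity)
    (Eventually.of_forall fun ω => by
      have := Complex.hasSum_re (hsum (fun _ => 1) ω)
      simpa [apply_ite Complex.re] using this)
    (integrable_model fun σ : Fin m → LayerGraph n =>
      if (fun k => (((0 : ℕ), (0 : ℝ)), σ k)) ∈ adjEvent n m then (1 : ℝ) else 0)
    (fun u => norm_pow_mul_pow hz hw _ _)
    (Eventually.of_forall fun ω => by
      refine hasSum_complex_congr (hsum (fun u => z ^ u.1 * w ^ u.2) ω) fun u => ?_
      split_ifs <;> simp)
  have h2 := hmix.mul_left (linkedPgf n m Q 1 1)⁻¹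
  rw [div_eq_inv_mul]
  refine hasSum_complex_congr h2 fun u => ?_
  rw [bidegree_eq, linkedPgf_one_one]
  push_cast
  ring

end Bidegree

theorem mul_le_conv2 {F G : ℕ → ℕ → ℝ} (hF : ∀ s t, 0 ≤ F s t) (hG : ∀ s t, 0 ≤ G s t)
    (i j a b : ℕ) : F i j * G a b ≤ conv2 F G (i + a) (j + b) := by
  have h0 : ∀ k l, 0 ≤ F k l * G (i + a - k) (j + b - l) := fun k l => mul_nonneg (hF _ _) (hG _ _)
  have h1 := Finset.single_le_sum (f := fun l => F i l * G (i + a - i) (j + b - l))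
    (fun l _ => h0 i l) (Finset.mem_range.2 (by omega : j < j + b + 1))
  have h2 := Finset.single_le_sum
    (f := fun k => ∑ l ∈ Finset.range (j + b + 1), F k l * G (i + a - k) (j + b - l))
    (fun k _ => Finset.sum_nonneg fun l _ => h0 k l) (Finset.mem_range.2 (by omega : i < i + a + 1))
  simpa [conv2] using h1.trans h2

theorem HasPgf.cpoi_pos {F : ℕ → ℝ} {φ : ℂ → ℂ} (hF : HasPgf F φ) {l : ℝ} (hl : 0 < l) {j s : ℕ}
    (h : 0 < _root_.convPow F j s) : 0 < _root_.cpoi l F s := by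
  have h0 : ∀ j, 0 ≤ Real.exp (-l) * l ^ j / (j.factorial : ℝ) * _root_.convPow F j s := fun j =>
    mul_nonneg (by positivity) ((hF.convPow j).nonneg s)
  have hle : ∀ j, _root_.convPow F j s ≤ ‖φ 1‖ ^ j := fun j => by
    have h1 := le_hasSum (hF.convPow j).hasSum_re s fun k _ => (hF.convPow j).nonneg k
    refine h1.trans ((Complex.re_le_norm _).trans ?_)
    rw [norm_pow]
  have hsum : Summable fun j : ℕ =>
      Real.exp (-l) * l ^ j / (j.factorial : ℝ) * _root_.convPow F j s := by
    refine Summable.of_nonneg_of_le h0 (fun j => ?_)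
      ((Real.summable_pow_div_factorial (l * ‖φ 1‖)).mul_left (Real.exp (-l)))
    refine (mul_le_mul_of_nonneg_left (hle j) (by positivity)).trans_eq ?_
    rw [mul_pow]
    ring
  exact hsum.tsum_pos h0 j (mul_pos (by positivity) h)

theorem conv_zero_right (F : ℕ → ℝ) (s : ℕ) : conv F (convPow F 0) s = F s := by
  unfold conv
  rw [Finset.sum_eq_single s]
  · simp [convPow]
  · intro i hi his
    have := Finset.mem_range.1 hi
    simp [convPow, show s - i ≠ 0 by omega]
  · simp

theorem binP_le_one {x : ℕ} {y : ℝ} (hy : y ∈ Set.Icc (0 : ℝ) 1) (s : ℕ) : binP x y s ≤ 1 := by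
  have h := le_hasSum (hasPgf_binP x hy).hasSum_re s fun k _ => binP_nonneg hy k
  simpa using h

section Nondegenerate

variable {P : Measure (ℕ × ℝ)}

theorem exists_gInc_pos (hP : ∀ᵐ p ∂P, p.2 ∈ Set.Icc (0 : ℝ) 1)
    (h_int : Integrable (fun p : ℕ × ℝ => (p.1 : ℝ)) P) (h10 : 0 < mom P 1 0)
    (h21 : 0 < mom P 2 1) : ∃ s, 1 ≤ s ∧ 0 < gInc P s := by
  by_contra! hcon
  have hz : ∀ s, 1 ≤ s → ∀ᵐ p ∂P, (p.1 : ℝ) * binP (p.1 - 1) p.2 s = 0 := by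
    intro s hs
    have h0 : 0 ≤ᵐ[P] fun p => (p.1 : ℝ) * binP (p.1 - 1) p.2 s := by
      filter_upwards [hP] with p hp
      exact mul_nonneg (Nat.cast_nonneg _) (binP_nonneg hp s)
    have hi : Integrable (fun p => (p.1 : ℝ) * binP (p.1 - 1) p.2 s) P := by
      refine h_int.mono' (measurable_of_continuous_snd fun x => ?_).aestronglyMeasurable ?_
      · have := continuous_binP (x - 1) s
        show Continuous fun y : ℝ => (x : ℝ) * binP (x - 1) y s
        fun_prop
      · filter_upwards [hP] with p hp
        rw [Real.norm_of_nonneg (mul_nonneg (Nat.cast_nonneg _) (binP_nonneg hp s))]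
        exact mul_le_of_le_one_right (Nat.cast_nonneg _) (binP_le_one hp s)
    have h1 := (hasPgf_gInc hP h_int).nonneg s
    have h2 : gInc P s = 0 := le_antisymm (hcon s hs) h1
    rw [gInc, div_eq_zero_iff, or_iff_left h10.ne', integral_eq_zero_iff_of_nonneg_ae h0 hi] at h2
    exact h2
  have hz' : ∀ᵐ p ∂P, ∀ s, 1 ≤ s → (p.1 : ℝ) * binP (p.1 - 1) p.2 s = 0 := by
    rw [ae_all_iff]
    intro s
    by_cases hs : 1 ≤ s
    · filter_upwards [hz s hs] with p hp _ using hp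
    · exact Eventually.of_forall fun p h => absurd h hs
  refine h21.ne' (integral_eq_zero_of_ae ?_)
  filter_upwards [hz'] with p hp
  by_cases hx : 2 ≤ p.1
  · have h := hp (p.1 - 1) (by omega)
    have hx' : (p.1 : ℝ) ≠ 0 := by norm_cast; omega
    simp [binP, hx'] at h
    simp [h.1]
  · have := Nat.descFactorial_of_lt (not_le.1 hx)
    simp only [this, Nat.cast_zero, zero_mul, Pi.zero_apply]

theorem exists_f2p_pos (hP : ∀ᵐ p ∂P, p.2 ∈ Set.Icc (0 : ℝ) 1)
    (h_int : Integrable (fun p : ℕ × ℝ => (p.1.descFactorial 2 : ℝ) * p.2) P)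
    (h21 : 0 < mom P 2 1) : ∃ a b, 0 < f2p P a b := by
  by_contra! hcon
  have h := hasPgf2_f2p hP h_int
  have h0 : ∀ a b, f2p P a b = 0 := fun a b => le_antisymm (hcon a b) (h.nonneg a b)
  have h1 := h.hasSum 1 1 (by simp) (by simp)
  have h2 : ∫ p, (p.1.descFactorial 2 : ℂ) * p.2 ∂P = (mom P 2 1 : ℂ) := by
    unfold mom
    rw [← integral_complex_ofReal]
    simp
  simp only [h0, Complex.ofReal_zero, mul_one, sub_add_cancel, one_pow, h2] at h1
  rw [div_self (by exact_mod_cast h21.ne')] at h1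
  exact zero_ne_one (hasSum_zero.unique h1)

theorem exists_barf2_pos {mu : ℝ} (hmu : 0 < mu) (hP : ∀ᵐ p ∂P, p.2 ∈ Set.Icc (0 : ℝ) 1)
    (hint10 : Integrable (fun p : ℕ × ℝ => (p.1 : ℝ)) P)
    (hint21 : Integrable (fun p : ℕ × ℝ => (p.1.descFactorial 2 : ℝ) * p.2) P)
    (h10 : 0 < mom P 1 0) (h21 : 0 < mom P 2 1) :
    ∃ u z : ℕ × ℕ, u.1 ≠ z.1 ∧ u.2 ≠ z.2 ∧ 0 < barf2 mu P u.1 u.2 ∧ 0 < barf2 mu P z.1 z.2 := by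
  obtain ⟨s, hs, hgs⟩ := exists_gInc_pos hP hint10 h10 h21
  obtain ⟨a, b, hab⟩ := exists_f2p_pos hP hint21 h21
  have hg := hasPgf_gInc hP hint10
  have hl : 0 < mu * mom P 1 0 := mul_pos hmu h10
  have h0 : ∀ t, 0 ≤ barf1 mu P t := (hg.cpoi hl.le).nonneg
  have hb0 : 0 < barf1 mu P 0 := hg.cpoi_pos hl (j := 0) (by simp [convPow])
  have hbs : 0 < barf1 mu P s := hg.cpoi_pos hl (j := 1) (by
    show 0 < conv (gInc P) (convPow (gInc P) 0) s
    rwa [conv_zero_right])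
  have hd : ∀ i j, 0 ≤ delta11 i j := fun i j => by unfold delta11; split_ifs <;> simp
  have hbb : ∀ i j, 0 ≤ barf1 mu P i * barf1 mu P j := fun i j => mul_nonneg (h0 i) (h0 j)
  have hc : ∀ i j, 0 ≤ conv2 delta11 (fun s t => barf1 mu P s * barf1 mu P t) i j := fun i j =>
    Finset.sum_nonneg fun _ _ => Finset.sum_nonneg fun _ _ => mul_nonneg (hd _ _) (hbb _ _)
  have key : ∀ t, 0 < barf1 mu P t → 0 < barf2 mu P (1 + t + a) (1 + t + b) := by
    intro t ht
    have h1 := mul_le_conv2 hd hbb 1 1 t t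
    have h2 := mul_le_conv2 hc (hasPgf2_f2p hP hint21).nonneg (1 + t) (1 + t) a b
    refine lt_of_lt_of_le (mul_pos (lt_of_lt_of_le ?_ h1) hab) h2
    simpa [delta11] using ht.ne'
  exact ⟨(1 + 0 + a, 1 + 0 + b), (1 + s + a, 1 + s + b), by simp; omega, by simp; omega,
    key 0 hb0, key s hbs⟩

end Nondegenerate

theorem ae_of_measure_eq_one {α : Type*} [MeasurableSpace α] {μ : Measure α}
    [IsProbabilityMeasure μ] {s : Set α} (hs : MeasurableSet s) (h : μ s = 1) :
    ∀ᵐ x ∂μ, x ∈ s :=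
  mem_ae_iff_prob_eq_one hs |>.2 h

theorem measurableSet_layerTypes (n : ℕ) :
    MeasurableSet {p : ℕ × ℝ | p.1 ≤ n ∧ p.2 ∈ Set.Icc (0 : ℝ) 1} :=
  (measurable_fst measurableSet_Iic).inter (measurable_snd measurableSet_Icc)

theorem layerEdgePgf_eq (Q : Measure (ℕ × ℝ)) (z w : ℂ) :
    layerEdgePgf Q z w = z * w * ∫ p, (p.1.descFactorial 2 : ℂ) * p.2 *
      (1 - p.2 + p.2 * z) ^ (p.1 - 2) * (1 - p.2 + p.2 * w) ^ (p.1 - 2) ∂Q := by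
  unfold layerEdgePgf
  rw [← integral_const_mul]
  refine integral_congr_ae (Eventually.of_forall fun p => ?_)
  simp only [Complex.real_smul, Complex.ofReal_natCast]
  ring

/-- **Theorem 5, Kendall's rank correlation** (Bloznelis–Karjalainen–Leskelä).
If `m/n → μ ∈ (0,∞)`, `P⁽ⁿ⁾ → P` weakly and `P⁽ⁿ⁾_{rs} → P_{rs} ∈ (0,∞)` for
`rs = 10, 21`, then `ρ_Ken(f_{2,n}) → ρ_Ken(\bar f₂)`. -/
theorem kendall_tendsto
    (mu : ℝ) (hmu : 0 < mu)
    (m : ℕ → ℕ) (hm : Tendsto m atTop atTop)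
    (hratio : Tendsto (fun n : ℕ => (m n : ℝ) / n) atTop (𝓝 mu))
    (Pn : ℕ → ProbabilityMeasure (ℕ × ℝ)) (P : ProbabilityMeasure (ℕ × ℝ))
    (hsupp : ∀ n, (Pn n : Measure (ℕ × ℝ)) {p : ℕ × ℝ | p.1 ≤ n ∧ p.2 ∈ Set.Icc (0:ℝ) 1} = 1)
    (hPsupp : (P : Measure (ℕ × ℝ)) {p : ℕ × ℝ | p.2 ∈ Set.Icc (0:ℝ) 1} = 1)
    (hweak : Tendsto Pn atTop (𝓝 P))
    (hint10 : Integrable (fun p : ℕ × ℝ => (p.1.descFactorial 1 : ℝ) * p.2 ^ (0:ℕ))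
      (P : Measure (ℕ × ℝ)))
    (hint21 : Integrable (fun p : ℕ × ℝ => (p.1.descFactorial 2 : ℝ) * p.2 ^ (1:ℕ))
      (P : Measure (ℕ × ℝ)))
    (h10pos : 0 < mom (P : Measure (ℕ × ℝ)) 1 0)
    (h21pos : 0 < mom (P : Measure (ℕ × ℝ)) 2 1)
    (h10 : Tendsto (fun n : ℕ => mom (Pn n : Measure (ℕ × ℝ)) 1 0) atTop
      (𝓝 (mom (P : Measure (ℕ × ℝ)) 1 0)))
    (h21 : Tendsto (fun n : ℕ => mom (Pn n : Measure (ℕ × ℝ)) 2 1) atTop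
      (𝓝 (mom (P : Measure (ℕ × ℝ)) 2 1))) :
    Tendsto (fun n : ℕ => kendall (bidegree n (m n) (Pn n : Measure (ℕ × ℝ)))) atTop
      (𝓝 (kendall (barf2 mu (P : Measure (ℕ × ℝ))))) := by
  have hs : ∀ n, ∀ᵐ p ∂(Pn n : Measure (ℕ × ℝ)), p.1 ≤ n ∧ p.2 ∈ Set.Icc (0 : ℝ) 1 := fun n =>
    ae_of_measure_eq_one (measurableSet_layerTypes n) (hsupp n)
  have hPs : ∀ᵐ p ∂(P : Measure (ℕ × ℝ)), p.2 ∈ Set.Icc (0 : ℝ) 1 :=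
    ae_of_measure_eq_one (measurable_snd measurableSet_Icc) hPsupp
  have hi10 : Integrable (fun p : ℕ × ℝ => (p.1 : ℝ)) (P : Measure (ℕ × ℝ)) := by
    simpa using hint10
  have hi21 : Integrable (fun p : ℕ × ℝ => (p.1.descFactorial 2 : ℝ) * p.2)
      (P : Measure (ℕ × ℝ)) := by simpa using hint21
  have hlim : ∀ z w : ℂ, ‖z‖ = 1 → ‖w‖ = 1 → _ := fun z w hz hw =>
    tendsto_nat_mul_linkedPgf hratio hweak hs hPs hi10 hint21 h10 h21 hz hw
  have hlim1 := hlim 1 1 (by simp) (by simp)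
  simp only [layerEdgePgf_one_one, layerPgf_one, add_zero, mul_zero, Complex.exp_zero,
    mul_one] at hlim1
  have hne : (mu * mom (P : Measure (ℕ × ℝ)) 2 1 : ℂ) ≠ 0 := by
    exact_mod_cast (mul_pos hmu h21pos).ne'
  have hne' : ∀ᶠ n : ℕ in atTop, linkedPgf n (m n) (Pn n : Measure (ℕ × ℝ)) 1 1 ≠ 0 :=
    (hlim1.eventually_ne hne).mono fun n hn => right_ne_zero_of_mul hn
  have hF0 : ∀ n s t, 0 ≤ bidegree n (m n) (Pn n : Measure (ℕ × ℝ)) s t := fun n s t =>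
    bidegree_nonneg n (m n) _ s t
  have hF : ∀ᶠ n : ℕ in atTop,
      HasSum (fun u : ℕ × ℕ => bidegree n (m n) (Pn n : Measure (ℕ × ℝ)) u.1 u.2) 1 := by
    filter_upwards [hne'] with n hn
    have h := hasSum_bidegree n (m n) (Pn n : Measure (ℕ × ℝ)) (z := 1) (w := 1) (by simp)
      (by simp)
    rw [div_self hn] at h
    simpa using Complex.hasSum_re h
  have hG := hasPgf2_barf2 hmu.le hPs hi10 h10pos hi21
  have hpgf : ∀ z w : ℂ, ‖z‖ = 1 → ‖w‖ = 1 →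
      HasSum (fun u : ℕ × ℕ => (barf2 mu (P : Measure (ℕ × ℝ)) u.1 u.2 : ℂ) * z ^ u.1 * w ^ u.2)
        (mu * layerEdgePgf (P : Measure (ℕ × ℝ)) z w * Complex.exp (mu *
          (layerPgf (P : Measure (ℕ × ℝ)) z + layerPgf (P : Measure (ℕ × ℝ)) w)) /
          (mu * mom (P : Measure (ℕ × ℝ)) 2 1)) := by
    intro z w hz hw
    convert hG.hasSum z w hz hw using 1
    have hmu' : (mu : ℂ) ≠ 0 := left_ne_zero_of_mul hne
    have h21' : (mom (P : Measure (ℕ × ℝ)) 2 1 : ℂ) ≠ 0 := right_ne_zero_of_mul hne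
    rw [← layerPgf_eq_sub hPs hi10 hz, ← layerPgf_eq_sub hPs hi10 hw, ← Complex.exp_add, ← mul_add,
      layerEdgePgf_eq]
    field_simp
  have hG1 : HasSum (fun u : ℕ × ℕ => barf2 mu (P : Measure (ℕ × ℝ)) u.1 u.2) 1 := by
    have h := hpgf 1 1 (by simp) (by simp)
    simp only [layerEdgePgf_one_one, layerPgf_one, add_zero, mul_zero, Complex.exp_zero,
      mul_one] at h
    rw [div_self hne] at h
    simpa using Complex.hasSum_re h
  obtain ⟨u, z, hu1, hu2, hu, hz⟩ := exists_barf2_pos hmu hPs hi10 hi21 h10pos h21pos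
  refine tendsto_kendall_of_tendsto_pmf (Eventually.of_forall hF0) hF hG.nonneg hG1
    (fun s t => ?_) hu1 hu2 hu hz
  refine tendsto_pmf_of_tendsto_pgf
    (F := fun n u => bidegree n (m n) (Pn n : Measure (ℕ × ℝ)) u.1 u.2)
    (G := fun u => barf2 mu (P : Measure (ℕ × ℝ)) u.1 u.2)
    (Eventually.of_forall fun n u => hF0 n u.1 u.2) hF (fun u => hG.nonneg u.1 u.2) hG1 ?_ (s, t)
  intro z w hz hw
  rw [(hpgf z w hz hw).tsum_eq]
  refine ((hlim z w hz hw).div hlim1 hne).congr' ?_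
  filter_upwards [eventually_ne_atTop 0] with n hn
  have hn' : (n : ℂ) ≠ 0 := by exact_mod_cast hn
  rw [(hasSum_bidegree n (m n) (Pn n : Measure (ℕ × ℝ)) hz hw).tsum_eq]
  exact mul_div_mul_left _ _ hn'
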